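/- arXiv:gr-qc/0006035 — 2 statements merged into one kernel-verified Lean document; each statement's English description precedes it below -/
import Mathlib

section
/- Let γ = 2 and let x = (Ω, Σ₊, Σ₋, N₁, N₂, N₃) be a solution of the Wainwright–Hsu system with Ω > 0. Then as τ → −∞ the solution converges to a type I point (Ω*, Σ₊*, Σ₋*, 0, 0, 0) with Σ₊*² + Σ₋*² < 1 (so Ω* = 1 − Σ₊*² − Σ₋*² > 0). In addition: (1) if the solution is of type II with N₁ > 0, then Σ₊* < 1/2; (2) if N₂ and N₃ are both nonzero and N₁ = 0 (type VI₀ or VII₀), then Σ₊* + √3·Σ₋* > −1 and Σ₊* − √3·Σ₋* > −1; (3) if the solution is of type VIII or IX, then Σ₊* < 1/2, Σ₊* + √3·Σ₋* > −1 and Σ₊* − √3·Σ₋* > −1. -/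
open Real Filter Topology Set

noncomputable section

namespace WainwrightHsu

/-- The deceleration parameter `q` of the Wainwright–Hsu system. -/
def qf (γ O Sp Sm : ℝ) : ℝ := (1/2) * (3*γ - 2) * O + 2 * (Sp^2 + Sm^2)

/-- The curvature term `S₊`. -/
def SPf (n1 n2 n3 : ℝ) : ℝ := (1/2) * ((n2 - n3)^2 - n1 * (2*n1 - n2 - n3))

/-- The curvature term `S₋`. -/
def SMf (n1 n2 n3 : ℝ) : ℝ := (Real.sqrt 3 / 2) * (n3 - n2) * (n1 - n2 - n3)

/-- The Hamiltonian constraint. -/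
def Constraint (O Sp Sm n1 n2 n3 : ℝ) : Prop :=
  O + Sp^2 + Sm^2 + (3/4) * (n1^2 + n2^2 + n3^2 - 2*(n1*n2 + n2*n3 + n3*n1)) = 1

/-- `(O, Sp, Sm, n1, n2, n3)` is a solution of the Wainwright–Hsu system (with
parameter `γ`) on the set `s ⊆ ℝ`, satisfying `Ω ≥ 0` and the constraint. -/
structure SolOn (γ : ℝ) (s : Set ℝ) (O Sp Sm n1 n2 n3 : ℝ → ℝ) : Prop where
  hn1 : ∀ τ ∈ s, HasDerivAt n1 ((qf γ (O τ) (Sp τ) (Sm τ) - 4 * Sp τ) * n1 τ) τ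
  hn2 : ∀ τ ∈ s, HasDerivAt n2
    ((qf γ (O τ) (Sp τ) (Sm τ) + 2 * Sp τ + 2 * Real.sqrt 3 * Sm τ) * n2 τ) τ
  hn3 : ∀ τ ∈ s, HasDerivAt n3
    ((qf γ (O τ) (Sp τ) (Sm τ) + 2 * Sp τ - 2 * Real.sqrt 3 * Sm τ) * n3 τ) τ
  hSp : ∀ τ ∈ s, HasDerivAt Sp
    (-(2 - qf γ (O τ) (Sp τ) (Sm τ)) * Sp τ - 3 * SPf (n1 τ) (n2 τ) (n3 τ)) τ
  hSm : ∀ τ ∈ s, HasDerivAt Sm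
    (-(2 - qf γ (O τ) (Sp τ) (Sm τ)) * Sm τ - 3 * SMf (n1 τ) (n2 τ) (n3 τ)) τ
  hO : ∀ τ ∈ s, HasDerivAt O ((2 * qf γ (O τ) (Sp τ) (Sm τ) - (3*γ - 2)) * O τ) τ
  hOnn : ∀ τ ∈ s, 0 ≤ O τ
  hcon : ∀ τ ∈ s, Constraint (O τ) (Sp τ) (Sm τ) (n1 τ) (n2 τ) (n3 τ)

/-- The solution is of Taub type. -/
def TaubType (s : Set ℝ) (Sp Sm n1 n2 n3 : ℝ → ℝ) : Prop :=
  (∀ τ ∈ s, Sm τ = 0 ∧ n2 τ = n3 τ) ∨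
  (∀ τ ∈ s, Sm τ = -(Real.sqrt 3) * Sp τ ∧ n1 τ = n2 τ) ∨
  (∀ τ ∈ s, Sm τ = Real.sqrt 3 * Sp τ ∧ n3 τ = n1 τ)

/-- The solution converges to the fixed point `F` as `τ → -∞`. -/
def TendstoF (O Sp Sm n1 n2 n3 : ℝ → ℝ) : Prop :=
  Tendsto O atBot (𝓝 1) ∧ Tendsto Sp atBot (𝓝 0) ∧ Tendsto Sm atBot (𝓝 0) ∧
  Tendsto n1 atBot (𝓝 0) ∧ Tendsto n2 atBot (𝓝 0) ∧ Tendsto n3 atBot (𝓝 0)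

/-- The solution converges to the fixed point `P₁⁺(II)` as `τ → -∞`. -/
def TendstoP1 (γ : ℝ) (O Sp Sm n1 n2 n3 : ℝ → ℝ) : Prop :=
  Tendsto O atBot (𝓝 (1 - (3*γ - 2)/16)) ∧
  Tendsto Sp atBot (𝓝 ((3*γ - 2)/8)) ∧ Tendsto Sm atBot (𝓝 0) ∧
  (∃ c : ℝ, 0 < c ∧ Tendsto n1 atBot (𝓝 c)) ∧
  Tendsto n2 atBot (𝓝 0) ∧ Tendsto n3 atBot (𝓝 0)

/-- The solution converges to the fixed point `P₂⁺(II)` as `τ → -∞`. -/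
def TendstoP2 (γ : ℝ) (O Sp Sm n1 n2 n3 : ℝ → ℝ) : Prop :=
  Tendsto O atBot (𝓝 (1 - (3*γ - 2)/16)) ∧
  Tendsto Sp atBot (𝓝 (-((3*γ - 2)/16))) ∧
  Tendsto Sm atBot (𝓝 (-(Real.sqrt 3 * (3*γ - 2)/16))) ∧
  Tendsto n1 atBot (𝓝 0) ∧
  (∃ c : ℝ, 0 < c ∧ Tendsto n2 atBot (𝓝 c)) ∧ Tendsto n3 atBot (𝓝 0)

/-- The solution converges to the fixed point `P₃⁺(II)` as `τ → -∞`. -/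
def TendstoP3 (γ : ℝ) (O Sp Sm n1 n2 n3 : ℝ → ℝ) : Prop :=
  Tendsto O atBot (𝓝 (1 - (3*γ - 2)/16)) ∧
  Tendsto Sp atBot (𝓝 (-((3*γ - 2)/16))) ∧
  Tendsto Sm atBot (𝓝 (Real.sqrt 3 * (3*γ - 2)/16)) ∧
  Tendsto n1 atBot (𝓝 0) ∧ Tendsto n2 atBot (𝓝 0) ∧
  (∃ c : ℝ, 0 < c ∧ Tendsto n3 atBot (𝓝 c))

/-- A Bianchi IX solution is generic if it is not of Taub type and does not
converge to `F` nor to any of the `Pᵢ⁺(II)` as `τ → -∞`. -/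
def Generic (γ : ℝ) (s : Set ℝ) (O Sp Sm n1 n2 n3 : ℝ → ℝ) : Prop :=
  ¬ TaubType s Sp Sm n1 n2 n3 ∧ ¬ TendstoF O Sp Sm n1 n2 n3 ∧
  ¬ TendstoP1 γ O Sp Sm n1 n2 n3 ∧ ¬ TendstoP2 γ O Sp Sm n1 n2 n3 ∧
  ¬ TendstoP3 γ O Sp Sm n1 n2 n3

/-- `(a, b, c, d, e, f)` is an α-limit point of the solution:
some sequence of times tending to `-∞` along which the solution converges to it. -/
def AlphaLim (O Sp Sm n1 n2 n3 : ℝ → ℝ) (a b c d e f : ℝ) : Prop :=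
  ∃ τs : ℕ → ℝ, Tendsto τs atTop atBot ∧
    Tendsto (fun k => O (τs k)) atTop (𝓝 a) ∧
    Tendsto (fun k => Sp (τs k)) atTop (𝓝 b) ∧
    Tendsto (fun k => Sm (τs k)) atTop (𝓝 c) ∧
    Tendsto (fun k => n1 (τs k)) atTop (𝓝 d) ∧
    Tendsto (fun k => n2 (τs k)) atTop (𝓝 e) ∧
    Tendsto (fun k => n3 (τs k)) atTop (𝓝 f)

/-- ω-limit point (times tending to `+∞`). -/
def OmegaLim (O Sp Sm n1 n2 n3 : ℝ → ℝ) (a b c d e f : ℝ) : Prop :=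
  ∃ τs : ℕ → ℝ, Tendsto τs atTop atTop ∧
    Tendsto (fun k => O (τs k)) atTop (𝓝 a) ∧
    Tendsto (fun k => Sp (τs k)) atTop (𝓝 b) ∧
    Tendsto (fun k => Sm (τs k)) atTop (𝓝 c) ∧
    Tendsto (fun k => n1 (τs k)) atTop (𝓝 d) ∧
    Tendsto (fun k => n2 (τs k)) atTop (𝓝 e) ∧
    Tendsto (fun k => n3 (τs k)) atTop (𝓝 f)

/-- α-limit point, phrased for a point of `ℝ⁶` (in coordinates `Ω, Σ₊, Σ₋, N₁, N₂, N₃`). -/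
def AlphaLimPt (O Sp Sm n1 n2 n3 : ℝ → ℝ) (p : Fin 6 → ℝ) : Prop :=
  ∃ τs : ℕ → ℝ, Tendsto τs atTop atBot ∧
    Tendsto (fun k =>
      (![O (τs k), Sp (τs k), Sm (τs k), n1 (τs k), n2 (τs k), n3 (τs k)] : Fin 6 → ℝ))
      atTop (𝓝 p)

/-- A non-special point of the Kasner circle, given by its `(Σ₊, Σ₋)` coordinates. -/
def NonSpecialKasner (a b : ℝ) : Prop :=
  a^2 + b^2 = 1 ∧ (a, b) ≠ (-1, 0) ∧
  (a, b) ≠ (1/2, Real.sqrt 3 / 2) ∧ (a, b) ≠ (1/2, -(Real.sqrt 3) / 2)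

/-- The state vector of a solution, as a point of Euclidean `ℝ⁶`. -/
def stateVec (O Sp Sm n1 n2 n3 : ℝ → ℝ) (τ : ℝ) : EuclideanSpace ℝ (Fin 6) :=
  (WithLp.equiv 2 (Fin 6 → ℝ)).symm ![O τ, Sp τ, Sm τ, n1 τ, n2 τ, n3 τ]

/-- The Bianchi attractor `𝒜`: the closure of the vacuum type I and II points, i.e. the
points of `ℝ⁶` satisfying the constraint with `Ω = 0` and `N₁N₂ = N₂N₃ = N₃N₁ = 0`. -/
def attractor : Set (EuclideanSpace ℝ (Fin 6)) :=
  {y | Constraint (y 0) (y 1) (y 2) (y 3) (y 4) (y 5) ∧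
    y 0 = 0 ∧ y 3 * y 4 = 0 ∧ y 4 * y 5 = 0 ∧ y 5 * y 3 = 0}



lemma mono_Iic {f f' : ℝ → ℝ} {T : ℝ} (hf : ∀ τ ≤ T, HasDerivAt f (f' τ) τ)
    (h0 : ∀ τ ≤ T, 0 ≤ f' τ) {a b : ℝ} (hab : a ≤ b) (hb : b ≤ T) : f a ≤ f b := by
  have hm : MonotoneOn f (Set.Iic T) := by
    apply monotoneOn_of_deriv_nonneg (convex_Iic T)
    · intro x hx
      exact (hf x hx).continuousAt.continuousWithinAt
    · intro x hx
      rw [interior_Iic] at hx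
      exact (hf x (le_of_lt hx)).differentiableAt.differentiableWithinAt
    · intro x hx
      rw [interior_Iic] at hx
      rw [(hf x (le_of_lt hx)).deriv]
      exact h0 x (le_of_lt hx)
  exact hm (show a ≤ T from hab.trans hb) hb hab

lemma anti_Iic {f f' : ℝ → ℝ} {T : ℝ} (hf : ∀ τ ≤ T, HasDerivAt f (f' τ) τ)
    (h0 : ∀ τ ≤ T, f' τ ≤ 0) {a b : ℝ} (hab : a ≤ b) (hb : b ≤ T) : f b ≤ f a := by
  have := mono_Iic (f := fun τ => -f τ) (f' := fun τ => -f' τ) (T := T)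
    (fun τ h => (hf τ h).neg) (fun τ h => by have := h0 τ h; linarith) hab hb
  linarith

lemma conv_of_mono {f : ℝ → ℝ} {T m : ℝ}
    (hm : ∀ a b, a ≤ b → b ≤ T → f a ≤ f b) (hb : ∀ τ ≤ T, m ≤ f τ) :
    ∃ l, Tendsto f atBot (𝓝 l) := by
  have hmon : Monotone (fun τ => f (min τ T)) := fun a b hab =>
    hm _ _ (min_le_min_right T hab) (min_le_right _ _)
  have hbdd : BddBelow (Set.range (fun τ => f (min τ T))) := by
    refine ⟨m, ?_⟩
    rintro _ ⟨τ, rfl⟩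
    exact hb _ (min_le_right _ _)
  refine ⟨_, (tendsto_atBot_ciInf hmon hbdd).congr' ?_⟩
  filter_upwards [eventually_le_atBot T] with τ hτ
  simp [min_eq_left hτ]

lemma conv_of_ctrl {g g' E E' : ℝ → ℝ} {T b e A : ℝ} (hA : 0 ≤ A)
    (hE : ∀ τ ≤ T, HasDerivAt E (E' τ) τ) (hE0 : ∀ τ ≤ T, 0 ≤ E' τ) (hEb : ∀ τ ≤ T, e ≤ E τ)
    (hg : ∀ τ ≤ T, HasDerivAt g (g' τ) τ) (hg0 : ∀ τ ≤ T, -(A * E' τ) ≤ g' τ)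
    (hgb : ∀ τ ≤ T, b ≤ g τ) : ∃ l, Tendsto g atBot (𝓝 l) := by
  obtain ⟨l1, h1⟩ := conv_of_mono (f := E) (T := T) (m := e)
    (fun a b hab hb => mono_Iic hE hE0 hab hb) hEb
  obtain ⟨l2, h2⟩ := conv_of_mono (f := fun τ => g τ + A * E τ) (T := T) (m := b + A * e)
    (fun a b hab hb => mono_Iic (f := fun τ => g τ + A * E τ) (f' := fun τ => g' τ + A * E' τ)
      (fun τ h => (hg τ h).add ((hE τ h).const_mul A))
      (fun τ h => by have := hg0 τ h; linarith) hab hb)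
    (fun τ h => add_le_add (hgb τ h) (mul_le_mul_of_nonneg_left (hEb τ h) hA))
  refine ⟨l2 - A * l1, (h2.sub (h1.const_mul A)).congr ?_⟩
  intro τ
  ring

lemma quad_pos_ordered {x y z : ℝ} (hxy : y ≤ x) (hyz : z ≤ y) (hz : 0 < z)
    (hQ : x^2 + y^2 + z^2 - 2*(x*y + y*z + z*x) < 0) :
    (-(x^2 + y^2 + z^2 - 2*(x*y + y*z + z*x)))^3 ≤ 1600 * (x*y*z)^2 := by
  have hy : x ≤ 5 * y := by
    by_contra h
    push Not at h
    nlinarith [mul_pos hz hz, mul_nonneg (sub_nonneg.2 hyz) hz.le,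
      mul_pos (sub_pos.2 h) (by linarith : (0:ℝ) < x), mul_pos (sub_pos.2 h) (by linarith : (0:ℝ) < y),
      mul_nonneg (sub_nonneg.2 hyz) (by linarith : (0:ℝ) ≤ x),
      mul_nonneg (sub_nonneg.2 hyz) (by linarith : (0:ℝ) ≤ y)]
  have h1 : -(x^2 + y^2 + z^2 - 2*(x*y + y*z + z*x)) ≤ 4 * (z * x) := by
    nlinarith [sq_nonneg (x - y), mul_nonneg (sub_nonneg.2 hxy) hz.le, sq_nonneg z]
  have h2 := pow_le_pow_left₀ (by linarith : 0 ≤ -(x^2 + y^2 + z^2 - 2*(x*y + y*z + z*x))) h1 3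
  refine h2.trans ?_
  have h3 : z * x ≤ 25 * y^2 := by nlinarith
  have h4 : 0 ≤ (z*x)^2 := sq_nonneg _
  nlinarith [mul_le_mul_of_nonneg_left h3 h4]

lemma quad_pos {x y z : ℝ} (hx : 0 < x) (hy : 0 < y) (hz : 0 < z)
    (hQ : x^2 + y^2 + z^2 - 2*(x*y + y*z + z*x) < 0) :
    (-(x^2 + y^2 + z^2 - 2*(x*y + y*z + z*x)))^3 ≤ 1600 * (x*y*z)^2 := by
  rcases le_total x y with h1 | h1 <;> rcases le_total y z with h2 | h2 <;>
    rcases le_total x z with h3 | h3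
  · convert quad_pos_ordered h2 h1 hx (by linarith) using 2 <;> ring
  · convert quad_pos_ordered h2 h1 hx (by linarith) using 2 <;> ring
  · convert quad_pos_ordered h2 h3 hx (by linarith) using 2 <;> ring
  · convert quad_pos_ordered h1 h3 hz (by linarith) using 2 <;> ring
  · convert quad_pos_ordered h3 h1 hy (by linarith) using 2 <;> ring
  · convert quad_pos_ordered h3 h2 hy (by linarith) using 2 <;> ring
  · convert quad_pos_ordered h1 h2 hz (by linarith) using 2 <;> ring
  · convert quad_pos_ordered h1 h2 hz (by linarith) using 2 <;> ring

lemma quad_one_neg {x y z : ℝ} (hx : x ≤ 0) (hy : 0 ≤ y) (hz : 0 ≤ z) :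
    0 ≤ x^2 + y^2 + z^2 - 2*(x*y + y*z + z*x) := by
  nlinarith [sq_nonneg (y - z), mul_nonneg (neg_nonneg.2 hx) hy, mul_nonneg (neg_nonneg.2 hx) hz]

lemma quad_all {x y z : ℝ}
    (hQ : x^2 + y^2 + z^2 - 2*(x*y + y*z + z*x) < 0) :
    (-(x^2 + y^2 + z^2 - 2*(x*y + y*z + z*x)))^3 ≤ 1600 * (x*y*z)^2 := by
  rcases le_or_gt x 0 with hx | hx <;> rcases le_or_gt y 0 with hy | hy <;>
    rcases le_or_gt z 0 with hz | hz
  · rcases eq_or_lt_of_le hx with h | hx'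
    · have := quad_one_neg (x := -x) (y := -y) (z := -z) (by linarith) (by linarith) (by linarith)
      linarith
    rcases eq_or_lt_of_le hy with h | hy'
    · have := quad_one_neg (x := -y) (y := -z) (z := -x) (by linarith) (by linarith) (by linarith)
      linarith
    rcases eq_or_lt_of_le hz with h | hz'
    · have := quad_one_neg (x := -z) (y := -x) (z := -y) (by linarith) (by linarith) (by linarith)
      linarith
    convert quad_pos (x := -x) (y := -y) (z := -z) (by linarith) (by linarith) (by linarith)
      (by linarith) using 2 <;> ring
  · have := quad_one_neg (x := -z) (y := -x) (z := -y) (by linarith) (by linarith) (by linarith)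
    linarith
  · have := quad_one_neg (x := -y) (y := -z) (z := -x) (by linarith) (by linarith) (by linarith)
    linarith
  · have := quad_one_neg (x := x) (y := y) (z := z) (by linarith) (by linarith) (by linarith)
    linarith
  · have := quad_one_neg (x := -x) (y := -y) (z := -z) (by linarith) (by linarith) (by linarith)
    linarith
  · have := quad_one_neg (x := y) (y := z) (z := x) (by linarith) (by linarith) (by linarith)
    linarith
  · have := quad_one_neg (x := z) (y := x) (z := y) (by linarith) (by linarith) (by linarith)
    linarith
  · exact quad_pos hx hy hz hQ

/-- If `(xyz)² ≤ w³` then the curvature form is at least `-12 w`. -/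
lemma quad_lower {x y z w : ℝ} (hw : 0 ≤ w) (hP : (x*y*z)^2 ≤ w^3) :
    -(12 * w) ≤ x^2 + y^2 + z^2 - 2*(x*y + y*z + z*x) := by
  by_contra h
  push Not at h
  have h1 := quad_all (x := x) (y := y) (z := z) (by linarith)
  have h2 : 12 * w < -(x^2 + y^2 + z^2 - 2*(x*y + y*z + z*x)) := by linarith
  have h3 := pow_lt_pow_left₀ h2 (by linarith) (by norm_num : (3:ℕ) ≠ 0)
  have h4 : 0 ≤ w^3 := by positivity
  nlinarith

/-- The curvature scalar. -/
def Kf (a b c : ℝ) : ℝ := (3/4) * (a^2 + b^2 + c^2 - 2*(a*b + b*c + c*a))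

/-- Cyclic permutation symmetry. -/
lemma SolOn.rot {s : Set ℝ} {O Sp Sm n1 n2 n3 : ℝ → ℝ} (h : SolOn 2 s O Sp Sm n1 n2 n3) :
    SolOn 2 s O (fun τ => -(Sp τ + Real.sqrt 3 * Sm τ)/2)
      (fun τ => (Real.sqrt 3 * Sp τ - Sm τ)/2) n2 n3 n1 := by
  have r3 : Real.sqrt 3 ^ 2 = 3 := Real.sq_sqrt (by norm_num)
  have hq : ∀ τ, qf 2 (O τ) (-(Sp τ + Real.sqrt 3 * Sm τ)/2) ((Real.sqrt 3 * Sp τ - Sm τ)/2)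
      = qf 2 (O τ) (Sp τ) (Sm τ) := by
    intro τ
    unfold qf
    linear_combination ((Sp τ)^2 + (Sm τ)^2)/2 * r3
  constructor
  · intro τ hτ
    refine HasDerivAt.congr_deriv (h.hn2 τ hτ) ?_
    rw [hq]
    ring
  · intro τ hτ
    refine HasDerivAt.congr_deriv (h.hn3 τ hτ) ?_
    rw [hq]
    linear_combination -Sp τ * n3 τ * r3
  · intro τ hτ
    refine HasDerivAt.congr_deriv (h.hn1 τ hτ) ?_
    rw [hq]
    linear_combination Sp τ * n1 τ * r3
  · intro τ hτ
    refine HasDerivAt.congr_deriv ((((h.hSp τ hτ).add ((h.hSm τ hτ).const_mul (Real.sqrt 3))).neg).div_const 2) ?_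
    simp only [hq, SPf, SMf]
    linear_combination ((3/4) * (n3 τ - n2 τ) * (n1 τ - n2 τ - n3 τ)) * r3
  · intro τ hτ
    refine HasDerivAt.congr_deriv ((((h.hSp τ hτ).const_mul (Real.sqrt 3)).sub (h.hSm τ hτ)).div_const 2) ?_
    simp only [hq, SPf, SMf]
    ring
  · intro τ hτ
    refine HasDerivAt.congr_deriv (h.hO τ hτ) ?_
    rw [hq]
  · exact h.hOnn
  · intro τ hτ
    have := h.hcon τ hτ
    unfold Constraint at this ⊢
    linear_combination this + ((Sp τ)^2 + (Sm τ)^2)/4 * r3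

lemma sp_lt_half {O Sp Sm n1 n2 n3 : ℝ → ℝ} {sp sm : ℝ}
    (h : SolOn 2 (Set.Iic 0) O Sp Sm n1 n2 n3)
    (hO : ∀ τ ∈ Set.Iic (0:ℝ), 0 < O τ) (hlt : sp^2 + sm^2 < 1)
    (tSp : Tendsto Sp atBot (𝓝 sp)) (tSm : Tendsto Sm atBot (𝓝 sm))
    (tO : Tendsto O atBot (𝓝 (1 - sp^2 - sm^2)))
    (t1 : Tendsto n1 atBot (𝓝 0)) (t2 : Tendsto n2 atBot (𝓝 0)) (t3 : Tendsto n3 atBot (𝓝 0))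
    (hn : ∀ τ ∈ Set.Iic (0:ℝ), n1 τ ≠ 0) : sp < 1/2 := by
  by_contra hsp
  push Not at hsp
  have r3 : Real.sqrt 3 ^ 2 = 3 := Real.sq_sqrt (by norm_num)
  set r := Real.sqrt 3 with hr
  have hsp1 : sp < 1 := by nlinarith [sq_nonneg sm]
  have hsm : (r * sm)^2 < (1 + sp)^2 := by
    rw [mul_pow, r3]
    nlinarith
  obtain ⟨ha, hb⟩ := abs_lt.1 (abs_lt_of_sq_lt_sq hsm (by linarith))
  have tq : Tendsto (fun τ => qf 2 (O τ) (Sp τ) (Sm τ)) atBot (𝓝 2) := by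
    have := (tO.const_mul ((1/2) * (3*(2:ℝ) - 2))).add (((tSp.pow 2).add (tSm.pow 2)).const_mul 2)
    have e : (1/2) * (3*(2:ℝ) - 2) * (1 - sp^2 - sm^2) + 2 * (sp^2 + sm^2) = 2 := by ring
    rw [e] at this
    exact this
  obtain ⟨c, hc0, hc1, hc2⟩ : ∃ c : ℝ, 0 < c ∧ c < 2 + 2*sp + 2*r*sm ∧ c < 2 + 2*sp - 2*r*sm := by
    refine ⟨min (2 + 2*sp + 2*r*sm) (2 + 2*sp - 2*r*sm) / 2, ?_, ?_, ?_⟩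
    · have : 0 < min (2 + 2*sp + 2*r*sm) (2 + 2*sp - 2*r*sm) := lt_min (by linarith) (by linarith)
      linarith
    · have := min_le_left (2 + 2*sp + 2*r*sm) (2 + 2*sp - 2*r*sm)
      linarith
    · have := min_le_right (2 + 2*sp + 2*r*sm) (2 + 2*sp - 2*r*sm)
      linarith
  have e1 := ((tq.add (tSp.const_mul 2)).add (tSm.const_mul (2*r))).eventually (lt_mem_nhds hc1)
  have e2 := ((tq.add (tSp.const_mul 2)).sub (tSm.const_mul (2*r))).eventually (lt_mem_nhds hc2)
  have e3 := tSp.eventually (gt_mem_nhds hsp1)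
  have e4 := tSp.eventually (lt_mem_nhds (by linarith : (0:ℝ) < sp))
  obtain ⟨T, hT⟩ := eventually_atBot.1
    (e1.and (e2.and (e3.and (e4.and (eventually_le_atBot (0:ℝ))))))
  set M' : ℝ → ℝ := fun τ =>
    2 * (qf 2 (O τ) (Sp τ) (Sm τ) + 2 * Sp τ + 2 * r * Sm τ) * n2 τ ^ 2 +
    2 * (qf 2 (O τ) (Sp τ) (Sm τ) + 2 * Sp τ - 2 * r * Sm τ) * n3 τ ^ 2 with hM'
  have dM : ∀ τ ≤ T, HasDerivAt (fun τ => n2 τ ^ 2 + n3 τ ^ 2) (M' τ) τ := by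
    intro τ hτ
    have h0 := (hT τ hτ).2.2.2.2
    refine HasDerivAt.congr_deriv (((h.hn2 τ h0).pow 2).add ((h.hn3 τ h0).pow 2)) ?_
    simp only [hM', hr, Nat.cast_ofNat]
    push_cast
    ring
  have hMge : ∀ τ ≤ T, 2 * c * (n2 τ ^ 2 + n3 τ ^ 2) ≤ M' τ := by
    intro τ hτ
    obtain ⟨a1, a2, -⟩ := hT τ hτ
    simp only [hM']
    nlinarith [mul_le_mul_of_nonneg_right a1.le (sq_nonneg (n2 τ)),
      mul_le_mul_of_nonneg_right a2.le (sq_nonneg (n3 τ))]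
  have hcon : ∀ τ ≤ T, 2 - qf 2 (O τ) (Sp τ) (Sm τ) = 2 * Kf (n1 τ) (n2 τ) (n3 τ) := by
    intro τ hτ
    have := h.hcon τ (hT τ hτ).2.2.2.2
    unfold Constraint at this
    unfold qf Kf
    linear_combination -2 * this
  set A := 13 / (2*c) with hA
  have hAc : A * (2 * c) = 13 := by rw [hA]; field_simp
  have hA0 : 0 < A := by positivity
  have hSp' : ∀ τ ≤ T, -(13 * (n2 τ ^ 2 + n3 τ ^ 2)) ≤
      -(2 - qf 2 (O τ) (Sp τ) (Sm τ)) * Sp τ - 3 * SPf (n1 τ) (n2 τ) (n3 τ) := by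
    intro τ hτ
    rw [hcon τ hτ]
    obtain ⟨-, -, a3, a4, -⟩ := hT τ hτ
    unfold Kf SPf
    generalize n1 τ = x at *
    generalize n2 τ = y at *
    generalize n3 τ = z at *
    generalize Sp τ = s at *
    have k1 : 0 ≤ x^2 * (1 - s) := mul_nonneg (sq_nonneg _) (by linarith)
    have k2 : 0 ≤ (y - z)^2 * (1 - s) := mul_nonneg (sq_nonneg _) (by linarith)
    have k3 : 0 ≤ (x + (y+z))^2 * s := mul_nonneg (sq_nonneg _) (by linarith)
    have k4 : 0 ≤ (x - (y+z))^2 * (1 - s) := mul_nonneg (sq_nonneg _) (by linarith)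
    have k5 : 0 ≤ (y+z)^2 * (1-s) := mul_nonneg (sq_nonneg _) (by linarith)
    have k6 : 0 ≤ (y+z)^2 * s := mul_nonneg (sq_nonneg _) (by linarith)
    nlinarith [sq_nonneg (y - z), sq_nonneg (y+z), sq_nonneg x]
  have hW : ∀ τ ≤ T, sp ≤ Sp τ + A * (n2 τ ^ 2 + n3 τ ^ 2) := by
    intro τ hτ
    have tW : Tendsto (fun τ => Sp τ + A * (n2 τ ^ 2 + n3 τ ^ 2)) atBot (𝓝 sp) := by
      convert tSp.add (((t2.pow 2).add (t3.pow 2)).const_mul A) using 2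
      ring
    refine le_of_tendsto tW ?_
    filter_upwards [eventually_le_atBot τ] with a ha'
    refine mono_Iic (f := fun τ => Sp τ + A * (n2 τ ^ 2 + n3 τ ^ 2))
      (f' := fun τ => (-(2 - qf 2 (O τ) (Sp τ) (Sm τ)) * Sp τ - 3 * SPf (n1 τ) (n2 τ) (n3 τ))
        + A * M' τ) (T := T) ?_ ?_ ha' hτ
    · intro t ht
      exact (h.hSp t (hT t ht).2.2.2.2).add ((dM t ht).const_mul A)
    · intro t ht
      have b1 := hSp' t ht
      have b2 := mul_le_mul_of_nonneg_left (hMge t ht) hA0.le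
      have b3 : A * (2 * c * (n2 t ^ 2 + n3 t ^ 2)) = 13 * (n2 t ^ 2 + n3 t ^ 2) := by
        rw [← hAc]; ring
      linarith
  set B := 4 * A / c with hB
  have hBc : B * (2 * c) = 8 * A := by rw [hB]; field_simp; ring
  have hB0 : 0 < B := by positivity
  have dV : ∀ τ ≤ T, HasDerivAt (fun τ => n1 τ ^ 2 / O τ) ((4 - 8 * Sp τ) * (n1 τ ^ 2 / O τ)) τ := by
    intro τ hτ
    have h0 := (hT τ hτ).2.2.2.2
    have hOp := hO τ h0
    refine HasDerivAt.congr_deriv (((h.hn1 τ h0).pow 2).div (h.hO τ h0) hOp.ne') ?_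
    simp only [Pi.pow_apply]
    push_cast
    field_simp
    ring
  have dZ : ∀ τ ≤ T, HasDerivAt (fun τ => n1 τ ^ 2 / O τ * Real.exp (-B * (n2 τ ^ 2 + n3 τ ^ 2)))
      ((4 - 8 * Sp τ - B * M' τ) * (n1 τ ^ 2 / O τ * Real.exp (-B * (n2 τ ^ 2 + n3 τ ^ 2)))) τ := by
    intro τ hτ
    refine HasDerivAt.congr_deriv ((dV τ hτ).mul ((dM τ hτ).const_mul (-B)).exp) ?_
    ring
  have hZ0 : n1 T ^ 2 / O T * Real.exp (-B * (n2 T ^ 2 + n3 T ^ 2)) ≤ 0 := by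
    have tZ : Tendsto (fun τ => n1 τ ^ 2 / O τ * Real.exp (-B * (n2 τ ^ 2 + n3 τ ^ 2)))
        atBot (𝓝 0) := by
      have := ((t1.pow 2).div tO (by linarith)).mul
        ((((t2.pow 2).add (t3.pow 2)).const_mul (-B)).rexp)
      have e : (0:ℝ)^2 / (1 - sp^2 - sm^2) * Real.exp (-B * (0^2 + 0^2)) = 0 := by simp
      rw [e] at this
      exact this
    refine ge_of_tendsto tZ ?_
    filter_upwards [eventually_le_atBot T] with a ha'
    refine anti_Iic dZ ?_ ha' le_rfl
    intro t ht
    have hOp := hO t (hT t ht).2.2.2.2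
    have b1 := hW t ht
    have b2 := mul_le_mul_of_nonneg_left (hMge t ht) hB0.le
    have b3 : B * (2 * c * (n2 t ^ 2 + n3 t ^ 2)) = 8 * A * (n2 t ^ 2 + n3 t ^ 2) := by
      rw [← hBc]; ring
    apply mul_nonpos_of_nonpos_of_nonneg
    · linarith
    · positivity
  have h0 := (hT T le_rfl).2.2.2.2
  have hOp := hO T h0
  have hn1 := hn T h0
  have : 0 < n1 T ^ 2 / O T * Real.exp (-B * (n2 T ^ 2 + n3 T ^ 2)) := by positivity
  linarith

lemma decay_of_rate {f ρ : ℝ → ℝ} {T d : ℝ} (hf : ∀ τ ≤ T, HasDerivAt f (ρ τ * f τ) τ)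
    (hρ : ∀ τ ≤ T, d ≤ ρ τ) (h0 : ∀ τ ≤ T, 0 ≤ f τ) :
    ∃ C, 0 ≤ C ∧ ∀ τ ≤ T, f τ ≤ C * Real.exp (d * τ) := by
  refine ⟨f T * Real.exp (-d * T), mul_nonneg (h0 T le_rfl) (Real.exp_pos _).le, ?_⟩
  intro τ hτ
  have key := mono_Iic (f := fun τ => f τ * Real.exp (-d * τ))
    (f' := fun τ => (ρ τ - d) * (f τ * Real.exp (-d * τ))) (T := T) ?_ ?_ hτ le_rfl
  · have h1 := mul_le_mul_of_nonneg_right key (Real.exp_pos (d * τ)).le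
    have h2 : f τ * Real.exp (-d * τ) * Real.exp (d * τ) = f τ := by
      rw [mul_assoc, ← Real.exp_add]
      have : -d * τ + d * τ = 0 := by ring
      rw [this, Real.exp_zero, mul_one]
    rw [h2] at h1
    exact h1
  · intro t ht
    refine HasDerivAt.congr_deriv ((hf t ht).mul ((hasDerivAt_id t).const_mul (-d)).exp) ?_
    simp only [id]
    ring
  · intro t ht
    exact mul_nonneg (sub_nonneg.2 (hρ t ht)) (mul_nonneg (h0 t ht) (Real.exp_pos _).le)

lemma SolOn.two_sub_q {O Sp Sm n1 n2 n3 : ℝ → ℝ} (h : SolOn 2 (Set.Iic 0) O Sp Sm n1 n2 n3)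
    {τ : ℝ} (hτ : τ ≤ 0) :
    qf 2 (O τ) (Sp τ) (Sm τ) = 2 - 2 * Kf (n1 τ) (n2 τ) (n3 τ) := by
  have := h.hcon τ hτ
  unfold Constraint at this
  unfold qf Kf
  linear_combination 2 * this

lemma SolOn.energy {O Sp Sm n1 n2 n3 : ℝ → ℝ} (h : SolOn 2 (Set.Iic 0) O Sp Sm n1 n2 n3)
    {τ : ℝ} (hτ : τ ≤ 0) :
    O τ + Sp τ ^ 2 + Sm τ ^ 2 + Kf (n1 τ) (n2 τ) (n3 τ) = 1 := h.hcon τ hτ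

lemma SolOn.bounds {O Sp Sm n1 n2 n3 : ℝ → ℝ} (h : SolOn 2 (Set.Iic 0) O Sp Sm n1 n2 n3)
    (hO : ∀ τ ∈ Set.Iic (0:ℝ), 0 < O τ) :
    ∃ T δ : ℝ, T ≤ 0 ∧ 0 < δ ∧ δ ≤ 1 ∧
      ∀ τ ≤ T, δ ≤ O τ ∧ O τ ≤ 2 ∧ Sp τ ^ 2 + Sm τ ^ 2 ≤ 1 - δ / 2 := by
  obtain ⟨C, hC0, hC⟩ := decay_of_rate (f := fun τ => (n1 τ * n2 τ * n3 τ)^2 / (O τ)^3)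
    (ρ := fun _ => 12) (T := 0) (d := 12)
    (by
      intro τ hτ
      have hOp := hO τ hτ
      refine HasDerivAt.congr_deriv (((((h.hn1 τ hτ).mul (h.hn2 τ hτ)).mul (h.hn3 τ hτ)).pow 2).div
        ((h.hO τ hτ).pow 3) (pow_pos hOp 3).ne') ?_
      simp only [Pi.pow_apply, Pi.mul_apply]
      push_cast
      field_simp
      ring)
    (fun _ _ => le_rfl)
    (fun τ hτ => by
      have hOp := hO τ hτ
      positivity)
  set c := C + 1 with hc
  have hc0 : 0 < c := by linarith
  have hcC : C ≤ c^3 := by nlinarith [mul_nonneg hC0 hC0, mul_nonneg hC0 (mul_nonneg hC0 hC0)]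
  have hKlow : ∀ τ ≤ 0, -(9 * (c * O τ * Real.exp (4 * τ))) ≤ Kf (n1 τ) (n2 τ) (n3 τ) := by
    intro τ hτ
    have hOp := hO τ hτ
    have h1 := hC τ hτ
    have h2 : (n1 τ * n2 τ * n3 τ)^2 ≤ (c * O τ * Real.exp (4 * τ))^3 := by
      rw [div_le_iff₀ (by positivity)] at h1
      refine h1.trans ?_
      have e : Real.exp (12 * τ) = Real.exp (4 * τ) ^ 3 := by
        rw [← Real.exp_nat_mul]
        congr 1
        push_cast
        ring
      rw [e, mul_pow, mul_pow]
      have hp : 0 ≤ Real.exp (4*τ)^3 * O τ ^ 3 := by positivity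
      nlinarith [mul_le_mul_of_nonneg_right hcC hp]
    have h3 := quad_lower (by positivity) h2
    unfold Kf
    linarith
  have tE : Tendsto (fun τ : ℝ => Real.exp (4 * τ)) atBot (𝓝 0) :=
    Real.tendsto_exp_atBot.comp (tendsto_id.const_mul_atBot (by norm_num : (0:ℝ) < 4))
  obtain ⟨T1, hT1⟩ := eventually_atBot.1
    ((tE.eventually (gt_mem_nhds (by positivity : (0:ℝ) < 1 / (18 * c)))).and
      (eventually_le_atBot (0:ℝ)))
  have hsmall : ∀ τ ≤ T1, c * Real.exp (4 * τ) ≤ 1 / 18 := by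
    intro τ hτ
    have := mul_le_mul_of_nonneg_left (hT1 τ hτ).1.le hc0.le
    refine this.trans (le_of_eq ?_)
    field_simp
  have hO2 : ∀ τ ≤ T1, O τ ≤ 2 := by
    intro τ hτ
    have h0 := (hT1 τ hτ).2
    have hOp := hO τ h0
    have h1 := hKlow τ h0
    have h2 := h.energy h0
    have h3 := mul_le_mul_of_nonneg_right (hsmall τ hτ) hOp.le
    nlinarith [sq_nonneg (Sp τ), sq_nonneg (Sm τ)]
  have hK2 : ∀ τ ≤ T1, -(18 * (c * Real.exp (4 * τ))) ≤ Kf (n1 τ) (n2 τ) (n3 τ) := by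
    intro τ hτ
    have h0 := (hT1 τ hτ).2
    have h1 := hKlow τ h0
    have h3 : c * Real.exp (4*τ) * O τ ≤ c * Real.exp (4*τ) * 2 :=
      mul_le_mul_of_nonneg_left (hO2 τ hτ) (by positivity)
    linarith
  have hL : ∀ τ ≤ T1, Real.log (O T1) - 18 * c ≤ Real.log (O τ) := by
    intro τ hτ
    have key := anti_Iic (f := fun τ => Real.log (O τ) - 18 * c * Real.exp (4 * τ))
      (f' := fun τ => -4 * Kf (n1 τ) (n2 τ) (n3 τ) - 72 * c * Real.exp (4 * τ)) (T := T1)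
      ?_ ?_ hτ le_rfl
    · have h1 : Real.exp (4 * T1) ≤ 1 := by
        rw [Real.exp_le_one_iff]
        linarith [(hT1 T1 le_rfl).2]
      have h2 := Real.exp_pos (4 * τ)
      have h3 := mul_le_mul_of_nonneg_left h1 hc0.le
      have h4 := mul_pos hc0 h2
      linarith
    · intro t ht
      have h0 := (hT1 t ht).2
      have hOp := hO t h0
      refine HasDerivAt.congr_deriv (((h.hO t h0).log hOp.ne').sub
        ((((hasDerivAt_id t).const_mul 4).exp).const_mul (18 * c))) ?_
      rw [h.two_sub_q h0]
      simp only [id]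
      field_simp
      ring
    · intro t ht
      have := hK2 t ht
      linarith
  set δ := min 1 (Real.exp (Real.log (O T1) - 18 * c)) with hδ
  have hδ0 : 0 < δ := lt_min one_pos (Real.exp_pos _)
  obtain ⟨T2, hT2⟩ := eventually_atBot.1
    ((tE.eventually (gt_mem_nhds (by positivity : (0:ℝ) < δ / (36 * c)))).and
      (eventually_le_atBot T1))
  refine ⟨T2, δ, (hT1 _ (hT2 T2 le_rfl).2).2, hδ0, min_le_left _ _, ?_⟩
  intro τ hτ
  obtain ⟨a1, a2⟩ := hT2 τ hτ
  have h0 := (hT1 τ a2).2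
  have hOp := hO τ h0
  have hδO : δ ≤ O τ := by
    refine (min_le_right _ _).trans ?_
    rw [← Real.exp_log hOp]
    exact Real.exp_le_exp.2 (hL τ a2)
  refine ⟨hδO, hO2 τ a2, ?_⟩
  have h1 := hK2 τ a2
  have h2 := h.energy h0
  have h3 : c * Real.exp (4 * τ) ≤ δ / 36 := by
    refine (mul_le_mul_of_nonneg_left a1.le hc0.le).trans (le_of_eq ?_)
    field_simp
  linarith

lemma pair_decay {f ρ O : ℝ → ℝ} {T d : ℝ} (hf : ∀ τ ≤ T, HasDerivAt f (ρ τ * f τ) τ)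
    (hρ : ∀ τ ≤ T, 2 * d ≤ ρ τ) (g : ℝ → ℝ) (hfg : ∀ τ ≤ T, f τ = (g τ / O τ)^2)
    (hO : ∀ τ ≤ T, 0 < O τ ∧ O τ ≤ 2) :
    ∃ C, 0 ≤ C ∧ ∀ τ ≤ T, g τ ≤ C * Real.exp (d * τ) := by
  obtain ⟨C, hC0, hC⟩ := decay_of_rate hf hρ (fun τ hτ => by rw [hfg τ hτ]; positivity)
  refine ⟨2 * (C + 1), by linarith, ?_⟩
  intro τ hτ
  obtain ⟨o1, o2⟩ := hO τ hτ
  have h1 := hC τ hτ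
  rw [hfg τ hτ] at h1
  have e : Real.exp (2 * d * τ) = Real.exp (d * τ) ^ 2 := by
    rw [← Real.exp_nat_mul]
    congr 1
    push_cast
    ring
  have hx := Real.exp_pos (d * τ)
  have h2 : (g τ / O τ)^2 ≤ ((C + 1) * Real.exp (d * τ))^2 := by
    rw [e] at h1
    refine h1.trans ?_
    rw [mul_pow]
    apply mul_le_mul_of_nonneg_right _ (by positivity)
    nlinarith
  have h3 := (abs_le_of_sq_le_sq' h2 (by positivity)).2
  rw [div_le_iff₀ o1] at h3
  refine h3.trans ?_
  have := mul_le_mul_of_nonneg_left o2 (by positivity : 0 ≤ (C + 1) * Real.exp (d * τ))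
  linarith

/-- `N₂N₃` decays exponentially. -/
lemma SolOn.pair23 {O Sp Sm n1 n2 n3 : ℝ → ℝ} (h : SolOn 2 (Set.Iic 0) O Sp Sm n1 n2 n3)
    {T δ : ℝ} (hT : T ≤ 0) (hδ : 0 < δ) (hδ1 : δ ≤ 1)
    (hb : ∀ τ ≤ T, δ ≤ O τ ∧ O τ ≤ 2 ∧ Sp τ ^ 2 + Sm τ ^ 2 ≤ 1 - δ / 2) :
    ∃ C, 0 ≤ C ∧ ∀ τ ≤ T, n2 τ * n3 τ ≤ C * Real.exp (δ * τ) := by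
  refine pair_decay (f := fun τ => (n2 τ * n3 τ / O τ)^2) (ρ := fun τ => 8 * (1 + Sp τ)) (O := O)
    ?_ ?_ (fun τ => n2 τ * n3 τ) (fun _ _ => rfl)
    (fun τ hτ => ⟨lt_of_lt_of_le hδ (hb τ hτ).1, (hb τ hτ).2.1⟩)
  · intro τ hτ
    have h0 : τ ≤ 0 := hτ.trans hT
    have hOp : 0 < O τ := lt_of_lt_of_le hδ (hb τ hτ).1
    refine HasDerivAt.congr_deriv
      ((((h.hn2 τ h0).mul (h.hn3 τ h0)).div (h.hO τ h0) hOp.ne').pow 2) ?_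
    simp only [Pi.pow_apply, Pi.mul_apply, Pi.div_apply]
    push_cast
    field_simp
    ring
  · intro τ hτ
    have := (hb τ hτ).2.2
    have h1 : (Sp τ)^2 ≤ (1 - δ/4)^2 := by nlinarith [sq_nonneg (Sm τ)]
    have h2 := (abs_le_of_sq_le_sq' h1 (by linarith)).1
    linarith

lemma SolOn.lyap {O Sp Sm n1 n2 n3 : ℝ → ℝ} (h : SolOn 2 (Set.Iic 0) O Sp Sm n1 n2 n3)
    {T δ : ℝ} (hT : T ≤ 0) (hδ : 0 < δ) (hδ1 : δ ≤ 1)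
    (hb : ∀ τ ≤ T, δ ≤ O τ ∧ O τ ≤ 2 ∧ Sp τ ^ 2 + Sm τ ^ 2 ≤ 1 - δ / 2) :
    ∃ (E E' : ℝ → ℝ) (e : ℝ), (∀ τ ≤ T, HasDerivAt E (E' τ) τ) ∧ (∀ τ ≤ T, e ≤ E τ) ∧
      ∀ τ ≤ T, n1 τ ^ 2 + n2 τ ^ 2 + n3 τ ^ 2 ≤ E' τ := by
  have r3 : Real.sqrt 3 ^ 2 = 3 := Real.sq_sqrt (by norm_num)
  obtain ⟨C1, hC1, p1⟩ := h.pair23 hT hδ hδ1 hb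
  obtain ⟨C2, hC2, p2⟩ := h.rot.pair23 hT hδ hδ1 (fun τ hτ => by
    refine ⟨(hb τ hτ).1, (hb τ hτ).2.1, ?_⟩
    refine le_trans (le_of_eq ?_) (hb τ hτ).2.2
    linear_combination ((Sp τ)^2 + (Sm τ)^2)/4 * r3)
  obtain ⟨C3, hC3, p3⟩ := h.rot.rot.pair23 hT hδ hδ1 (fun τ hτ => by
    refine ⟨(hb τ hτ).1, (hb τ hτ).2.1, ?_⟩
    refine le_trans (le_of_eq ?_) (hb τ hτ).2.2
    linear_combination ((Sp τ)^2 + (Sm τ)^2)/4 * r3 + (((-(Sp τ + Real.sqrt 3 * Sm τ)/2))^2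
      + (((Real.sqrt 3 * Sp τ - Sm τ)/2))^2)/4 * r3)
  refine ⟨fun τ => -(1/3) * Real.log (O τ) + 2 * (C1 + C2 + C3) / δ * Real.exp (δ * τ),
    fun τ => (4/3) * Kf (n1 τ) (n2 τ) (n3 τ) + 2 * (C1 + C2 + C3) * Real.exp (δ * τ),
    -(1/3) * Real.log 2, ?_, ?_, ?_⟩
  · intro τ hτ
    have h0 : τ ≤ 0 := hτ.trans hT
    have hOp : 0 < O τ := lt_of_lt_of_le hδ (hb τ hτ).1
    refine HasDerivAt.congr_deriv ((((h.hO τ h0).log hOp.ne').const_mul (-(1/3))).add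
      ((((hasDerivAt_id τ).const_mul δ).exp).const_mul (2 * (C1 + C2 + C3) / δ))) ?_
    rw [h.two_sub_q h0]
    simp only [id]
    field_simp
    ring
  · intro τ hτ
    have hOp : 0 < O τ := lt_of_lt_of_le hδ (hb τ hτ).1
    have h1 := Real.log_le_log hOp (hb τ hτ).2.1
    have h2 : 0 ≤ 2 * (C1 + C2 + C3) / δ * Real.exp (δ * τ) := by positivity
    linarith
  · intro τ hτ
    have a1 := p1 τ hτ
    have a2 := p2 τ hτ
    have a3 := p3 τ hτ
    unfold Kf
    linarith

lemma sq_tendsto_zero {n E E' : ℝ → ℝ} {T e l : ℝ} (hE : ∀ τ ≤ T, HasDerivAt E (E' τ) τ)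
    (hEb : ∀ τ ≤ T, e ≤ E τ) (hN : ∀ τ ≤ T, n τ ^ 2 ≤ E' τ)
    (hl : Tendsto (fun τ => n τ ^ 2) atBot (𝓝 l)) : Tendsto n atBot (𝓝 0) := by
  have hl0 : 0 ≤ l := ge_of_tendsto' hl (fun τ => sq_nonneg _)
  rcases eq_or_lt_of_le hl0 with hl1 | hl1
  · rw [← hl1] at hl
    have h1 := hl.sqrt
    simp only [Real.sqrt_sq_eq_abs, Real.sqrt_zero] at h1
    exact (tendsto_zero_iff_abs_tendsto_zero _).2 h1
  · exfalso
    obtain ⟨S, hS⟩ := eventually_atBot.1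
      ((hl.eventually (lt_mem_nhds (half_lt_self hl1))).and (eventually_le_atBot T))
    have key : ∀ τ ≤ S, E τ - l/2 * τ ≤ E S - l/2 * S := fun τ hτ =>
      mono_Iic (f := fun τ => E τ - l/2 * τ) (f' := fun τ => E' τ - l/2 * 1) (T := S)
        (fun t ht => (hE t (hS t ht).2).sub ((hasDerivAt_id t).const_mul (l/2)))
        (fun t ht => by
          have h1 := (hS t ht).1
          have h2 := hN t (hS t ht).2
          linarith) hτ le_rfl
    set d := (E S - e + 1) / (l/2) with hd
    have hES := hEb S (hS S le_rfl).2
    have hd0 : 0 < d := by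
      rw [hd]
      apply div_pos <;> linarith
    have hdl : l/2 * d = E S - e + 1 := by rw [hd]; field_simp
    have h1 := key (S - d) (by linarith)
    have h2 := hEb (S - d) ((hS _ (by linarith)).2)
    nlinarith

lemma abs_prod_bound (a b c : ℝ) : |Kf a b c| ≤ 3 * (a^2 + b^2 + c^2) ∧
    |SPf a b c| ≤ 3 * (a^2 + b^2 + c^2) ∧ |SMf a b c| ≤ 6 * (a^2 + b^2 + c^2) := by
  have r0 : 0 ≤ Real.sqrt 3 := Real.sqrt_nonneg 3
  have r2 : Real.sqrt 3 ≤ 2 := by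
    rw [Real.sqrt_le_left (by norm_num)]
    norm_num
  refine ⟨abs_le.2 ⟨?_, ?_⟩, abs_le.2 ⟨?_, ?_⟩, ?_⟩
  · unfold Kf
    nlinarith [sq_nonneg (a-b), sq_nonneg (b-c), sq_nonneg (a-c)]
  · unfold Kf
    nlinarith [sq_nonneg (a+b), sq_nonneg (b+c), sq_nonneg (a+c)]
  · unfold SPf
    nlinarith [sq_nonneg (a-b), sq_nonneg (b-c), sq_nonneg (a-c), sq_nonneg (a+b),
      sq_nonneg (b+c), sq_nonneg (a+c), sq_nonneg a, sq_nonneg b, sq_nonneg c]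
  · unfold SPf
    nlinarith [sq_nonneg (a-b), sq_nonneg (b-c), sq_nonneg (a-c), sq_nonneg (a+b),
      sq_nonneg (b+c), sq_nonneg (a+c), sq_nonneg a, sq_nonneg b, sq_nonneg c]
  · unfold SMf
    have h1 : |(c - b) * (a - b - c)| ≤ 6 * (a^2 + b^2 + c^2) := by
      refine abs_le.2 ⟨?_, ?_⟩ <;>
      nlinarith [sq_nonneg (a-b), sq_nonneg (b-c), sq_nonneg (a-c), sq_nonneg (a+b),
        sq_nonneg (b+c), sq_nonneg (a+c), sq_nonneg a, sq_nonneg b, sq_nonneg c]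
    rw [mul_assoc, abs_mul, abs_of_nonneg (by positivity : 0 ≤ Real.sqrt 3 / 2)]
    have h2 : Real.sqrt 3 / 2 ≤ 1 := by linarith
    have h3 := mul_le_mul_of_nonneg_right h2 (abs_nonneg ((c - b) * (a - b - c)))
    linarith

/-- in the stiff fluid case `γ = 2` with `Ω > 0`, every solution converges
as `τ → -∞` to a type I point inside the Kasner disc, with the stated additional
restrictions on the limit according to the Bianchi type. -/
theorem stiff_fluid_convergence
    (O Sp Sm n1 n2 n3 : ℝ → ℝ)
    (hsol : SolOn 2 (Set.Iic 0) O Sp Sm n1 n2 n3)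
    (hOpos : ∀ τ ∈ Set.Iic (0:ℝ), 0 < O τ) :
    ∃ sp sm : ℝ, sp^2 + sm^2 < 1 ∧
      Tendsto Sp atBot (𝓝 sp) ∧ Tendsto Sm atBot (𝓝 sm) ∧
      Tendsto O atBot (𝓝 (1 - sp^2 - sm^2)) ∧
      Tendsto n1 atBot (𝓝 0) ∧ Tendsto n2 atBot (𝓝 0) ∧ Tendsto n3 atBot (𝓝 0) ∧
      ((∀ τ ∈ Set.Iic (0:ℝ), 0 < n1 τ ∧ n2 τ = 0 ∧ n3 τ = 0) → sp < 1/2) ∧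
      ((∀ τ ∈ Set.Iic (0:ℝ), n1 τ = 0 ∧ n2 τ ≠ 0 ∧ n3 τ ≠ 0) →
        -1 < sp + Real.sqrt 3 * sm ∧ -1 < sp - Real.sqrt 3 * sm) ∧
      ((∀ τ ∈ Set.Iic (0:ℝ), n1 τ ≠ 0 ∧ n2 τ ≠ 0 ∧ n3 τ ≠ 0) →
        sp < 1/2 ∧ -1 < sp + Real.sqrt 3 * sm ∧ -1 < sp - Real.sqrt 3 * sm) := by
  obtain ⟨T, δ, hT, hδ, hδ1, hb⟩ := hsol.bounds hOpos
  obtain ⟨E, E', e, hE, hEb, hN⟩ := hsol.lyap hT hδ hδ1 hb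
  have r3 : Real.sqrt 3 ^ 2 = 3 := Real.sq_sqrt (by norm_num)
  have r0 : 0 ≤ Real.sqrt 3 := Real.sqrt_nonneg 3
  have r2 : Real.sqrt 3 ≤ 2 := by
    rw [Real.sqrt_le_left (by norm_num)]
    norm_num
  have hE0 : ∀ τ ≤ T, 0 ≤ E' τ := fun τ hτ => le_trans (by positivity) (hN τ hτ)
  have hSpB : ∀ τ ≤ T, |Sp τ| ≤ 1 := by
    intro τ hτ
    apply abs_le_of_sq_le_sq _ zero_le_one
    have := (hb τ hτ).2.2
    nlinarith [sq_nonneg (Sm τ)]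
  have hSmB : ∀ τ ≤ T, |Sm τ| ≤ 1 := by
    intro τ hτ
    apply abs_le_of_sq_le_sq _ zero_le_one
    have := (hb τ hτ).2.2
    nlinarith [sq_nonneg (Sp τ)]
  have hqB : ∀ τ ≤ T, 0 ≤ qf 2 (O τ) (Sp τ) (Sm τ) := by
    intro τ hτ
    have := (hb τ hτ).1
    unfold qf
    nlinarith [sq_nonneg (Sp τ), sq_nonneg (Sm τ)]
  have ctrl : ∀ x y N N' : ℝ, ∀ s k S : ℝ, |s| ≤ 1 → |k| ≤ 3 * N → |S| ≤ 6 * N → N ≤ N' →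
      -(24 * N') ≤ -(2 - (2 - 2 * k)) * s - 3 * S := by
    intro _ _ N N' s k S h1 h2 h3 h4
    have h5 : |k * s| ≤ 3 * N := by
      rw [abs_mul]
      nlinarith [abs_nonneg k, abs_nonneg s]
    have := abs_le.1 h5
    have := abs_le.1 h3
    linarith
  obtain ⟨sp, tSp⟩ := conv_of_ctrl (A := 24) (b := -1) (by norm_num) hE hE0 hEb
    (fun τ hτ => hsol.hSp τ (hτ.trans hT))
    (fun τ hτ => by
      rw [hsol.two_sub_q (hτ.trans hT)]
      obtain ⟨b1, b2, b3⟩ := abs_prod_bound (n1 τ) (n2 τ) (n3 τ)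
      exact ctrl 0 0 _ _ _ _ _ (hSpB τ hτ) b1 (b2.trans (by nlinarith [sq_nonneg (n1 τ), sq_nonneg (n2 τ), sq_nonneg (n3 τ)])) (hN τ hτ))
    (fun τ hτ => (abs_le.1 (hSpB τ hτ)).1)
  obtain ⟨sm, tSm⟩ := conv_of_ctrl (A := 24) (b := -1) (by norm_num) hE hE0 hEb
    (fun τ hτ => hsol.hSm τ (hτ.trans hT))
    (fun τ hτ => by
      rw [hsol.two_sub_q (hτ.trans hT)]
      obtain ⟨b1, b2, b3⟩ := abs_prod_bound (n1 τ) (n2 τ) (n3 τ)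
      exact ctrl 0 0 _ _ _ _ _ (hSmB τ hτ) b1 b3 (hN τ hτ))
    (fun τ hτ => (abs_le.1 (hSmB τ hτ)).1)
  have nconv : ∀ n ρ : ℝ → ℝ, (∀ τ ≤ T, HasDerivAt n (ρ τ * n τ) τ) → (∀ τ ≤ T, -6 ≤ ρ τ) →
      (∀ τ ≤ T, n τ ^ 2 ≤ E' τ) → Tendsto n atBot (𝓝 0) := by
    intro n ρ hd hρ hn
    obtain ⟨l, hl⟩ := conv_of_ctrl (A := 12) (b := 0) (g := fun τ => n τ ^ 2)
      (g' := fun τ => 2 * ρ τ * n τ ^ 2) (by norm_num) hE hE0 hEb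
      (fun τ hτ => by
        refine HasDerivAt.congr_deriv ((hd τ hτ).pow 2) ?_
        push_cast
        ring)
      (fun τ hτ => by
        have h1 := hn τ hτ
        have h2 := mul_le_mul_of_nonneg_right (hρ τ hτ) (sq_nonneg (n τ))
        linarith)
      (fun τ hτ => sq_nonneg _)
    exact sq_tendsto_zero hE hEb hn hl
  have t1 : Tendsto n1 atBot (𝓝 0) := nconv n1 _ (fun τ hτ => hsol.hn1 τ (hτ.trans hT))
    (fun τ hτ => by
      have h1 := hqB τ hτ
      have h2 := abs_le.1 (hSpB τ hτ)
      linarith)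
    (fun τ hτ => by have := hN τ hτ; nlinarith [sq_nonneg (n2 τ), sq_nonneg (n3 τ)])
  have t2 : Tendsto n2 atBot (𝓝 0) := nconv n2 _ (fun τ hτ => hsol.hn2 τ (hτ.trans hT))
    (fun τ hτ => by
      have h1 := hqB τ hτ
      have h2 := abs_le.1 (hSpB τ hτ)
      have h3 := abs_le.1 (hSmB τ hτ)
      nlinarith [mul_nonneg r0 (by linarith [h3.1] : 0 ≤ Sm τ + 1)])
    (fun τ hτ => by have := hN τ hτ; nlinarith [sq_nonneg (n1 τ), sq_nonneg (n3 τ)])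
  have t3 : Tendsto n3 atBot (𝓝 0) := nconv n3 _ (fun τ hτ => hsol.hn3 τ (hτ.trans hT))
    (fun τ hτ => by
      have h1 := hqB τ hτ
      have h2 := abs_le.1 (hSpB τ hτ)
      have h3 := abs_le.1 (hSmB τ hτ)
      nlinarith [mul_nonneg r0 (by linarith [h3.2] : 0 ≤ 1 - Sm τ)])
    (fun τ hτ => by have := hN τ hτ; nlinarith [sq_nonneg (n1 τ), sq_nonneg (n2 τ)])
  have tO : Tendsto O atBot (𝓝 (1 - sp^2 - sm^2)) := by
    have hK := (((((t1.pow 2).add (t2.pow 2)).add (t3.pow 2)).sub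
      ((((t1.mul t2).add (t2.mul t3)).add (t3.mul t1)).const_mul 2)).const_mul (3/4))
    have hall := (((tendsto_const_nhds (x := (1:ℝ))).sub (tSp.pow 2)).sub (tSm.pow 2)).sub hK
    have e0 : 1 - sp^2 - sm^2 - 3/4 * ((0:ℝ)^2 + 0^2 + 0^2 - 2 * (0*0 + 0*0 + 0*0))
        = 1 - sp^2 - sm^2 := by ring
    rw [e0] at hall
    refine hall.congr' ?_
    filter_upwards [eventually_le_atBot (0:ℝ)] with τ hτ
    have := hsol.energy hτ
    unfold Kf at this
    linarith
  have hlt : sp^2 + sm^2 < 1 := by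
    have : δ ≤ 1 - sp^2 - sm^2 := by
      refine ge_of_tendsto tO ?_
      filter_upwards [eventually_le_atBot T] with τ hτ
      exact (hb τ hτ).1
    linarith
  have key1 : (∀ τ ∈ Set.Iic (0:ℝ), n1 τ ≠ 0) → sp < 1/2 := fun hn =>
    sp_lt_half hsol hOpos hlt tSp tSm tO t1 t2 t3 hn
  have tSp' : Tendsto (fun τ => -(Sp τ + Real.sqrt 3 * Sm τ)/2) atBot
      (𝓝 (-(sp + Real.sqrt 3 * sm)/2)) := ((tSp.add (tSm.const_mul _)).neg).div_const 2
  have tSm' : Tendsto (fun τ => (Real.sqrt 3 * Sp τ - Sm τ)/2) atBot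
      (𝓝 ((Real.sqrt 3 * sp - sm)/2)) := ((tSp.const_mul _).sub tSm).div_const 2
  have esq : (-(sp + Real.sqrt 3 * sm)/2)^2 + ((Real.sqrt 3 * sp - sm)/2)^2 = sp^2 + sm^2 := by
    linear_combination (sp^2 + sm^2)/4 * r3
  have tO' : Tendsto O atBot
      (𝓝 (1 - (-(sp + Real.sqrt 3 * sm)/2)^2 - ((Real.sqrt 3 * sp - sm)/2)^2)) := by
    have : 1 - (-(sp + Real.sqrt 3 * sm)/2)^2 - ((Real.sqrt 3 * sp - sm)/2)^2
        = 1 - sp^2 - sm^2 := by linarith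
    rw [this]
    exact tO
  have key2 : (∀ τ ∈ Set.Iic (0:ℝ), n2 τ ≠ 0) → -1 < sp + Real.sqrt 3 * sm := by
    intro hn
    have := sp_lt_half hsol.rot hOpos (by rw [esq]; exact hlt) tSp' tSm' tO' t2 t3 t1 hn
    linarith
  have key3 : (∀ τ ∈ Set.Iic (0:ℝ), n3 τ ≠ 0) → -1 < sp - Real.sqrt 3 * sm := by
    intro hn
    set sp' := -(sp + Real.sqrt 3 * sm)/2 with hsp'
    set sm' := (Real.sqrt 3 * sp - sm)/2 with hsm'
    have esq' : (-(sp' + Real.sqrt 3 * sm')/2)^2 + ((Real.sqrt 3 * sp' - sm')/2)^2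
        = sp'^2 + sm'^2 := by
      linear_combination (sp'^2 + sm'^2)/4 * r3
    have := sp_lt_half hsol.rot.rot hOpos (by rw [esq', esq]; exact hlt)
      (((tSp'.add (tSm'.const_mul _)).neg).div_const 2)
      (((tSp'.const_mul _).sub tSm').div_const 2)
      (by
        have e1 : 1 - (-(sp' + Real.sqrt 3 * sm')/2)^2 - ((Real.sqrt 3 * sp' - sm')/2)^2
          = 1 - sp'^2 - sm'^2 := by linarith
        rw [e1]
        exact tO') t3 t1 t2 hn
    have e2 : -(sp' + Real.sqrt 3 * sm')/2 = -(sp - Real.sqrt 3 * sm)/2 := by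
      rw [hsp', hsm']
      linear_combination (-(sp/4)) * r3
    rw [e2] at this
    linarith
  refine ⟨sp, sm, hlt, tSp, tSm, tO, t1, t2, t3, ?_, ?_, ?_⟩
  · intro hn
    exact key1 (fun τ hτ => (hn τ hτ).1.ne')
  · intro hn
    exact ⟨key2 (fun τ hτ => (hn τ hτ).2.1), key3 (fun τ hτ => (hn τ hτ).2.2)⟩
  · intro hn
    exact ⟨key1 (fun τ hτ => (hn τ hτ).1), key2 (fun τ hτ => (hn τ hτ).2.1),
      key3 (fun τ hτ => (hn τ hτ).2.2)⟩

end WainwrightHsu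
end
end

section
/- Let 2/3 < γ < 2. Every generic Bianchi type IX solution of the Wainwright–Hsu system has an α-limit point on the Kasner circle. -/
open Real Filter Topology Set

noncomputable section

namespace WainwrightHsu

/-! ### Symmetric variables -/

/-- State space in the symmetric variables `(Ω, σ₁, σ₂, σ₃, N₁, N₂, N₃)`. -/
abbrev E7 := Fin 7 → ℝ

/-- Deceleration parameter. -/
def qq (G : ℝ) (x : E7) : ℝ := G/2 * x 0 + (x 1^2 + x 2^2 + x 3^2)/3

/-- The vector field in symmetric variables. -/
def FF (G : ℝ) (x : E7) : E7 :=
  ![(2 * qq G x - G) * x 0,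
    -(2 - qq G x) * x 1 - 3 * (2 * x 4^2 - x 4 * x 5 - x 4 * x 6 - (x 5 - x 6)^2),
    -(2 - qq G x) * x 2 - 3 * (2 * x 5^2 - x 5 * x 6 - x 5 * x 4 - (x 6 - x 4)^2),
    -(2 - qq G x) * x 3 - 3 * (2 * x 6^2 - x 6 * x 4 - x 6 * x 5 - (x 4 - x 5)^2),
    (qq G x + 2 * x 1) * x 4,
    (qq G x + 2 * x 2) * x 5,
    (qq G x + 2 * x 3) * x 6]

/-- Admissible states. -/
def DD : Set E7 :=
  {x | 0 ≤ x 0 ∧ x 1 + x 2 + x 3 = 0 ∧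
    x 0 + (x 1^2 + x 2^2 + x 3^2)/6 +
      3/4 * (x 4^2 + x 5^2 + x 6^2 - 2*(x 4 * x 5 + x 5 * x 6 + x 6 * x 4)) = 1 ∧
    0 ≤ x 4 ∧ 0 ≤ x 5 ∧ 0 ≤ x 6}

/-- Solutions in the symmetric variables. -/
def IsSol (G : ℝ) (I : Set ℝ) (x : ℝ → E7) : Prop :=
  ∀ t ∈ I, HasDerivAt x (FF G (x t)) t ∧ x t ∈ DD

lemma isClosed_DD : IsClosed DD := by
  have h0 : IsClosed {x : E7 | 0 ≤ x 0} := isClosed_le (by fun_prop) (by fun_prop)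
  have h1 : IsClosed {x : E7 | x 1 + x 2 + x 3 = 0} := isClosed_eq (by fun_prop) (by fun_prop)
  have h2 : IsClosed {x : E7 | x 0 + (x 1^2 + x 2^2 + x 3^2)/6 +
      3/4 * (x 4^2 + x 5^2 + x 6^2 - 2*(x 4 * x 5 + x 5 * x 6 + x 6 * x 4)) = 1} :=
    isClosed_eq (by fun_prop) (by fun_prop)
  have h3 : IsClosed {x : E7 | 0 ≤ x 4} := isClosed_le (by fun_prop) (by fun_prop)
  have h4 : IsClosed {x : E7 | 0 ≤ x 5} := isClosed_le (by fun_prop) (by fun_prop)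
  have h5 : IsClosed {x : E7 | 0 ≤ x 6} := isClosed_le (by fun_prop) (by fun_prop)
  exact h0.inter (h1.inter (h2.inter (h3.inter (h4.inter h5))))

lemma contDiff_FF (G : ℝ) : ContDiff ℝ 1 (FF G) := by
  rw [contDiff_pi]
  intro i
  fin_cases i <;> simp [FF, qq] <;> fun_prop

section comps
variable {G : ℝ} {x : ℝ → E7} {t : ℝ}

lemma hd0 (h : HasDerivAt x (FF G (x t)) t) :
    HasDerivAt (fun s => x s 0) ((2 * qq G (x t) - G) * x t 0) t :=
  (hasDerivAt_pi.1 h) 0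
lemma hd1 (h : HasDerivAt x (FF G (x t)) t) :
    HasDerivAt (fun s => x s 1) (-(2 - qq G (x t)) * x t 1 - 3 * (2 * x t 4^2 - x t 4 * x t 5
      - x t 4 * x t 6 - (x t 5 - x t 6)^2)) t :=
  (hasDerivAt_pi.1 h) 1
lemma hd2 (h : HasDerivAt x (FF G (x t)) t) :
    HasDerivAt (fun s => x s 2) (-(2 - qq G (x t)) * x t 2 - 3 * (2 * x t 5^2 - x t 5 * x t 6
      - x t 5 * x t 4 - (x t 6 - x t 4)^2)) t :=
  (hasDerivAt_pi.1 h) 2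
lemma hd3 (h : HasDerivAt x (FF G (x t)) t) :
    HasDerivAt (fun s => x s 3) (-(2 - qq G (x t)) * x t 3 - 3 * (2 * x t 6^2 - x t 6 * x t 4
      - x t 6 * x t 5 - (x t 4 - x t 5)^2)) t :=
  (hasDerivAt_pi.1 h) 3
lemma hd4 (h : HasDerivAt x (FF G (x t)) t) :
    HasDerivAt (fun s => x s 4) ((qq G (x t) + 2 * x t 1) * x t 4) t :=
  (hasDerivAt_pi.1 h) 4
lemma hd5 (h : HasDerivAt x (FF G (x t)) t) :
    HasDerivAt (fun s => x s 5) ((qq G (x t) + 2 * x t 2) * x t 5) t :=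
  (hasDerivAt_pi.1 h) 5
lemma hd6 (h : HasDerivAt x (FF G (x t)) t) :
    HasDerivAt (fun s => x s 6) ((qq G (x t) + 2 * x t 3) * x t 6) t :=
  (hasDerivAt_pi.1 h) 6
end comps

/-- Second order Taylor estimate for bounded solutions, uniform in the solution. -/
lemma taylor_bound (G R : ℝ) : ∃ C : ℝ, 0 ≤ C ∧ ∀ (I : Set ℝ) (x : ℝ → E7), Convex ℝ I →
    IsSol G I x → (∀ t ∈ I, ‖x t‖ ≤ R) →
    ∀ s ∈ I, ∀ t ∈ I, ‖x t - x s - (t - s) • FF G (x s)‖ ≤ C * |t - s|^2 := by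
  obtain ⟨K, hK⟩ := (contDiff_FF G).contDiffOn.exists_lipschitzOnWith (s := Metric.closedBall 0 R)
    one_ne_zero (convex_closedBall _ _) (isCompact_closedBall _ _)
  obtain ⟨B, hB⟩ := (isCompact_closedBall (0 : E7) R).exists_bound_of_continuousOn
    (contDiff_FF G).continuous.continuousOn
  have hB' : ∀ y : E7, ‖y‖ ≤ R → ‖FF G y‖ ≤ |B| := fun y hy =>
    (hB y (by simpa using hy)).trans (le_abs_self B)
  refine ⟨K * |B|, by positivity, ?_⟩
  intro I x hI hx hR s hs t ht
  have hsub : Set.uIcc s t ⊆ I := by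
    rw [← segment_eq_uIcc]; exact hI.segment_subset hs ht
  have h1 : ∀ τ ∈ Set.uIcc s t, ‖x τ - x s‖ ≤ |B| * ‖τ - s‖ := by
    intro τ hτ
    exact (convex_uIcc s t).norm_image_sub_le_of_norm_hasDerivWithin_le
      (f := x) (f' := fun τ => FF G (x τ))
      (fun y hy => (hx y (hsub hy)).1.hasDerivWithinAt)
      (fun y hy => hB' _ (hR y (hsub hy))) left_mem_uIcc hτ
  have h2 := (convex_uIcc s t).norm_image_sub_le_of_norm_hasDerivWithin_le
      (f := fun τ => x τ - (τ - s) • FF G (x s)) (f' := fun τ => FF G (x τ) - FF G (x s))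
      (C := K * |B| * |t - s|) (x := s) (y := t)
      (fun y hy => by
        have := (hx y (hsub hy)).1.sub (((hasDerivAt_id y).sub_const s).smul_const (FF G (x s)))
        simp only [one_smul] at this
        exact this.hasDerivWithinAt)
      (fun y hy => by
        have a1 := hK.norm_sub_le (x := x y) (y := x s) (by simpa using hR y (hsub hy))
          (by simpa using hR s hs)
        have a2 := h1 y hy
        have a3 : ‖y - s‖ ≤ |t - s| := by
          rw [Real.norm_eq_abs]
          exact Set.abs_sub_left_of_mem_uIcc hy
        calc _ ≤ K * ‖x y - x s‖ := a1
          _ ≤ K * (|B| * |t - s|) := by gcongr; exact a2.trans (by gcongr)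
          _ = _ := by ring)
      left_mem_uIcc right_mem_uIcc
  simp only [sub_self, zero_smul, sub_zero] at h2
  calc _ = ‖x t - (t - s) • FF G (x s) - x s‖ := by congr 1; abel
    _ ≤ _ := h2
    _ = _ := by rw [Real.norm_eq_abs]; ring

/-- Limits along an ultrafilter of translates of a bounded solution are complete solutions. -/
lemma limit_sol {G R : ℝ} {x : ℝ → E7} (hx : IsSol G (Iic 0) x) (hR : ∀ t ≤ 0, ‖x t‖ ≤ R)
    (U : Ultrafilter ℝ) (hU : (U : Filter ℝ) ≤ atBot) :
    ∃ z : ℝ → E7, (∀ t, Tendsto (fun τ => x (τ + t)) U (𝓝 (z t))) ∧ IsSol G univ z ∧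
      ∀ t, ‖z t‖ ≤ R := by
  have hev : ∀ t : ℝ, ∀ᶠ τ in (U : Filter ℝ), τ + t ≤ 0 := by
    intro t
    refine hU ?_
    filter_upwards [eventually_le_atBot (-t)] with τ hτ
    linarith
  have hex : ∀ t : ℝ, ∃ z ∈ Metric.closedBall (0 : E7) R, Tendsto (fun τ => x (τ + t)) U (𝓝 z) := by
    intro t
    obtain ⟨z, hz, hz'⟩ := (isCompact_closedBall (0 : E7) R).ultrafilter_le_nhds
      (U.map (fun τ => x (τ + t))) (by
        rw [le_principal_iff]
        show ∀ᶠ τ in (U : Filter ℝ), x (τ + t) ∈ Metric.closedBall (0 : E7) R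
        filter_upwards [hev t] with τ hτ
        simpa using hR _ hτ)
    exact ⟨z, hz, hz'⟩
  choose z hz hzt using hex
  refine ⟨z, hzt, ?_, fun t => by simpa using hz t⟩
  obtain ⟨C, hC0, hC⟩ := taylor_bound G R
  intro s _
  constructor
  · have key : ∀ t, ‖z t - z s - (t - s) • FF G (z s)‖ ≤ C * |t - s|^2 := by
      intro t
      have hl : Tendsto (fun τ => ‖x (τ + t) - x (τ + s) - (t - s) • FF G (x (τ + s))‖) U
          (𝓝 ‖z t - z s - (t - s) • FF G (z s)‖) := by
        refine (((hzt t).sub (hzt s)).sub (Tendsto.const_smul ?_ _)).norm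
        exact ((contDiff_FF G).continuous.tendsto _).comp (hzt s)
      refine le_of_tendsto hl ?_
      filter_upwards [hev t, hev s] with τ h1 h2
      have := hC (Iic 0) x (convex_Iic 0) hx hR (τ + s) h2 (τ + t) h1
      simpa using this
    rw [hasDerivAt_iff_isLittleO]
    have hO : (fun t => z t - z s - (t - s) • FF G (z s)) =O[𝓝 s] fun t => (t - s)^2 := by
      refine Asymptotics.IsBigO.of_bound C (Eventually.of_forall fun t => ?_)
      have := key t
      simpa using this
    refine hO.trans_isLittleO ?_
    have := (Asymptotics.isLittleO_pow_sub_sub s (m := 2) (by norm_num))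
    simpa using this
  · refine isClosed_DD.mem_of_tendsto (hzt s) ?_
    filter_upwards [hev s] with τ hτ
    exact (hx _ hτ).2

/-- The `α`-limit set. -/
def AL (x : ℝ → E7) : Set E7 := {p | MapClusterPt p atBot x}

lemma isClosed_AL (x : ℝ → E7) : IsClosed (AL x) := isClosed_setOfPred_clusterPt

lemma AL_of_ultra {x : ℝ → E7} {U : Ultrafilter ℝ} (hU : (U : Filter ℝ) ≤ atBot) {t : ℝ} {p : E7}
    (h : Tendsto (fun τ => x (τ + t)) U (𝓝 p)) : p ∈ AL x := by
  refine mapClusterPt_iff_ultrafilter.2 ⟨U.map (fun τ => τ + t), ?_, ?_⟩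
  · have : Tendsto (fun τ : ℝ => τ + t) atBot atBot := tendsto_atBot_add_const_right _ _ tendsto_id
    exact (map_mono hU).trans this
  · exact tendsto_map'_iff.2 h

/-- A complete bounded solution inside the set `A`. -/
structure Good (G R : ℝ) (A : Set E7) (z : ℝ → E7) : Prop where
  sol : IsSol G univ z
  bd : ∀ t, ‖z t‖ ≤ R
  mem : ∀ t, z t ∈ A

/-- `w` is an orbit in the `α`-limit set of `z`. -/
def LimOf (z w : ℝ → E7) : Prop :=
  ∃ U : Ultrafilter ℝ, (U : Filter ℝ) ≤ atBot ∧ ∀ t, Tendsto (fun τ => z (τ + t)) U (𝓝 (w t))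

lemma Good.of_mem_AL {G R : ℝ} {x : ℝ → E7} (hx : IsSol G (Iic 0) x) (hR : ∀ t ≤ 0, ‖x t‖ ≤ R)
    {p : E7} (hp : p ∈ AL x) : ∃ z, Good G R (AL x) z ∧ z 0 = p ∧ LimOf x z := by
  obtain ⟨U, hU, hUt⟩ := mapClusterPt_iff_ultrafilter.1 hp
  obtain ⟨z, hz, hzs, hzR⟩ := limit_sol hx hR U hU
  refine ⟨z, ⟨hzs, hzR, fun t => AL_of_ultra hU (hz t)⟩, ?_, U, hU, hz⟩
  have := hz 0
  simp only [add_zero] at this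
  exact tendsto_nhds_unique this hUt

lemma LimOf.eq {z w : ℝ → E7} (h : LimOf z w) {V : E7 → ℝ} {L : ℝ}
    (hV : Tendsto (fun t => V (z t)) atBot (𝓝 L)) (t : ℝ) (hc : ContinuousAt V (w t)) :
    V (w t) = L := by
  obtain ⟨U, hU, hUt⟩ := h
  have h1 : Tendsto (fun τ => V (z (τ + t))) U (𝓝 (V (w t))) := hc.tendsto.comp (hUt t)
  have h2 : Tendsto (fun τ : ℝ => τ + t) atBot atBot := tendsto_atBot_add_const_right _ _ tendsto_id
  exact tendsto_nhds_unique h1 ((hV.comp h2).mono_left hU)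

lemma LimOf.closed {z w : ℝ → E7} (h : LimOf z w) {C : Set E7} (hC : IsClosed C)
    (hz : ∀ᶠ t in atBot, z t ∈ C) (t : ℝ) : w t ∈ C := by
  obtain ⟨U, hU, hUt⟩ := h
  have h2 : Tendsto (fun τ : ℝ => τ + t) atBot atBot := tendsto_atBot_add_const_right _ _ tendsto_id
  exact hC.mem_of_tendsto (hUt t) ((h2.eventually hz).filter_mono hU)

lemma Good.lim {G R : ℝ} {A : Set E7} {z : ℝ → E7} (hA : IsClosed A) (hz : Good G R A z) :
    ∃ w, Good G R A w ∧ LimOf z w := by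
  obtain ⟨w, hw, hws, hwR⟩ := limit_sol (G := G) (R := R) (x := z) (fun t _ => hz.sol t trivial)
    (fun t _ => hz.bd t) (Ultrafilter.of atBot) (Ultrafilter.of_le _)
  have hl : LimOf z w := ⟨_, Ultrafilter.of_le _, hw⟩
  exact ⟨w, ⟨hws, hwR, hl.closed hA (Eventually.of_forall hz.mem)⟩, hl⟩

/-! ### Elementary ODE lemmas -/

lemma mono_of {f f' : ℝ → ℝ} (h : ∀ t, HasDerivAt f (f' t) t) (h0 : ∀ t, 0 ≤ f' t) :
    Monotone f :=
  monotone_of_deriv_nonneg (fun t => (h t).differentiableAt) (fun t => (h t).deriv ▸ h0 t)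

lemma anti_of {f f' : ℝ → ℝ} (h : ∀ t, HasDerivAt f (f' t) t) (h0 : ∀ t, f' t ≤ 0) :
    Antitone f :=
  antitone_of_deriv_nonpos (fun t => (h t).differentiableAt) (fun t => (h t).deriv ▸ h0 t)

/-- Monotonicity on a segment. -/
lemma le_of_deriv_nonneg {f f' : ℝ → ℝ} {a b : ℝ} (hab : a ≤ b)
    (h : ∀ t ∈ Icc a b, HasDerivAt f (f' t) t) (h0 : ∀ t ∈ Icc a b, 0 ≤ f' t) : f a ≤ f b := by
  refine monotoneOn_of_deriv_nonneg (convex_Icc a b)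
    (fun t ht => (h t ht).continuousAt.continuousWithinAt) ?_ ?_ (left_mem_Icc.2 hab)
    (right_mem_Icc.2 hab) hab
  · intro t ht
    exact (h t (interior_subset ht)).differentiableAt.differentiableWithinAt
  · intro t ht
    rw [(h t (interior_subset ht)).deriv]
    exact h0 t (interior_subset ht)

lemma deriv_zero_of_const {f : ℝ → ℝ} {c f' t : ℝ} (hf : ∀ s, f s = c) (h : HasDerivAt f f' t) :
    f' = 0 := by
  have : f = fun _ => c := funext hf
  rw [this] at h
  exact h.unique (hasDerivAt_const t c)

/-- Uniqueness for linear differential inequalities. -/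
lemma lin_zero {f f' : ℝ → ℝ} {I : Set ℝ} (hI : I.OrdConnected) {C T : ℝ}
    (h : ∀ t ∈ I, HasDerivAt f (f' t) t) (hC : ∀ t ∈ I, |f' t| ≤ C * |f t|) (hT : T ∈ I)
    (h0 : f T = 0) : ∀ t ∈ I, f t = 0 := by
  have key : ∀ t ∈ I, |f t * f' t| ≤ C * f t ^ 2 := by
    intro t ht
    rw [abs_mul, ← sq_abs (f t)]
    nlinarith [hC t ht, abs_nonneg (f t)]
  intro t ht
  rcases le_total t T with hle | hle
  · have hsub : Icc t T ⊆ I := hI.out ht hT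
    have := le_of_deriv_nonneg (f := fun s => f s ^ 2 * Real.exp (2 * C * s))
      (f' := fun s => (2 * (f s * f' s) + 2 * C * f s ^ 2) * Real.exp (2 * C * s)) hle
      (fun s hs => by
        have h1 := (h s (hsub hs)).pow 2
        have h2 : HasDerivAt (fun s => Real.exp (2 * C * s)) (Real.exp (2 * C * s) * (2 * C)) s := by
          have := ((hasDerivAt_id s).const_mul (2 * C)).exp
          simpa using this
        refine (h1.mul h2).congr_deriv ?_
        simp; ring)
      (fun s hs => by
        have := abs_le.1 (key s (hsub hs))
        exact mul_nonneg (by linarith [this.1]) (Real.exp_pos _).le)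
    simp only [h0] at this
    have h3 := Real.exp_pos (2 * C * t)
    have h4 : f t ^ 2 ≤ 0 := by
      by_contra hcon
      push Not at hcon
      have := mul_pos hcon h3
      nlinarith
    exact pow_eq_zero_iff (two_ne_zero) |>.1 (le_antisymm h4 (sq_nonneg _))
  · have hsub : Icc T t ⊆ I := hI.out hT ht
    have := le_of_deriv_nonneg (f := fun s => -(f s ^ 2 * Real.exp (-(2 * C) * s)))
      (f' := fun s => -((2 * (f s * f' s) - 2 * C * f s ^ 2) * Real.exp (-(2 * C) * s))) hle
      (fun s hs => by
        have h1 := (h s (hsub hs)).pow 2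
        have h2 : HasDerivAt (fun s => Real.exp (-(2 * C) * s))
            (Real.exp (-(2 * C) * s) * (-(2 * C))) s := by
          have := ((hasDerivAt_id s).const_mul (-(2 * C))).exp
          simpa using this
        refine (h1.mul h2).neg.congr_deriv ?_
        simp; ring)
      (fun s hs => by
        have := abs_le.1 (key s (hsub hs))
        have : 0 ≤ -(2 * (f s * f' s) - 2 * C * f s ^ 2) := by linarith [this.2]
        have := mul_nonneg this (Real.exp_pos (-(2 * C) * s)).le
        linarith)
    simp only [h0] at this
    have h3 := Real.exp_pos (-(2 * C) * t)
    have h4 : f t ^ 2 ≤ 0 := by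
      by_contra hcon
      push Not at hcon
      have := mul_pos hcon h3
      nlinarith
    exact pow_eq_zero_iff (two_ne_zero) |>.1 (le_antisymm h4 (sq_nonneg _))

lemma bound_cont (R : ℝ) {c : E7 → ℝ} (hc : Continuous c) :
    ∃ C, ∀ y : E7, ‖y‖ ≤ R → |c y| ≤ C := by
  obtain ⟨B, hB⟩ := (isCompact_closedBall (0 : E7) R).exists_bound_of_continuousOn hc.continuousOn
  exact ⟨B, fun y hy => hB y (by simpa using hy)⟩

lemma continuous_qq (G : ℝ) : Continuous (qq G) := by unfold qq; fun_prop

variable {G R : ℝ} {A : Set E7} {z : ℝ → E7}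

lemma Good.lin (hz : Good G R A z) {f : ℝ → ℝ} {c : E7 → ℝ} (hc : Continuous c)
    (h : ∀ t, HasDerivAt f (c (z t) * f t) t) {T : ℝ} (h0 : f T = 0) : ∀ t, f t = 0 := by
  obtain ⟨C, hC⟩ := bound_cont R hc
  intro t
  refine lin_zero (I := univ) ordConnected_univ (fun t _ => h t) (C := C) (fun t _ => ?_)
    (mem_univ T) h0 t trivial
  rw [abs_mul]
  exact mul_le_mul_of_nonneg_right (hC _ (hz.bd t)) (abs_nonneg _)

lemma Good.z0 (hz : Good G R A z) {T : ℝ} (h0 : z T 0 = 0) : ∀ t, z t 0 = 0 :=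
  hz.lin (f := fun t => z t 0) (c := fun y => 2 * qq G y - G)
    (by have := continuous_qq G; fun_prop) (fun t => hd0 (hz.sol t trivial).1) h0
lemma Good.z4 (hz : Good G R A z) {T : ℝ} (h0 : z T 4 = 0) : ∀ t, z t 4 = 0 :=
  hz.lin (f := fun t => z t 4) (c := fun y => qq G y + 2 * y 1)
    (by have := continuous_qq G; fun_prop) (fun t => hd4 (hz.sol t trivial).1) h0
lemma Good.z5 (hz : Good G R A z) {T : ℝ} (h0 : z T 5 = 0) : ∀ t, z t 5 = 0 :=
  hz.lin (f := fun t => z t 5) (c := fun y => qq G y + 2 * y 2)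
    (by have := continuous_qq G; fun_prop) (fun t => hd5 (hz.sol t trivial).1) h0
lemma Good.z6 (hz : Good G R A z) {T : ℝ} (h0 : z T 6 = 0) : ∀ t, z t 6 = 0 :=
  hz.lin (f := fun t => z t 6) (c := fun y => qq G y + 2 * y 3)
    (by have := continuous_qq G; fun_prop) (fun t => hd6 (hz.sol t trivial).1) h0

lemma Good.pos4 (hz : Good G R A z) {T : ℝ} (h0 : z T 4 ≠ 0) (t : ℝ) : 0 < z t 4 := by
  obtain ⟨-, -, -, h, -, -⟩ := (hz.sol t trivial).2
  exact lt_of_le_of_ne h (fun hh => h0 (hz.z4 hh.symm T))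
lemma Good.pos5 (hz : Good G R A z) {T : ℝ} (h0 : z T 5 ≠ 0) (t : ℝ) : 0 < z t 5 := by
  obtain ⟨-, -, -, -, h, -⟩ := (hz.sol t trivial).2
  exact lt_of_le_of_ne h (fun hh => h0 (hz.z5 hh.symm T))
lemma Good.pos6 (hz : Good G R A z) {T : ℝ} (h0 : z T 6 ≠ 0) (t : ℝ) : 0 < z t 6 := by
  obtain ⟨-, -, -, -, -, h⟩ := (hz.sol t trivial).2
  exact lt_of_le_of_ne h (fun hh => h0 (hz.z6 hh.symm T))
lemma Good.pos0 (hz : Good G R A z) {T : ℝ} (h0 : z T 0 ≠ 0) (t : ℝ) : 0 < z t 0 := by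
  obtain ⟨h, -⟩ := (hz.sol t trivial).2
  exact lt_of_le_of_ne h (fun hh => h0 (hz.z0 hh.symm T))

lemma LimOf.zero {z w : ℝ → E7} (h : LimOf z w) (i : Fin 7) (hz : ∀ t, z t i = 0) (t : ℝ) :
    w t i = 0 :=
  h.closed (C := {y | y i = 0}) (isClosed_eq (by fun_prop) continuous_const)
    (Eventually.of_forall hz) t

/-- A version of LaSalle's principle. -/
lemma lasalle (hA : IsClosed A) (hz : Good G R A z) {V : E7 → ℝ} (hV : Continuous V)
    (hm : Monotone (fun t => V (z t))) :
    ∃ w, Good G R A w ∧ LimOf z w ∧ ∃ L, (∀ t, V (w t) = L) ∧ ∀ t, L ≤ V (z t) := by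
  obtain ⟨w, hw, hl⟩ := hz.lim hA
  obtain ⟨C, hC⟩ := bound_cont R hV
  have hb : BddBelow (range (fun t => V (z t))) := by
    refine ⟨-C, ?_⟩
    rintro _ ⟨t, rfl⟩
    exact (abs_le.1 (hC _ (hz.bd t))).1
  have ht := tendsto_atBot_ciInf hm hb
  exact ⟨w, hw, hl, _, fun t => hl.eq ht t hV.continuousAt, fun t => ciInf_le hb t⟩

/-! ### Limit orbits of type I -/

/-- The fixed point `F`. -/
def pF : E7 := ![1, 0, 0, 0, 0, 0, 0]

/-- No Kasner points in `A`. -/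
def NoK (A : Set E7) : Prop := ∀ p ∈ A, ¬ (p 0 = 0 ∧ p 4 = 0 ∧ p 5 = 0 ∧ p 6 = 0)

lemma typeI (hG4 : G < 4) (hA : IsClosed A) (hK : NoK A) (hz : Good G R A z)
    (h4 : z 0 4 = 0) (h5 : z 0 5 = 0) (h6 : z 0 6 = 0) : z 0 = pF := by
  have H4 := hz.z4 h4
  have H5 := hz.z5 h5
  have H6 := hz.z6 h6
  have hq : ∀ w : ℝ → E7, Good G R A w → (∀ t, w t 4 = 0) → (∀ t, w t 5 = 0) → (∀ t, w t 6 = 0) →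
      ∀ t, 0 ≤ w t 0 ∧ w t 0 ≤ 1 ∧
        HasDerivAt (fun s => w s 0) ((4 - G) * (1 - w t 0) * w t 0) t := by
    intro w hw a4 a5 a6 t
    obtain ⟨h0, -, hc, -⟩ := (hw.sol t trivial).2
    rw [a4, a5, a6] at hc
    refine ⟨h0, by nlinarith [sq_nonneg (w t 1), sq_nonneg (w t 2), sq_nonneg (w t 3)], ?_⟩
    refine (hd0 (hw.sol t trivial).1).congr_deriv ?_
    have : w t 1^2 + w t 2^2 + w t 3^2 = 6 * (1 - w t 0) := by linarith
    rw [qq, this]; ring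
  have hmono : Monotone (fun t => z t 0) :=
    mono_of (fun t => (hq z hz H4 H5 H6 t).2.2) (fun t => by
      obtain ⟨a, b, -⟩ := hq z hz H4 H5 H6 t
      exact mul_nonneg (mul_nonneg (by linarith) (by linarith)) a)
  obtain ⟨w, hw, hl, L, hL, hLz⟩ := lasalle hA hz (V := fun y => y 0) (by fun_prop) hmono
  have b4 := hl.zero 4 H4
  have b5 := hl.zero 5 H5
  have b6 := hl.zero 6 H6
  obtain ⟨c0, c1, c2⟩ := hq w hw b4 b5 b6 0
  have hd := deriv_zero_of_const hL c2
  have hne : w 0 0 ≠ 0 := fun h => hK _ (hw.mem 0) ⟨h, b4 0, b5 0, b6 0⟩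
  have h1 : w 0 0 = 1 := by
    rcases mul_eq_zero.1 hd with h | h
    · rcases mul_eq_zero.1 h with h | h <;> linarith
    · exact absurd h hne
  have h2 : z 0 0 = 1 := by
    have a1 : L ≤ z 0 0 := hLz 0
    have a2 := (hq z hz H4 H5 H6 0).2.1
    have a3 : w 0 0 = L := hL 0
    linarith
  obtain ⟨-, hs, hc, -⟩ := (hz.sol 0 trivial).2
  rw [h4, h5, h6, h2] at hc
  have e1 : z 0 1 = 0 := by nlinarith [sq_nonneg (z 0 1), sq_nonneg (z 0 2), sq_nonneg (z 0 3)]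
  have e2 : z 0 2 = 0 := by nlinarith [sq_nonneg (z 0 1), sq_nonneg (z 0 2), sq_nonneg (z 0 3)]
  have e3 : z 0 3 = 0 := by nlinarith [sq_nonneg (z 0 1), sq_nonneg (z 0 2), sq_nonneg (z 0 3)]
  ext i
  fin_cases i <;> simp [pF, *]

/-! ### Limit orbits of type II -/

/-- The number `v = (3γ - 2)/8` and the `N₁` coordinate of `P₁⁺(II)`. -/
def nP (G : ℝ) : ℝ := Real.sqrt (2/3 * (G/8) * (1 - G/4))

/-- The fixed point `P₁⁺(II)`. -/
def pP1 (G : ℝ) : E7 := ![1 - G/16, -(G/4), G/8, G/8, nP G, 0, 0]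

set_option maxHeartbeats 1000000 in
lemma log_max {m v n ω N O u : ℝ} (hv0 : 0 < v) (hv : v < 1/2)
    (hm : m = v * (1 - 2*v) / (2 * (1 - v^2))) (hn : 0 < n) (hn2 : n^2 = 2/3 * v * (1 - 2*v))
    (hω : ω = 1 - v/2) (hN : 0 < N) (hO : 0 < O) (hc : O + u^2 + 3/4 * N^2 = 1)
    (hW : 2 * m * log n + (1 - m) * log ω - 2 * log (1 - v*v) ≤
      2 * m * log N + (1 - m) * log O - 2 * log (1 - v*u)) : u = v ∧ N = n := by
  have hv2 : 0 < 1 - v^2 := by nlinarith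
  have hu1 : u^2 < 1 := by nlinarith [sq_nonneg N, pow_pos hN 2]
  have hu2 : 0 < 1 - v*u := by
    have : |u| < 1 := by rwa [← sq_lt_one_iff_abs_lt_one]
    have := abs_lt.1 this
    nlinarith
  have hω0 : 0 < ω := by linarith
  have hm0 : 0 < m := by rw [hm]; apply div_pos <;> nlinarith
  have hm1 : 1 - m = (1 - v/2) / (1 - v^2) := by rw [hm]; field_simp; ring
  have hm1' : 0 < 1 - m := by rw [hm1]; apply div_pos <;> linarith
  set S := (1 - u^2) / (1 - v^2) with hS
  have hS0 : 0 < S := div_pos (by linarith) hv2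
  set k := (1 - v*u) / (1 - v*v) with hk
  have hvv : 0 < 1 - v*v := by nlinarith
  have hk0 : 0 < k := div_pos hu2 hvv
  have hSk : S ≤ k^2 := by
    rw [hS, hk, div_pow, div_le_div_iff₀ hv2 (by positivity)]
    nlinarith [mul_nonneg hv2.le (sq_nonneg (u - v))]
  set X := N^2/n^2 with hX
  set Y := O/ω with hY
  have hX0 : 0 < X := by positivity
  have hY0 : 0 < Y := by positivity
  have hsum : m * X + (1 - m) * Y = S := by
    have h12 : 1 - 2*v ≠ 0 := by linarith
    have e1 : m * X = 3/4 * N^2 / (1 - v^2) := by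
      rw [hX, hn2, hm]
      set a := 1 - 2*v with ha
      field_simp
      try ring
    have e2 : (1 - m) * Y = O / (1 - v^2) := by
      rw [hY, hm1, hω]
      have : 1 - v/2 ≠ 0 := by linarith
      set a := 1 - v/2 with ha
      field_simp
    rw [e1, e2, hS, ← add_div]; congr 1; linarith
  have hlog : log (k^2) ≤ m * log X + (1 - m) * log Y := by
    have e1 : log X = 2 * log N - 2 * log n := by
      rw [hX, log_div (by positivity) (by positivity), log_pow, log_pow]; push_cast; ring
    have e2 : log Y = log O - log ω := by rw [hY, log_div hO.ne' hω0.ne']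
    have e3 : log (k^2) = 2 * (log (1 - v*u) - log (1 - v*v)) := by
      rw [log_pow, hk, log_div hu2.ne' hvv.ne']; push_cast; ring
    rw [e1, e2, e3]
    linarith
  have hlS : log S ≤ log (k^2) := log_le_log hS0 hSk
  have lX : log X - log S = log (X/S) := (log_div hX0.ne' hS0.ne').symm
  have lY : log Y - log S = log (Y/S) := (log_div hY0.ne' hS0.ne').symm
  have hXS : log (X/S) ≤ X/S - 1 := log_le_sub_one_of_pos (by positivity)
  have hYS : log (Y/S) ≤ Y/S - 1 := log_le_sub_one_of_pos (by positivity)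
  have hz : m * (X/S - 1) + (1 - m) * (Y/S - 1) = 0 := by
    have : m * (X/S - 1) + (1 - m) * (Y/S - 1) = (m * X + (1 - m) * Y)/S - 1 := by
      field_simp; ring
    rw [this, hsum, div_self hS0.ne', sub_self]
  have hXe : X = S := by
    by_contra hne
    have : X/S ≠ 1 := fun h => hne (by rwa [div_eq_one_iff_eq hS0.ne'] at h)
    have := log_lt_sub_one_of_pos (by positivity : 0 < X/S) this
    have a1 := mul_lt_mul_of_pos_left this hm0
    have a2 := mul_le_mul_of_nonneg_left hYS hm1'.le
    rw [← lX] at a1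
    rw [← lY] at a2
    have a3 : m * (log X - log S) + (1 - m) * (log Y - log S) =
      m * log X + (1 - m) * log Y - log S := by ring
    linarith
  have hSk' : S = k^2 := by
    refine le_antisymm hSk ?_
    rw [← log_le_log_iff (by positivity) hS0]
    have a1 := mul_le_mul_of_nonneg_left hXS hm0.le
    have a2 := mul_le_mul_of_nonneg_left hYS hm1'.le
    rw [← lX] at a1
    rw [← lY] at a2
    have a3 : m * (log X - log S) + (1 - m) * (log Y - log S) =
      m * log X + (1 - m) * log Y - log S := by ring
    linarith
  have huv : u = v := by
    rw [hS, hk, div_pow, div_eq_div_iff hv2.ne' (by positivity)] at hSk'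
    have h1 : (1 - v^2) * (u - v)^2 = 0 := by linear_combination -hSk'
    have h2 := (mul_eq_zero.1 h1).resolve_left hv2.ne'
    have := pow_eq_zero_iff two_ne_zero |>.1 h2
    linarith
  refine ⟨huv, ?_⟩
  have hS1 : S = 1 := by rw [hS, huv, div_self hv2.ne']
  rw [hS1, hX, div_eq_one_iff_eq (by positivity)] at hXe
  exact (pow_left_inj₀ hN.le hn.le two_ne_zero).1 hXe

/-- Vacuum type II orbits lead to the Kasner circle. -/
lemma typeII_vac (hA : IsClosed A) (hK : NoK A) (hz : Good G R A z)
    (h5 : z 0 5 = 0) (h6 : z 0 6 = 0) (h0 : z 0 0 = 0) : False := by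
  have H5 := hz.z5 h5
  have H6 := hz.z6 h6
  have H0 := hz.z0 h0
  have hq : ∀ w : ℝ → E7, Good G R A w → (∀ t, w t 0 = 0) → (∀ t, w t 5 = 0) → (∀ t, w t 6 = 0) →
      ∀ t, -2 ≤ w t 1 ∧
        HasDerivAt (fun s => -w s 1) (3/2 * w t 4^2 * (w t 1 + 4)) t := by
    intro w hw a0 a5 a6 t
    obtain ⟨-, hs, hc, -⟩ := (hw.sol t trivial).2
    rw [a0, a5, a6] at hc
    refine ⟨by nlinarith [sq_nonneg (w t 4), sq_nonneg (w t 2 - w t 3), sq_nonneg (w t 2 + w t 3)], ?_⟩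
    refine (hd1 (hw.sol t trivial).1).neg.congr_deriv ?_
    have : w t 1^2 + w t 2^2 + w t 3^2 = 6 * (1 - 3/4 * w t 4^2) := by linarith
    rw [qq, this, a0, a5, a6]; ring
  have hmono : Monotone (fun t => -z t 1) :=
    mono_of (fun t => (hq z hz H0 H5 H6 t).2) (fun t => by
      obtain ⟨a, -⟩ := hq z hz H0 H5 H6 t
      exact mul_nonneg (by positivity) (by linarith))
  obtain ⟨w, hw, hl, L, hL, hLz⟩ := lasalle hA hz (V := fun y => -y 1) (by fun_prop) hmono
  have b0 := hl.zero 0 H0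
  have b5 := hl.zero 5 H5
  have b6 := hl.zero 6 H6
  obtain ⟨c0, c2⟩ := hq w hw b0 b5 b6 0
  have hd := deriv_zero_of_const hL c2
  refine hK _ (hw.mem 0) ⟨b0 0, ?_, b5 0, b6 0⟩
  rcases mul_eq_zero.1 hd with h | h
  · simpa using h
  · linarith

/-- Type II orbits are locally rotationally symmetric. -/
lemma typeII_lrs (hG4 : G < 4) (hA : IsClosed A) (hK : NoK A) (hz : Good G R A z)
    (h5 : z 0 5 = 0) (h6 : z 0 6 = 0) (t : ℝ) : z t 2 = z t 3 := by
  have H5 := hz.z5 h5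
  have H6 := hz.z6 h6
  have hq : ∀ w : ℝ → E7, Good G R A w → (∀ t, w t 5 = 0) → (∀ t, w t 6 = 0) →
      ∀ t, 0 ≤ w t 0 ∧
        HasDerivAt (fun s => -(w s 2 - w s 3)^2)
          (2 * ((2 - G/2) * w t 0 + 3/2 * w t 4^2) * (w t 2 - w t 3)^2) t := by
    intro w hw a5 a6 t
    obtain ⟨h0, hs, hc, -⟩ := (hw.sol t trivial).2
    rw [a5, a6] at hc
    refine ⟨h0, ?_⟩
    refine (((hd2 (hw.sol t trivial).1).sub (hd3 (hw.sol t trivial).1)).pow 2).neg.congr_deriv ?_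
    have : w t 1^2 + w t 2^2 + w t 3^2 = 6 * (1 - 3/4 * w t 4^2 - w t 0) := by linarith
    simp only [qq, this, a5, a6, Pi.sub_apply]; push_cast; ring
  have hmono : Monotone (fun t => -(z t 2 - z t 3)^2) :=
    mono_of (fun t => (hq z hz H5 H6 t).2) (fun t => by
      obtain ⟨a, -⟩ := hq z hz H5 H6 t
      have : 0 ≤ (2 - G/2) * z t 0 := mul_nonneg (by linarith) a
      positivity)
  obtain ⟨w, hw, hl, L, hL, hLz⟩ := lasalle hA hz (V := fun y => -(y 2 - y 3)^2) (by fun_prop) hmono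
  have b5 := hl.zero 5 H5
  have b6 := hl.zero 6 H6
  obtain ⟨c0, c2⟩ := hq w hw b5 b6 0
  have hd := deriv_zero_of_const hL c2
  have hw0 : (w 0 2 - w 0 3)^2 = 0 := by
    rcases mul_eq_zero.1 hd with h | h
    · exfalso
      have e0 : 0 ≤ (2 - G/2) * w 0 0 := mul_nonneg (by linarith) c0
      have e1 : w 0 4^2 = 0 := by nlinarith [sq_nonneg (w 0 4)]
      have e2 : w 0 0 = 0 := by
        rw [e1] at h
        have : (2 - G/2) * w 0 0 = 0 := by linarith
        exact (mul_eq_zero.1 this).resolve_left (by linarith)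
      exact hK _ (hw.mem 0) ⟨e2, by simpa using e1, b5 0, b6 0⟩
    · exact h
  have a1 : -(w 0 2 - w 0 3)^2 = L := hL 0
  have a2 : L ≤ -(z t 2 - z t 3)^2 := hLz t
  have a3 : (z t 2 - z t 3)^2 = 0 := by nlinarith [sq_nonneg (z t 2 - z t 3)]
  have := pow_eq_zero_iff two_ne_zero |>.1 a3
  linarith

/-- The monotone function for type II orbits with matter. -/
def WII (G : ℝ) (y : E7) : ℝ :=
  2 * ((G/8) * (1 - G/4) / (2 * (1 - (G/8)^2))) * log (y 4)
    + (1 - (G/8) * (1 - G/4) / (2 * (1 - (G/8)^2))) * log (y 0) - 2 * log (1 + G/16 * y 1)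

set_option maxHeartbeats 1000000 in
lemma typeII (hG0 : 0 < G) (hG4 : G < 4) (hA : IsClosed A) (hK : NoK A) (hz : Good G R A z)
    (h5 : z 0 5 = 0) (h6 : z 0 6 = 0) : pF ∈ A ∨ z 0 = pP1 G := by
  by_cases h4 : z 0 4 = 0
  · left; rw [← typeI hG4 hA hK hz h4 h5 h6]; exact hz.mem 0
  by_cases h0 : z 0 0 = 0
  · exact (typeII_vac hA hK hz h5 h6 h0).elim
  set v := G/8 with hv
  set m := v * (1 - 2*v) / (2 * (1 - v^2)) with hm
  have hv0 : 0 < v := by positivity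
  have hv1 : v < 1/2 := by rw [hv]; linarith
  have hv2 : 0 < 1 - v^2 := by nlinarith
  have hm0 : 0 < m := by rw [hm]; apply div_pos <;> nlinarith
  -- general facts on LRS type II orbits
  have hfact : ∀ w : ℝ → E7, Good G R A w → w 0 5 = 0 → w 0 6 = 0 → w 0 4 ≠ 0 → w 0 0 ≠ 0 →
      ∀ t, 0 < w t 4 ∧ 0 < w t 0 ∧ 0 < 1 + G/16 * w t 1 ∧ w t 2 = -w t 1/2 ∧ w t 3 = -w t 1/2 ∧
        w t 0 + (-w t 1/2)^2 + 3/4 * w t 4^2 = 1 ∧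
        HasDerivAt (fun s => WII G (w s))
          (8 * m / v * (-w t 1/2 - v)^2 / (1 + G/16 * w t 1)) t := by
    intro w hw a5 a6 a4 a0 t
    have p4 := hw.pos4 a4 t
    have p0 := hw.pos0 a0 t
    have e23 := typeII_lrs hG4 hA hK hw a5 a6 t
    obtain ⟨-, hs, hc, -⟩ := (hw.sol t trivial).2
    have e2 : w t 2 = -w t 1/2 := by linarith
    have e3 : w t 3 = -w t 1/2 := by linarith
    have z5 := hw.z5 a5 t
    have z6 := hw.z6 a6 t
    rw [z5, z6, e2, e3] at hc
    have hc' : w t 0 + (-w t 1/2)^2 + 3/4 * w t 4^2 = 1 := by linarith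
    have hu1 : -2 < w t 1 := by nlinarith [sq_nonneg (w t 4)]
    have hp : 0 < 1 + G/16 * w t 1 := by nlinarith
    refine ⟨p4, p0, hp, e2, e3, hc', ?_⟩
    have D := (hw.sol t trivial).1
    have D4 := (hd4 D).log p4.ne'
    have D0 := (hd0 D).log p0.ne'
    have D1 := (((hd1 D).const_mul (G/16)).const_add 1).log hp.ne'
    have := ((D4.const_mul (2 * m)).add (D0.const_mul (1 - m))).sub (D1.const_mul 2)
    have hfun : (fun s => WII G (w s)) = ((fun s => 2 * m * log (w s 4)) + fun s => (1 - m) * log (w s 0)) -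
        fun s => 2 * log (1 + G/16 * w s 1) := by
      funext s
      simp only [WII, Pi.add_apply, Pi.sub_apply, hm, hv]
      ring_nf
    rw [hfun]
    refine this.congr_deriv ?_
    have hG : G = 8 * v := by rw [hv]; ring
    have hO : w t 0 = 1 - (-w t 1/2)^2 - 3/4 * w t 4^2 := by linarith
    have hp' : 1 + v/2 * w t 1 ≠ 0 := by
      have : 1 + G/16 * w t 1 = 1 + v/2 * w t 1 := by rw [hG]; ring
      rw [← this]; exact hp.ne'
    have c1 : (qq G (w t) + 2 * w t 1) * w t 4 / w t 4 = qq G (w t) + 2 * w t 1 := by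
      field_simp
    have c2 : (2 * qq G (w t) - G) * w t 0 / w t 0 = 2 * qq G (w t) - G := by
      field_simp
    have hqe : qq G (w t) = 4 * v * w t 0 + w t 1^2/2 := by
      rw [qq, e2, e3, hG]; ring
    rw [c1, c2, z5, z6, hqe, hO]
    have hG16 : G/16 = v/2 := by rw [hG]; ring
    rw [hG16, hG, hm]
    have hp'' : 2 + v * w t 1 ≠ 0 := fun h => hp' (by linarith)
    have hv2' : 1 - v^2 ≠ 0 := hv2.ne'
    have e1 : 1 + v/2 * w t 1 = (2 + v * w t 1)/2 := by ring
    rw [e1]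
    obtain ⟨b, hb⟩ : ∃ b, b = 2 + v * w t 1 := ⟨_, rfl⟩
    obtain ⟨a, ha⟩ : ∃ a, a = 1 - v^2 := ⟨_, rfl⟩
    rw [← hb, ← ha]
    rw [← hb] at hp''
    rw [← ha] at hv2'
    have hw1 : w t 1 = (b - 2)/v := by rw [hb]; field_simp; ring
    field_simp
    subst hb ha
    ring
  by_contra hcon
  push Not at hcon
  obtain ⟨hF, hP⟩ := hcon
  have hzf := hfact z hz h5 h6 h4 h0
  have hmono : Monotone (fun t => Real.exp (WII G (z t))) := by
    refine Real.exp_monotone.comp (mono_of (fun t => (hzf t).2.2.2.2.2.2) (fun t => ?_))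
    obtain ⟨-, -, hp, -⟩ := hzf t
    positivity
  have hb : BddBelow (range (fun t => Real.exp (WII G (z t)))) := by
    refine ⟨0, ?_⟩
    rintro _ ⟨t, rfl⟩
    exact (Real.exp_pos _).le
  have ht := tendsto_atBot_ciInf hmono hb
  obtain ⟨w, hw, hl⟩ := hz.lim hA
  have b5 := hl.zero 5 (hz.z5 h5)
  have b6 := hl.zero 6 (hz.z6 h6)
  have b4 : w 0 4 ≠ 0 := fun h => hF (by
    rw [← typeI hG4 hA hK hw h (b5 0) (b6 0)]; exact hw.mem 0)
  have b0 : w 0 0 ≠ 0 := fun h => typeII_vac hA hK hw (b5 0) (b6 0) h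
  have hwf := hfact w hw (b5 0) (b6 0) b4 b0
  have hconst : ∀ t, Real.exp (WII G (w t)) = ⨅ t, Real.exp (WII G (z t)) := by
    intro t
    obtain ⟨p4, p0, hp, -⟩ := hwf t
    refine hl.eq ht t (V := fun y => Real.exp (WII G y)) ?_
    refine Real.continuous_exp.continuousAt.comp ?_
    unfold WII
    have i4 : ContinuousAt (fun y : E7 => y 4) (w t) := (continuous_apply 4).continuousAt
    have i0 : ContinuousAt (fun y : E7 => y 0) (w t) := (continuous_apply 0).continuousAt
    have i1 : ContinuousAt (fun y : E7 => 1 + G/16 * y 1) (w t) :=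
      (continuous_const.add (continuous_const.mul (continuous_apply 1))).continuousAt
    exact ((continuousAt_const.mul (i4.log p4.ne')).add (continuousAt_const.mul (i0.log p0.ne'))).sub
      (continuousAt_const.mul (i1.log hp.ne'))
  have hconst' : ∀ t, WII G (w t) = WII G (w 0) := fun t => by
    apply Real.exp_injective; rw [hconst t, hconst 0]
  have hu : ∀ t, w t 1 = -2 * v := by
    intro t
    obtain ⟨p4, p0, hp, -, -, -, hd⟩ := hwf t
    have := deriv_zero_of_const hconst' hd
    rw [div_eq_zero_iff] at this
    have h1 := this.resolve_right hp.ne'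
    have h2 := (mul_eq_zero.1 h1).resolve_left (by positivity)
    have := pow_eq_zero_iff two_ne_zero |>.1 h2
    linarith
  obtain ⟨p4, p0, hp, e2, e3, hc, -⟩ := hwf 0
  have hd := deriv_zero_of_const hu (hd1 (hw.sol 0 trivial).1)
  have hG : G = 8 * v := by rw [hv]; ring
  have hqe : qq G (w 0) = 4 * v * w 0 0 + 2 * v^2 := by
    rw [qq, e2, e3, hG, hu 0]; ring
  have hO : w 0 0 = 1 - v^2 - 3/4 * w 0 4^2 := by rw [hu 0] at hc; linarith
  rw [hqe, b5 0, b6 0, hO, hu 0] at hd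
  have hn2 : w 0 4^2 = 2/3 * v * (1 - 2*v) := by
    have : (1 - v^2) * (w 0 4^2 - 2/3 * v * (1 - 2*v)) = 0 := by nlinarith
    have := (mul_eq_zero.1 this).resolve_left hv2.ne'
    linarith
  have hnP : nP G = w 0 4 := by
    rw [nP, ← Real.sqrt_sq p4.le, hn2, hG]; congr 1; ring
  have hω : w 0 0 = 1 - v/2 := by rw [hO, hn2]; ring
  obtain ⟨q4, q0, hqp, f2, f3, gc, -⟩ := hzf 0
  have hle : WII G (w 0) ≤ WII G (z 0) := by
    rw [← Real.exp_le_exp, hconst 0]; exact ciInf_le hb 0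
  have key := log_max hv0 hv1 hm p4 hn2 hω q4 q0 gc (by
    have e : ∀ y : E7, WII G y = 2 * m * log (y 4) + (1 - m) * log (y 0) - 2 * log (1 - v * (-y 1/2)) := by
      intro y
      simp only [WII, hm, hv]
      ring_nf
    rw [e, e] at hle
    have : 1 - v * (-w 0 1/2) = 1 - v * v := by rw [hu 0]; ring
    rw [this] at hle
    exact hle)
  apply hP
  obtain ⟨k1, k2⟩ := key
  have g1 : z 0 1 = -(G/4) := by rw [hG]; linarith
  have g0 : z 0 0 = 1 - G/16 := by rw [k1, k2, hn2] at gc; rw [hG]; linarith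
  ext i
  fin_cases i
  · simpa [pP1] using g0
  · simpa [pP1] using g1
  · simp only [pP1]; simp; rw [f2, g1]; ring
  · simp only [pP1]; simp; rw [f3, g1]; ring
  · simp only [pP1]; simp; rw [k2, hnP]
  · simpa [pP1] using h5
  · simpa [pP1] using h6

/-! ### Cyclic symmetry -/

/-- Cyclic permutation of the three axes. -/
def rot (x : E7) : E7 := ![x 0, x 2, x 3, x 1, x 5, x 6, x 4]

lemma rot_rot_rot (x : E7) : rot (rot (rot x)) = x := by
  ext i; fin_cases i <;> rfl

lemma continuous_rot : Continuous rot := by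
  refine continuous_pi fun i => ?_
  fin_cases i <;> simp [rot] <;> fun_prop

lemma qq_rot (G : ℝ) (x : E7) : qq G (rot x) = qq G x := by
  simp [qq, rot]; ring

lemma FF_rot (G : ℝ) (x : E7) : FF G (rot x) = rot (FF G x) := by
  have h := qq_rot G x
  ext i
  fin_cases i <;> simp [FF, h] <;> simp [rot]

lemma DD_rot {x : E7} (h : x ∈ DD) : rot x ∈ DD := by
  obtain ⟨h0, h1, h2, h3, h4, h5⟩ := h
  refine ⟨h0, ?_, ?_, h4, h5, h3⟩
  · simp [rot]; linarith
  · simp [rot]; linarith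

lemma norm_rot_le {R : ℝ} {x : E7} (h : ‖x‖ ≤ R) : ‖rot x‖ ≤ R := by
  have hR : 0 ≤ R := (norm_nonneg x).trans h
  rw [pi_norm_le_iff_of_nonneg hR] at h ⊢
  intro i
  fin_cases i
  · exact h 0
  · exact h 2
  · exact h 3
  · exact h 1
  · exact h 5
  · exact h 6
  · exact h 4

lemma IsSol.rot {G : ℝ} {I : Set ℝ} {x : ℝ → E7} (h : IsSol G I x) :
    IsSol G I (fun t => rot (x t)) := by
  intro t ht
  obtain ⟨h1, h2⟩ := h t ht
  refine ⟨?_, DD_rot h2⟩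
  rw [FF_rot]
  have h3 := hasDerivAt_pi.1 h1
  refine hasDerivAt_pi.2 fun i => ?_
  fin_cases i
  · exact h3 0
  · exact h3 2
  · exact h3 3
  · exact h3 1
  · exact h3 5
  · exact h3 6
  · exact h3 4

lemma AL_rot {x : ℝ → E7} {p : E7} (h : p ∈ AL x) : rot p ∈ AL (fun t => rot (x t)) :=
  MapClusterPt.continuousAt_comp continuous_rot.continuousAt h

lemma AL_rot' {x : ℝ → E7} {p : E7} (h : p ∈ AL (fun t => rot (x t))) : rot (rot p) ∈ AL x := by
  have := AL_rot (AL_rot h)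
  simpa only [rot_rot_rot] using this

/-- Working context for the contradiction argument. -/
structure Ctx (G R : ℝ) (x : ℝ → E7) : Prop where
  G0 : 0 < G
  G4 : G < 4
  sol : IsSol G (Iic 0) x
  bd : ∀ t ≤ 0, ‖x t‖ ≤ R
  pos : ∀ t ≤ 0, 0 < x t 4 ∧ 0 < x t 5 ∧ 0 < x t 6
  noK : NoK (AL x)
  nF : ¬ Tendsto x atBot (𝓝 pF)
  nP1 : ¬ Tendsto x atBot (𝓝 (pP1 G))
  nP2 : ¬ Tendsto (fun t => rot (x t)) atBot (𝓝 (pP1 G))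
  nP3 : ¬ Tendsto (fun t => rot (rot (x t))) atBot (𝓝 (pP1 G))
  nT1 : ¬ ∀ t ≤ 0, x t 2 = x t 3 ∧ x t 5 = x t 6
  nT2 : ¬ ∀ t ≤ 0, x t 3 = x t 1 ∧ x t 6 = x t 4
  nT3 : ¬ ∀ t ≤ 0, x t 1 = x t 2 ∧ x t 4 = x t 5

lemma rot_pF : rot pF = pF := by ext i; fin_cases i <;> rfl

lemma Ctx.rot {G R : ℝ} {x : ℝ → E7} (h : Ctx G R x) : Ctx G R (fun t => rot (x t)) where
  G0 := h.G0
  G4 := h.G4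
  sol := h.sol.rot
  bd := fun t ht => norm_rot_le (h.bd t ht)
  pos := fun t ht => ⟨(h.pos t ht).2.1, (h.pos t ht).2.2, (h.pos t ht).1⟩
  noK := fun p hp hh => h.noK _ (AL_rot' hp) ⟨hh.1, hh.2.2.2, hh.2.1, hh.2.2.1⟩
  nF := fun hh => h.nF (by
    have h1 := ((continuous_rot.tendsto _).comp ((continuous_rot.tendsto _).comp hh))
    rw [rot_pF, rot_pF] at h1
    refine h1.congr fun t => ?_
    simp only [Function.comp, rot_rot_rot])
  nP1 := h.nP2
  nP2 := h.nP3
  nP3 := by simpa only [rot_rot_rot] using h.nP1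
  nT1 := h.nT2
  nT2 := h.nT3
  nT3 := h.nT1

/-! ### Leaving a fixed point -/

lemma le_of_deriv_nonneg' {f f' : ℝ → ℝ} {a b : ℝ} (hab : a ≤ b)
    (h : ∀ t ∈ Icc a b, HasDerivAt f (f' t) t) (h0 : ∀ t ∈ Ioo a b, 0 ≤ f' t) : f a ≤ f b := by
  refine monotoneOn_of_deriv_nonneg (convex_Icc a b)
    (fun t ht => (h t ht).continuousAt.continuousWithinAt) ?_ ?_ (left_mem_Icc.2 hab)
    (right_mem_Icc.2 hab) hab
  · intro t ht
    exact (h t (interior_subset ht)).differentiableAt.differentiableWithinAt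
  · intro t ht
    rw [(h t (interior_subset ht)).deriv]
    rw [interior_Icc] at ht
    exact h0 t ht

lemma exit_lemma {G R : ℝ} {x : ℝ → E7} (hx : IsSol G (Iic 0) x) (hR : ∀ t ≤ 0, ‖x t‖ ≤ R)
    {Q : E7} (hQ : Q ∈ AL x) (hn : ¬ Tendsto x atBot (𝓝 Q)) (J : Set (Fin 7))
    (c : Fin 7 → E7 → ℝ) (hc : ∀ j, Continuous (c j)) (hcQ : ∀ j ∈ J, 0 < c j Q)
    (hQj : ∀ j ∈ J, Q j = 0)
    (hd : ∀ j ∈ J, ∀ t ≤ 0, HasDerivAt (fun s => x s j) (c j (x t) * x t j) t)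
    (hpos : ∀ j ∈ J, ∀ t ≤ 0, 0 ≤ x t j) : ∃ p ∈ AL x, p ≠ Q ∧ ∀ j ∈ J, p j = 0 := by
  have h1 : ∃ ε0 > 0, ∃ᶠ t in atBot, ε0 ≤ dist (x t) Q := by
    by_contra hcon
    push Not at hcon
    refine hn (Metric.tendsto_nhds.2 fun ε hε => ?_)
    exact hcon ε hε
  obtain ⟨ε0, hε0, hfr⟩ := h1
  have h2 : ∀ᶠ y in 𝓝 Q, ∀ j ∈ J, 0 < c j y := by
    have : ∀ᶠ y in 𝓝 Q, ∀ j, j ∈ J → 0 < c j y := by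
      rw [eventually_all]
      intro j
      by_cases hj : j ∈ J
      · filter_upwards [(hc j).continuousAt.eventually_const_lt (hcQ j hj)] with y hy _
        exact hy
      · exact Eventually.of_forall fun y h => absurd h hj
    exact this
  obtain ⟨ε1, hε1, hε1'⟩ := Metric.eventually_nhds_iff.1 h2
  set ε := min ε0 ε1 with hε
  have hεp : 0 < ε := lt_min hε0 hε1
  have key : ∀ n : ℕ, ∃ s : ℝ, s ≤ -(n:ℝ) ∧ ε ≤ dist (x s) Q ∧ ∀ j ∈ J, x s j ≤ 1/((n:ℝ)+1) := by
    intro n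
    have hδ : 0 < min ε (1/((n:ℝ)+1)) := lt_min hεp (by positivity)
    have hcl : ∃ᶠ t in atBot, x t ∈ Metric.ball Q (min ε (1/((n:ℝ)+1))) :=
      mapClusterPt_iff_frequently.1 hQ _ (Metric.ball_mem_nhds _ hδ)
    obtain ⟨τ, hτ1, hτ2⟩ := (hcl.and_eventually (eventually_le_atBot (-(n:ℝ)))).exists
    rw [Metric.mem_ball] at hτ1
    have hn0 : (0:ℝ) ≤ n := Nat.cast_nonneg n
    obtain ⟨s0, hs1, hs2⟩ := (hfr.and_eventually (eventually_le_atBot τ)).exists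
    have hcont : ContinuousOn (fun t => dist (x t) Q) (Icc s0 τ) := by
      intro t ht
      have h0 : t ≤ 0 := by linarith [ht.2]
      have h1 : ContinuousAt (fun t => dist (x t) Q) t :=
        ContinuousAt.comp (g := fun y => dist y Q) (by fun_prop) (hx t h0).1.continuousAt
      exact h1.continuousWithinAt
    have hcpt : IsCompact (Icc s0 τ ∩ (fun t => dist (x t) Q) ⁻¹' Ici ε) :=
      isCompact_Icc.of_isClosed_subset (hcont.preimage_isClosed_of_isClosed isClosed_Icc isClosed_Ici)
        inter_subset_left
    obtain ⟨s, ⟨hsI, hsε⟩, hsmax⟩ := hcpt.exists_isGreatest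
      ⟨s0, ⟨le_rfl, hs2⟩, (min_le_left _ _).trans hs1⟩
    refine ⟨s, hsI.2.trans hτ2, hsε, fun j hj => ?_⟩
    have hle : x s j ≤ x τ j := by
      refine le_of_deriv_nonneg' hsI.2 (f := fun t => x t j) (fun t ht => hd j hj t (by linarith [ht.2])) ?_
      intro t ht
      have ht0 : t ≤ 0 := by linarith [ht.2]
      refine mul_nonneg (le_of_lt ?_) (hpos j hj t ht0)
      refine hε1' ?_ j hj
      by_contra hcon
      have : t ≤ s := hsmax ⟨⟨hsI.1.trans ht.1.le, ht.2.le⟩, by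
        show ε ≤ _
        exact (min_le_right _ _).trans (not_lt.1 hcon)⟩
      linarith [ht.1]
    have h3 : dist (x τ j) (Q j) ≤ dist (x τ) Q := dist_le_pi_dist _ _ j
    rw [hQj j hj, Real.dist_eq, sub_zero] at h3
    have := le_abs_self (x τ j)
    have := min_le_right ε (1/((n:ℝ)+1))
    linarith
  choose s hs1 hs2 hs3 using key
  have hs0 : ∀ n, s n ≤ 0 := fun n => (hs1 n).trans (by simp)
  obtain ⟨p, -, φ, hφ, hp⟩ := (isCompact_closedBall (0 : E7) R).tendsto_subseq
    (x := fun n => x (s n)) (fun n => by simpa using hR _ (hs0 n))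
  have hsb : Tendsto (fun n => s (φ n)) atTop atBot := by
    have : Tendsto (fun n => s n) atTop atBot :=
      tendsto_atBot_mono hs1 (tendsto_neg_atTop_atBot.comp tendsto_natCast_atTop_atTop)
    exact this.comp hφ.tendsto_atTop
  refine ⟨p, ?_, ?_, ?_⟩
  · exact MapClusterPt.of_comp hsb hp.mapClusterPt
  · have h5 : Tendsto (fun n => dist (x (s (φ n))) Q) atTop (𝓝 (dist p Q)) :=
      hp.dist tendsto_const_nhds
    have h6 : ε ≤ dist p Q := ge_of_tendsto h5 (Eventually.of_forall fun n => hs2 _)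
    intro h
    rw [h, dist_self] at h6
    linarith
  · intro j hj
    have h5 : Tendsto (fun n => x (s (φ n)) j) atTop (𝓝 (p j)) :=
      ((continuous_apply j).tendsto _).comp hp
    refine le_antisymm ?_ (ge_of_tendsto h5 (Eventually.of_forall fun n => hpos j hj _ (hs0 _)))
    refine le_of_tendsto_of_tendsto h5 (tendsto_one_div_add_atTop_nhds_zero_nat.comp hφ.tendsto_atTop)
      (Eventually.of_forall fun n => hs3 _ j hj)

section ctx
variable {x : ℝ → E7}

/-- The growth rate of `N_j`. -/
def rate (G : ℝ) (j : Fin 7) (y : E7) : ℝ := qq G y + 2 * y (j - 3)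

lemma continuous_rate (G : ℝ) (j : Fin 7) : Continuous (rate G j) := by
  have := continuous_qq G
  unfold rate; fun_prop

lemma Ctx.not_F (h : Ctx G R x) : pF ∉ AL x := by
  intro hQ
  obtain ⟨p, hp, hne, hj⟩ := exit_lemma h.sol h.bd hQ h.nF {4, 5, 6} (rate G) (continuous_rate G)
    (by
      have := h.G0
      rintro j (rfl | rfl | rfl) <;> simp [rate, qq, pF] <;> exact this)
    (by rintro j (rfl | rfl | rfl) <;> rfl)
    (by
      rintro j (rfl | rfl | rfl) t ht
      · exact hd4 (h.sol t ht).1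
      · exact hd5 (h.sol t ht).1
      · exact hd6 (h.sol t ht).1)
    (by
      rintro j (rfl | rfl | rfl) t ht
      · exact (h.pos t ht).1.le
      · exact (h.pos t ht).2.1.le
      · exact (h.pos t ht).2.2.le)
  obtain ⟨z, hz, hz0, -⟩ := Good.of_mem_AL h.sol h.bd hp
  refine hne ?_
  rw [← hz0]
  refine typeI h.G4 (isClosed_AL x) h.noK hz ?_ ?_ ?_ <;> rw [hz0] <;> apply hj <;> simp

lemma Ctx.not_P (h : Ctx G R x) : pP1 G ∉ AL x := by
  intro hQ
  have e1 : 0 < qq G (pP1 G) + 2 * (G/8) := by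
    have := h.G0
    have := h.G4
    have : 0 < G/2 * (1 - G/16) := by apply mul_pos <;> linarith
    simp [qq, pP1]
    positivity
  obtain ⟨p, hp, hne, hj⟩ := exit_lemma h.sol h.bd hQ h.nP1 {5, 6} (rate G) (continuous_rate G)
    (by
      rintro j (rfl | rfl)
      · exact e1
      · exact e1)
    (by rintro j (rfl | rfl) <;> rfl)
    (by
      rintro j (rfl | rfl) t ht
      · exact hd5 (h.sol t ht).1
      · exact hd6 (h.sol t ht).1)
    (by
      rintro j (rfl | rfl) t ht
      · exact (h.pos t ht).2.1.le
      · exact (h.pos t ht).2.2.le)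
  obtain ⟨z, hz, hz0, -⟩ := Good.of_mem_AL h.sol h.bd hp
  rcases typeII h.G0 h.G4 (isClosed_AL x) h.noK hz (by rw [hz0]; apply hj; simp)
    (by rw [hz0]; apply hj; simp) with h1 | h1
  · exact h.not_F h1
  · exact hne (hz0 ▸ h1)

lemma Ctx.not56 (h : Ctx G R x) {p : E7} (hp : p ∈ AL x) : ¬ (p 5 = 0 ∧ p 6 = 0) := by
  rintro ⟨h5, h6⟩
  obtain ⟨z, hz, hz0, -⟩ := Good.of_mem_AL h.sol h.bd hp
  rcases typeII h.G0 h.G4 (isClosed_AL x) h.noK hz (by rw [hz0]; exact h5)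
    (by rw [hz0]; exact h6) with h1 | h1
  · exact h.not_F h1
  · exact h.not_P (h1 ▸ hz0 ▸ hp)

lemma Ctx.not64 (h : Ctx G R x) {p : E7} (hp : p ∈ AL x) : ¬ (p 6 = 0 ∧ p 4 = 0) :=
  h.rot.not56 (AL_rot hp)

lemma Ctx.not45 (h : Ctx G R x) {p : E7} (hp : p ∈ AL x) : ¬ (p 4 = 0 ∧ p 5 = 0) :=
  h.rot.rot.not56 (AL_rot (AL_rot hp))

/-- The product of the `N_i` tends to zero. -/
lemma Ctx.prod_zero (h : Ctx G R x) : Tendsto (fun t => x t 4 * x t 5 * x t 6) atBot (𝓝 0) := by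
  have hqn : ∀ y ∈ DD, 0 ≤ qq G y := by
    intro y hy
    have := hy.1
    have := h.G0
    unfold qq; positivity
  have hder : ∀ (w : ℝ → E7) t, HasDerivAt w (FF G (w t)) t →
      HasDerivAt (fun t => w t 4 * w t 5 * w t 6) (3 * qq G (w t) * (w t 4 * w t 5 * w t 6)
        + 2 * (w t 1 + w t 2 + w t 3) * (w t 4 * w t 5 * w t 6)) t := by
    intro w t hw
    refine (((hd4 hw).mul (hd5 hw)).mul (hd6 hw)).congr_deriv ?_
    simp only [Pi.mul_apply]; ring
  set V : E7 → ℝ := fun y => y 4 * y 5 * y 6 with hV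
  have hVc : Continuous V := by fun_prop
  have hmono : Monotone (fun t => V (x (min t 0))) := by
    intro a b hab
    refine le_of_deriv_nonneg (f := fun t => V (x t)) (min_le_min_right 0 hab)
      (fun t ht => hder x t (h.sol t (ht.2.trans (min_le_right _ _))).1) ?_
    intro t ht
    have ht0 : t ≤ 0 := ht.2.trans (min_le_right _ _)
    obtain ⟨p4, p5, p6⟩ := h.pos t ht0
    have hs := (h.sol t ht0).2
    rw [hs.2.1]
    have := hqn _ hs
    have : 0 ≤ x t 4 * x t 5 * x t 6 := by positivity
    have : 0 ≤ 3 * qq G (x t) * (x t 4 * x t 5 * x t 6) := by positivity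
    linarith
  have hb : BddBelow (range (fun t => V (x (min t 0)))) := by
    refine ⟨0, ?_⟩
    rintro _ ⟨t, rfl⟩
    obtain ⟨p4, p5, p6⟩ := h.pos _ (min_le_right t 0)
    simp only [hV]; positivity
  have ht := tendsto_atBot_ciInf hmono hb
  set L := ⨅ t, V (x (min t 0)) with hL
  have ht' : Tendsto (fun t => V (x t)) atBot (𝓝 L) := by
    refine ht.congr' ?_
    filter_upwards [eventually_le_atBot 0] with t ht
    rw [min_eq_left ht]
  suffices L = 0 by rw [this] at ht'; exact ht'
  by_contra hne
  obtain ⟨z, hz, hl⟩ : ∃ z, Good G R (AL x) z ∧ LimOf x z := by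
    obtain ⟨p, -, hp⟩ := (isCompact_closedBall (0 : E7) R).exists_mapClusterPt_of_frequently
      (l := atBot) (f := x) (by
        refine Eventually.frequently ?_
        filter_upwards [eventually_le_atBot 0] with t ht
        simpa using h.bd t ht)
    obtain ⟨z, hz, -, hl⟩ := Good.of_mem_AL h.sol h.bd hp
    exact ⟨z, hz, hl⟩
  have hzL : ∀ t, V (z t) = L := fun t => hl.eq ht' t hVc.continuousAt
  have hq0 : ∀ t, qq G (z t) = 0 := by
    intro t
    have := deriv_zero_of_const hzL (hder z t (hz.sol t trivial).1)
    have e : z t 4 * z t 5 * z t 6 = L := hzL t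
    rw [e, (hz.sol t trivial).2.2.1] at this
    have : qq G (z t) * L = 0 := by linarith
    exact (mul_eq_zero.1 this).resolve_right hne
  have hs0 : ∀ t, z t 0 = 0 ∧ z t 1 = 0 ∧ z t 2 = 0 ∧ z t 3 = 0 := by
    intro t
    have e := hq0 t
    have e0 := (hz.sol t trivial).2.1
    have e1 : 0 ≤ G/2 * z t 0 := mul_nonneg (by linarith [h.G0]) e0
    unfold qq at e
    have a1 := sq_nonneg (z t 1)
    have a2 := sq_nonneg (z t 2)
    have a3 := sq_nonneg (z t 3)
    refine ⟨?_, ?_, ?_, ?_⟩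
    · have : G/2 * z t 0 = 0 := by linarith
      exact (mul_eq_zero.1 this).resolve_left (by linarith [h.G0])
    · exact pow_eq_zero_iff two_ne_zero |>.1 (by linarith : z t 1^2 = 0)
    · exact pow_eq_zero_iff two_ne_zero |>.1 (by linarith : z t 2^2 = 0)
    · exact pow_eq_zero_iff two_ne_zero |>.1 (by linarith : z t 3^2 = 0)
  have D := (hz.sol 0 trivial).1
  have d1 := deriv_zero_of_const (fun t => (hs0 t).2.1) (hd1 D)
  have d2 := deriv_zero_of_const (fun t => (hs0 t).2.2.1) (hd2 D)
  have d3 := deriv_zero_of_const (fun t => (hs0 t).2.2.2) (hd3 D)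
  obtain ⟨s0, s1, s2, s3⟩ := hs0 0
  obtain ⟨-, -, hc, p4, p5, p6⟩ := (hz.sol 0 trivial).2
  rw [s0, s1, s2, s3] at hc
  rw [s1] at d1
  rw [s2] at d2
  rw [s3] at d3
  have hneg : z 0 4^2 + z 0 5^2 + z 0 6^2 - 2*(z 0 4 * z 0 5 + z 0 5 * z 0 6 + z 0 6 * z 0 4) = 4/3 := by
    linarith
  have f1 : (z 0 4 - z 0 5) * (z 0 4 + z 0 5 - z 0 6) = 0 := by nlinarith
  have q1 := mul_nonneg p4 p5
  rcases mul_eq_zero.1 f1 with g | g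
  · have g' : z 0 5 = z 0 4 := by linarith
    rw [g'] at d3 hneg
    have : (z 0 6 - z 0 4) * z 0 6 = 0 := by nlinarith
    rcases mul_eq_zero.1 this with k | k
    · have k' : z 0 6 = z 0 4 := by linarith
      rw [k'] at hneg
      nlinarith
    · rw [k] at hneg
      nlinarith
  · have g' : z 0 6 = z 0 4 + z 0 5 := by linarith
    rw [g'] at hneg
    nlinarith

end ctx

/-! ### Limit orbits of type VII₀ -/

section ctx
variable {x : ℝ → E7}

/-- Deviation from local rotational symmetry about the first axis. -/
def r2 (y : E7) : ℝ := (y 2 - y 3)^2/12 + 3/4 * (y 5 - y 6)^2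

/-- Derivative of `r2` along solutions. -/
def r2d (G : ℝ) (y : E7) : ℝ :=
  -(2 - qq G y) * (y 2 - y 3)^2/6 + 3/2 * (qq G y - y 1) * (y 5 - y 6)^2
    + 3/2 * y 4 * ((y 2 - y 3) * (y 5 - y 6))

lemma continuous_r2 : Continuous r2 := by unfold r2; fun_prop

lemma r2_nonneg (y : E7) : 0 ≤ r2 y := by unfold r2; positivity

lemma r2_zero {y : E7} (h : r2 y = 0) : y 2 = y 3 ∧ y 5 = y 6 := by
  unfold r2 at h
  have h1 := sq_nonneg (y 2 - y 3)
  have h2 := sq_nonneg (y 5 - y 6)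
  have e1 := pow_eq_zero_iff two_ne_zero |>.1 (by linarith : (y 2 - y 3)^2 = 0)
  have e2 := pow_eq_zero_iff two_ne_zero |>.1 (by linarith : (y 5 - y 6)^2 = 0)
  exact ⟨by linarith, by linarith⟩

lemma hd_r2 {t : ℝ} (h : HasDerivAt x (FF G (x t)) t) (hD : x t ∈ DD) :
    HasDerivAt (fun s => r2 (x s)) (r2d G (x t)) t := by
  have h1 := ((((hd2 h).sub (hd3 h)).pow 2).div_const 12).add
    ((((hd5 h).sub (hd6 h)).pow 2).const_mul (3/4))
  refine h1.congr_deriv ?_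
  have e : x t 1 = -x t 2 - x t 3 := by linarith [hD.2.1]
  simp only [r2d, Pi.sub_apply, e]
  push_cast
  ring

lemma hd_p {t : ℝ} (h : HasDerivAt x (FF G (x t)) t) (hD : x t ∈ DD) :
    HasDerivAt (fun s => x s 5 * x s 6) (2 * (qq G (x t) - x t 1) * (x t 5 * x t 6)) t := by
  refine ((hd5 h).mul (hd6 h)).congr_deriv ?_
  have e : x t 1 = -x t 2 - x t 3 := by linarith [hD.2.1]
  rw [e]
  ring

lemma con1 {y : E7} (hD : y ∈ DD) :
    y 0 + y 1^2/4 + r2 y + 3/4 * (y 4^2 - 2 * y 4 * (y 5 + y 6)) = 1 := by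
  have e : y 1 = -y 2 - y 3 := by linarith [hD.2.1]
  have := hD.2.2.1
  rw [e] at this
  unfold r2
  rw [e]
  linarith

lemma r2d_bound (G : ℝ) (y : E7) :
    |r2d G y| ≤ (2 * |2 - qq G y| + 2 * |qq G y - y 1| + 3 * |y 4|) * |r2 y| := by
  rw [abs_of_nonneg (r2_nonneg y)]
  have h1 := sq_nonneg (y 2 - y 3)
  have h2 := sq_nonneg (y 5 - y 6)
  have h3 : |(y 2 - y 3) * (y 5 - y 6)| ≤ 2 * r2 y := by
    unfold r2
    rw [abs_le]
    constructor <;> nlinarith [sq_nonneg ((y 2 - y 3) - 3 * (y 5 - y 6)), sq_nonneg ((y 2 - y 3) + 3 * (y 5 - y 6))]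
  have a1 : |-(2 - qq G y) * (y 2 - y 3)^2/6| ≤ 2 * |2 - qq G y| * r2 y := by
    have e : |-(2 - qq G y) * (y 2 - y 3)^2/6| = |2 - qq G y| * ((y 2 - y 3)^2/6) := by
      rw [mul_div_assoc, abs_mul, abs_neg, abs_of_nonneg (a := (y 2 - y 3)^2/6) (by positivity)]
    rw [e]
    have : (y 2 - y 3)^2/6 ≤ 2 * r2 y := by unfold r2; linarith
    calc _ ≤ |2 - qq G y| * (2 * r2 y) := mul_le_mul_of_nonneg_left this (abs_nonneg _)
      _ = _ := by ring
  have a2 : |3/2 * (qq G y - y 1) * (y 5 - y 6)^2| ≤ 2 * |qq G y - y 1| * r2 y := by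
    have e : |3/2 * (qq G y - y 1) * (y 5 - y 6)^2| = |qq G y - y 1| * (3/2 * (y 5 - y 6)^2) := by
      rw [abs_mul, abs_mul, abs_of_nonneg (a := (y 5 - y 6)^2) (by positivity),
        abs_of_nonneg (a := (3/2 : ℝ)) (by positivity)]
      ring
    rw [e]
    have : 3/2 * (y 5 - y 6)^2 ≤ 2 * r2 y := by unfold r2; linarith
    calc _ ≤ |qq G y - y 1| * (2 * r2 y) := mul_le_mul_of_nonneg_left this (abs_nonneg _)
      _ = _ := by ring
  have a3 : |3/2 * y 4 * ((y 2 - y 3) * (y 5 - y 6))| ≤ 3 * |y 4| * r2 y := by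
    rw [abs_mul, abs_mul, abs_of_nonneg (a := (3/2 : ℝ)) (by positivity)]
    have := mul_le_mul_of_nonneg_left h3 (abs_nonneg (y 4))
    linarith
  unfold r2d
  refine (abs_add_le _ _).trans ((add_le_add ((abs_add_le _ _).trans (add_le_add a1 a2)) a3).trans ?_)
  linarith

/-- `r2` vanishes identically or nowhere. -/
lemma r2_zero_prop {I : Set ℝ} (hI : I.OrdConnected) (hx : IsSol G I x) (hR : ∀ t ∈ I, ‖x t‖ ≤ R)
    {T : ℝ} (hT : T ∈ I) (h0 : r2 (x T) = 0) : ∀ t ∈ I, r2 (x t) = 0 := by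
  obtain ⟨C, hC⟩ := bound_cont R
    (c := fun y => 2 * |2 - qq G y| + 2 * |qq G y - y 1| + 3 * |y 4|)
    (by have := continuous_qq G; fun_prop)
  refine lin_zero (f := fun t => r2 (x t)) hI (fun t ht => hd_r2 (hx t ht).1 (hx t ht).2) (C := C)
    (fun t ht => (r2d_bound G (x t)).trans ?_) hT h0
  exact mul_le_mul_of_nonneg_right ((le_abs_self _).trans (hC _ (hR t ht))) (abs_nonneg _)

lemma sign_prop (hz : Good G R A z) {f : ℝ → ℝ} {c : E7 → ℝ} (hc : Continuous c)
    (h : ∀ t, HasDerivAt f (c (z t) * f t) t) (h0 : f 0 ≤ 0) : ∀ t, f t ≤ 0 := by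
  intro t
  by_contra hcon
  push Not at hcon
  have hcont : Continuous f := continuous_iff_continuousAt.2 fun t => (h t).continuousAt
  obtain ⟨T, -, hT⟩ := intermediate_value_uIcc (a := 0) (b := t) hcont.continuousOn
    (show (0:ℝ) ∈ uIcc (f 0) (f t) from ⟨by simp [h0], by simp [hcon.le]⟩)
  have := hz.lin hc h hT t
  linarith

lemma Ctx.typeVII_a (h : Ctx G R x) (hz : Good G R (AL x) z) (h4 : z 0 4 = 0) :
    r2 (z 0) = 0 := by
  by_contra hr
  have pos : ∀ w : ℝ → E7, Good G R (AL x) w → w 0 4 = 0 → ∀ t, w t 4 = 0 ∧ 0 < w t 5 ∧ 0 < w t 6 := by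
    intro w hw h4 t
    have h4' := hw.z4 h4 t
    have h5 : w t 5 ≠ 0 := fun h5 => h.not45 (hw.mem t) ⟨h4', h5⟩
    have h6 : w t 6 ≠ 0 := fun h6 => h.not64 (hw.mem t) ⟨h6, h4'⟩
    exact ⟨h4', hw.pos5 h5 t, hw.pos6 h6 t⟩
  have r2pos : ∀ w : ℝ → E7, Good G R (AL x) w → r2 (w 0) ≠ 0 → ∀ t, 0 < r2 (w t) := by
    intro w hw h0 t
    refine lt_of_le_of_ne (r2_nonneg _) (fun hh => h0 ?_)
    exact r2_zero_prop (I := univ) ordConnected_univ hw.sol (fun t _ => hw.bd t) (mem_univ t) hh.symm 0 trivial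
  have s1 : ∀ w : ℝ → E7, Good G R (AL x) w → w 0 4 = 0 → r2 (w 0) ≠ 0 → ∀ t, w t 1 < 2 := by
    intro w hw h4 h0 t
    have e1 := con1 (hw.sol t trivial).2
    rw [hw.z4 h4 t] at e1
    have e2 := (hw.sol t trivial).2.1
    have e3 := r2pos w hw h0 t
    nlinarith
  have hder : ∀ w : ℝ → E7, Good G R (AL x) w → w 0 4 = 0 → r2 (w 0) ≠ 0 → ∀ t,
      HasDerivAt (fun s => w s 5 * w s 6 / r2 (w s))
        ((w t 5 * w t 6) * (2 - w t 1) * (w t 2 - w t 3)^2 / (6 * r2 (w t)^2)) t := by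
    intro w hw h4 h0 t
    have D := hw.sol t trivial
    have hr := (r2pos w hw h0 t).ne'
    refine ((hd_p D.1 D.2).div (hd_r2 D.1 D.2) hr).congr_deriv ?_
    rw [div_eq_div_iff (by positivity) (by positivity)]
    have e : r2d G (w t) = -(2 - qq G (w t)) * (w t 2 - w t 3)^2/6
        + 3/2 * (qq G (w t) - w t 1) * (w t 5 - w t 6)^2 := by
      unfold r2d; rw [hw.z4 h4 t]; ring
    have e' : 3/4 * (w t 5 - w t 6)^2 = r2 (w t) - (w t 2 - w t 3)^2/12 := by unfold r2; ring
    have e'' : r2d G (w t) = -(2 - qq G (w t)) * (w t 2 - w t 3)^2/6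
        + 2 * (qq G (w t) - w t 1) * (r2 (w t) - (w t 2 - w t 3)^2/12) := by
      rw [e, ← e']; ring
    rw [e'']
    ring
  have hmono : Monotone (fun s => z s 5 * z s 6 / r2 (z s)) := by
    refine mono_of (hder z hz h4 hr) (fun t => ?_)
    obtain ⟨-, p5, p6⟩ := pos z hz h4 t
    have := s1 z hz h4 hr t
    have : 0 ≤ 2 - z t 1 := by linarith
    positivity
  have hb : BddBelow (range (fun s => z s 5 * z s 6 / r2 (z s))) := by
    refine ⟨0, ?_⟩
    rintro _ ⟨t, rfl⟩
    obtain ⟨-, p5, p6⟩ := pos z hz h4 t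
    have := r2_nonneg (z t)
    positivity
  have ht := tendsto_atBot_ciInf hmono hb
  set L := ⨅ s, z s 5 * z s 6 / r2 (z s) with hL
  obtain ⟨w, hw, hl⟩ := hz.lim (isClosed_AL x)
  have w4 : w 0 4 = 0 := hl.zero 4 (hz.z4 h4) 0
  have hwL : ∀ t, w t 5 * w t 6 = L * r2 (w t) := by
    intro t
    obtain ⟨U, hU, hUt⟩ := hl
    have h2 : Tendsto (fun τ : ℝ => τ + t) atBot atBot := tendsto_atBot_add_const_right _ _ tendsto_id
    have k1 : Tendsto (fun τ => z (τ+t) 5 * z (τ+t) 6 / r2 (z (τ+t))) U (𝓝 L) :=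
      (ht.comp h2).mono_left hU
    have k2 : Tendsto (fun τ => r2 (z (τ+t))) U (𝓝 (r2 (w t))) :=
      (continuous_r2.tendsto _).comp (hUt t)
    have k3 : Tendsto (fun τ => z (τ+t) 5 * z (τ+t) 6) U (𝓝 (w t 5 * w t 6)) :=
      ((by fun_prop : Continuous fun y : E7 => y 5 * y 6).tendsto _).comp (hUt t)
    refine tendsto_nhds_unique k3 ((k1.mul k2).congr fun τ => ?_)
    have := (r2pos z hz hr (τ+t)).ne'
    field_simp
  have wr : ∀ t, r2 (w t) ≠ 0 := by
    intro t h0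
    obtain ⟨-, p5, p6⟩ := pos w hw w4 t
    have := hwL t
    rw [h0, mul_zero] at this
    have := mul_pos p5 p6
    linarith
  have wV : ∀ t, w t 5 * w t 6 / r2 (w t) = L := fun t => by
    rw [hwL t, mul_div_assoc, div_self (wr t), mul_one]
  have wd : ∀ t, w t 2 - w t 3 = 0 := by
    intro t
    have := deriv_zero_of_const wV (hder w hw w4 (wr 0) t)
    obtain ⟨-, p5, p6⟩ := pos w hw w4 t
    have h1 := s1 w hw w4 (wr 0) t
    have h2 := wr t
    rw [div_eq_zero_iff] at this
    have h3 := this.resolve_right (by positivity)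
    have h4 : w t 5 * w t 6 * (2 - w t 1) ≠ 0 := by
      have : 0 < 2 - w t 1 := by linarith
      positivity
    exact pow_eq_zero_iff two_ne_zero |>.1 ((mul_eq_zero.1 h3).resolve_left h4)
  have D := (hw.sol 0 trivial).1
  have := deriv_zero_of_const wd ((hd2 D).sub (hd3 D))
  have e23 := wd 0
  obtain ⟨-, p5, p6⟩ := pos w hw w4 0
  rw [w4] at this
  have h1 : (w 0 5 - w 0 6) * (w 0 5 + w 0 6) = 0 := by
    have e : w 0 2 = w 0 3 := by linarith
    rw [e] at this
    nlinarith
  have h2 : w 0 5 - w 0 6 = 0 := (mul_eq_zero.1 h1).resolve_right (by positivity)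
  apply wr 0
  unfold r2
  rw [e23, h2]; ring

lemma Ctx.typeVII (h : Ctx G R x) {p : E7} (hp : p ∈ AL x) (h4 : p 4 = 0) :
    r2 p = 0 ∧ 0 < p 1 ∧ 0 < p 5 ∧ 0 < p 6 := by
  obtain ⟨z, hz, hz0, -⟩ := Good.of_mem_AL h.sol h.bd hp
  rw [← hz0] at h4 ⊢
  have hr := h.typeVII_a hz h4
  have h5 : z 0 5 ≠ 0 := fun h5 => h.not45 (hz.mem 0) ⟨h4, h5⟩
  have h6 : z 0 6 ≠ 0 := fun h6 => h.not64 (hz.mem 0) ⟨h6, h4⟩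
  refine ⟨hr, ?_, hz.pos5 h5 0, hz.pos6 h6 0⟩
  by_contra hneg
  push Not at hneg
  have hr' : ∀ t, r2 (z t) = 0 := fun t =>
    r2_zero_prop (I := univ) ordConnected_univ hz.sol (fun t _ => hz.bd t) (mem_univ 0) hr t trivial
  have h4' := hz.z4 h4
  have hs : ∀ t, z t 1 ≤ 0 := by
    refine sign_prop hz (f := fun t => z t 1) (c := fun y => -(2 - qq G y))
      (by have := continuous_qq G; fun_prop) (fun t => ?_) hneg
    refine (hd1 (hz.sol t trivial).1).congr_deriv ?_
    rw [h4' t, (r2_zero (hr' t)).2]; ring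
  have hqn : ∀ y ∈ DD, 0 ≤ qq G y := by
    intro y hy
    have := hy.1
    have := h.G0
    unfold qq; positivity
  have hmono : Monotone (fun t => z t 5) := by
    refine mono_of (fun t => hd5 (hz.sol t trivial).1) (fun t => ?_)
    have h1 := (hz.sol t trivial).2
    have h2 := hqn _ h1
    have h3 := (r2_zero (hr' t)).1
    have h4 := h1.2.1
    have h5 := hs t
    exact mul_nonneg (by linarith) h1.2.2.2.2.1
  obtain ⟨w, hw, hl, L, hL, -⟩ := lasalle (isClosed_AL x) hz (V := fun y => y 5) (by fun_prop) hmono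
  have w4 : w 0 4 = 0 := hl.zero 4 h4' 0
  have wr : r2 (w 0) = 0 := hl.closed (C := {y | r2 y = 0})
    (isClosed_eq continuous_r2 continuous_const) (Eventually.of_forall hr') 0
  have ws : w 0 1 ≤ 0 := hl.closed (C := {y | y 1 ≤ 0})
    (isClosed_le (by fun_prop) continuous_const) (Eventually.of_forall hs) 0
  have w5 : w 0 5 ≠ 0 := fun h5 => h.not45 (hw.mem 0) ⟨w4, h5⟩
  have hd := deriv_zero_of_const hL (hd5 (hw.sol 0 trivial).1)
  have hd' := (mul_eq_zero.1 hd).resolve_right w5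
  have D := (hw.sol 0 trivial).2
  have e1 := (r2_zero wr).1
  have e2 := hqn _ D
  have e3 := D.2.1
  have e4 : w 0 1 = 0 := by linarith
  have e5 : qq G (w 0) = 0 := by linarith
  have e6 := con1 D
  rw [w4, wr, e4] at e6
  unfold qq at e5
  have e7 : w 0 0 = 1 := by linarith
  rw [e7] at e5
  have := h.G0
  nlinarith [sq_nonneg (w 0 1), sq_nonneg (w 0 2), sq_nonneg (w 0 3)]

end ctx

/-! ### The contradiction -/

section ctx
variable {x : ℝ → E7}

lemma Ctx.ev_open (h : Ctx G R x) {U : Set E7} (hU : IsOpen U) (hAU : AL x ⊆ U) :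
    ∀ᶠ t in atBot, x t ∈ U := by
  by_contra hcon
  have hf : ∃ᶠ t in atBot, x t ∈ Metric.closedBall (0 : E7) R ∩ Uᶜ := by
    have h1 : ∃ᶠ t in atBot, x t ∉ U := not_eventually.1 hcon
    refine (h1.and_eventually (eventually_le_atBot 0)).mono ?_
    rintro t ⟨a, b⟩
    exact ⟨by simpa using h.bd t b, a⟩
  obtain ⟨p, hp, hp'⟩ := ((isCompact_closedBall (0 : E7) R).inter_right hU.isClosed_compl).exists_mapClusterPt_of_frequently hf
  exact hp.2 (hAU hp')

lemma Ctx.AL_bd (h : Ctx G R x) {p : E7} (hp : p ∈ AL x) : ‖p‖ ≤ R := by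
  obtain ⟨z, hz, hz0, -⟩ := Good.of_mem_AL h.sol h.bd hp
  rw [← hz0]; exact hz.bd 0

lemma Ctx.AL_DD (h : Ctx G R x) {p : E7} (hp : p ∈ AL x) : p ∈ DD := by
  obtain ⟨z, hz, hz0, -⟩ := Good.of_mem_AL h.sol h.bd hp
  rw [← hz0]; exact (hz.sol 0 trivial).2

lemma Ctx.ev_lower (h : Ctx G R x) {f : E7 → ℝ} (hf : Continuous f) (hp : ∀ p ∈ AL x, 0 < f p) :
    ∃ c > 0, ∀ᶠ t in atBot, c < f (x t) := by
  have hc : IsCompact (AL x) := (isCompact_closedBall (0 : E7) R).of_isClosed_subset (isClosed_AL x)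
    (fun p hp => by simpa using h.AL_bd hp)
  rcases (AL x).eq_empty_or_nonempty with he | hne
  · refine ⟨1, one_pos, ?_⟩
    exact h.ev_open (U := {y | 1 < f y}) (isOpen_lt continuous_const hf) (by rw [he]; exact empty_subset _)
  · obtain ⟨p, hpA, hmin⟩ := hc.exists_isMinOn hne hf.continuousOn
    refine ⟨f p / 2, half_pos (hp p hpA), ?_⟩
    refine h.ev_open (U := {y | f p / 2 < f y}) (isOpen_lt continuous_const hf) (fun y hy => ?_)
    have h1 := hp p hpA
    have h2 : f p ≤ f y := hmin hy
    show f p / 2 < f y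
    linarith

lemma Ctx.final1 (h : Ctx G R x) (hU : ∀ᶠ t in atBot, x t 4 < x t 5 ∧ x t 4 < x t 6) : False := by
  -- the limit set lies in the Taub set of the first axis
  have hP0 : ∀ p ∈ AL x, p 4 * p 5 * p 6 = 0 := by
    intro p hp
    obtain ⟨z, hz, hz0, hl⟩ := Good.of_mem_AL h.sol h.bd hp
    rw [← hz0]
    exact hl.eq h.prod_zero 0 (V := fun y => y 4 * y 5 * y 6) (by fun_prop)
  have h40 : ∀ p ∈ AL x, p 4 = 0 := by
    intro p hp
    obtain ⟨z, hz, hz0, hl⟩ := Good.of_mem_AL h.sol h.bd hp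
    have hle : p 4 ≤ p 5 ∧ p 4 ≤ p 6 := by
      rw [← hz0]
      refine hl.closed (C := {y | y 4 ≤ y 5 ∧ y 4 ≤ y 6}) ?_ (hU.mono fun t ht => ⟨ht.1.le, ht.2.le⟩) 0
      exact (isClosed_le (continuous_apply 4) (continuous_apply 5)).inter
        (isClosed_le (continuous_apply 4) (continuous_apply 6))
    have hnn := (h.AL_DD hp).2.2.2.1
    rcases mul_eq_zero.1 (hP0 p hp) with h1 | h1
    · rcases mul_eq_zero.1 h1 with h1 | h1
      · exact h1
      · linarith [hle.1]
    · linarith [hle.2]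
  have hA : ∀ p ∈ AL x, r2 p = 0 ∧ 0 < p 1 ∧ 0 < p 5 ∧ 0 < p 6 := fun p hp => h.typeVII hp (h40 p hp)
  obtain ⟨δ, hδ, hδ'⟩ := h.ev_lower (f := fun y => y 1) (by fun_prop) (fun p hp => (hA p hp).2.1)
  obtain ⟨c, hc, hc'⟩ := h.ev_lower (f := fun y => y 5 * y 6) (by fun_prop)
    (fun p hp => mul_pos (hA p hp).2.2.1 (hA p hp).2.2.2)
  have hr0 : ∀ ε > 0, ∀ᶠ t in atBot, r2 (x t) < ε := by
    intro ε hε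
    exact h.ev_open (U := {y | r2 y < ε}) (isOpen_lt continuous_r2 continuous_const)
      (fun p hp => by show r2 p < ε; rw [(hA p hp).1]; exact hε)
  obtain ⟨T0, hT0⟩ := eventually_atBot.1 (hδ'.and (hc'.and (eventually_le_atBot 0)))
  -- `r2` does not vanish
  have hrp : ∀ t ≤ 0, 0 < r2 (x t) := by
    intro t ht
    refine lt_of_le_of_ne (r2_nonneg _) (fun hh => h.nT1 ?_)
    intro s hs
    exact r2_zero (r2_zero_prop (I := Iic 0) ordConnected_Iic h.sol h.bd ht hh.symm s hs)
  have hR0 : 0 ≤ R := (norm_nonneg _).trans (h.bd 0 le_rfl)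
  set C := 12 * R + 3 with hC
  have hC0 : 0 < C := by positivity
  set f : ℝ → ℝ := fun t => log (r2 (x t)) - log (x t 5 * x t 6) - C / (2*δ) * x t 4 with hf
  have hfT : ∀ t ≤ T0, f T0 ≤ f t := by
    intro t ht
    have := le_of_deriv_nonneg (f := fun t => -f t) (f' := fun t => -(r2d G (x t) / r2 (x t)
      - 2 * (qq G (x t) - x t 1) * (x t 5 * x t 6) / (x t 5 * x t 6)
      - C / (2*δ) * ((qq G (x t) + 2 * x t 1) * x t 4))) ht (fun s hs => by
        obtain ⟨-, -, hs0⟩ := hT0 s hs.2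
        obtain ⟨p4, p5, p6⟩ := h.pos s hs0
        have D := h.sol s hs0
        exact ((((hd_r2 D.1 D.2).log (hrp s hs0).ne').sub
          ((hd_p D.1 D.2).log (mul_pos p5 p6).ne')).sub ((hd4 D.1).const_mul _)).neg)
      (fun s hs => by
        obtain ⟨hs1, -, hs0⟩ := hT0 s hs.2
        obtain ⟨p4, p5, p6⟩ := h.pos s hs0
        have D := (h.sol s hs0).2
        have hr := hrp s hs0
        have hcon := con1 D
        have hO := D.1
        have hq : 0 ≤ qq G (x s) := by
          have := h.G0
          unfold qq; positivity
        have hb := h.bd s hs0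
        have b5 : x s 5 ≤ R := (le_abs_self _).trans ((norm_le_pi_norm (x s) 5).trans hb)
        have b6 : x s 6 ≤ R := (le_abs_self _).trans ((norm_le_pi_norm (x s) 6).trans hb)
        have k1 : C * x s 4 ≤ C / (2*δ) * ((qq G (x s) + 2 * x s 1) * x s 4) := by
          have e : C * x s 4 = C / (2*δ) * ((2*δ) * x s 4) := by field_simp
          rw [e]
          have : (2*δ) * x s 4 ≤ (qq G (x s) + 2 * x s 1) * x s 4 :=
            mul_le_mul_of_nonneg_right (by linarith) p4.le
          exact mul_le_mul_of_nonneg_left this (by positivity)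
        have k2 : 2 * (qq G (x s) - x s 1) * (x s 5 * x s 6) / (x s 5 * x s 6)
            = 2 * (qq G (x s) - x s 1) := by
          rw [mul_div_assoc, div_self (mul_pos p5 p6).ne', mul_one]
        have k3 : r2d G (x s) ≤ (2 * (qq G (x s) - x s 1) + C * x s 4) * r2 (x s) := by
          have e : r2d G (x s) = 2 * (qq G (x s) - x s 1) * r2 (x s)
              + (x s 1 - 2) * ((x s 2 - x s 3)^2/6)
              + 3/2 * x s 4 * ((x s 2 - x s 3) * (x s 5 - x s 6)) := by
            unfold r2d r2; ring
          have l1 : x s 1 - 2 ≤ 6 * R * x s 4 := by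
            by_contra hcc
            push Not at hcc
            have m1 : x s 4 * (x s 5 + x s 6) ≤ x s 4 * (2 * R) :=
              mul_le_mul_of_nonneg_left (by linarith) p4.le
            have m2 : 0 ≤ R * x s 4 := by positivity
            have m3 : x s 1^2/4 ≤ 1 + 3 * (R * x s 4) := by
              nlinarith [sq_nonneg (x s 4)]
            nlinarith [sq_nonneg (x s 4)]
          have l2 : (x s 2 - x s 3)^2/6 ≤ 2 * r2 (x s) := by
            unfold r2; linarith [sq_nonneg (x s 5 - x s 6)]
          have l3 : (x s 2 - x s 3) * (x s 5 - x s 6) ≤ 2 * r2 (x s) := by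
            unfold r2; nlinarith [sq_nonneg ((x s 2 - x s 3) - 3 * (x s 5 - x s 6))]
          have l4 : (x s 1 - 2) * ((x s 2 - x s 3)^2/6) ≤ 6 * R * x s 4 * (2 * r2 (x s)) :=
            (mul_le_mul_of_nonneg_right l1 (by positivity)).trans
              (mul_le_mul_of_nonneg_left l2 (by positivity))
          have l5 : 3/2 * x s 4 * ((x s 2 - x s 3) * (x s 5 - x s 6)) ≤ 3/2 * x s 4 * (2 * r2 (x s)) :=
            mul_le_mul_of_nonneg_left l3 (by positivity)
          rw [e, hC]
          linarith
        have k4 : r2d G (x s) / r2 (x s) ≤ 2 * (qq G (x s) - x s 1) + C * x s 4 := by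
          rwa [div_le_iff₀ hr]
        rw [k2]
        linarith)
    linarith
  obtain ⟨t, ht1, ht2⟩ := ((hr0 (c * Real.exp (f T0)) (by positivity)).and (eventually_le_atBot T0)).exists
  obtain ⟨-, hcp, ht0⟩ := hT0 t ht2
  have h1 := hfT t ht2
  have h2 : 0 ≤ C / (2*δ) * x t 4 := by
    have := (h.pos t ht0).1
    positivity
  have h3 : f T0 + log (x t 5 * x t 6) ≤ log (r2 (x t)) := by
    have : f t = log (r2 (x t)) - log (x t 5 * x t 6) - C / (2*δ) * x t 4 := rfl
    linarith
  have hpp : 0 < x t 5 * x t 6 := hc.trans hcp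
  have h4 := Real.exp_le_exp.2 h3
  rw [Real.exp_add, Real.exp_log hpp, Real.exp_log (hrp t ht0)] at h4
  have h5 : c * Real.exp (f T0) ≤ Real.exp (f T0) * (x t 5 * x t 6) := by
    rw [mul_comm]
    exact mul_le_mul_of_nonneg_left (le_of_lt hcp) (Real.exp_pos _).le
  linarith

lemma Ctx.contra (h : Ctx G R x) : False := by
  set U1 : Set E7 := {y | y 4 < y 5 ∧ y 4 < y 6} with hU1
  set U2 : Set E7 := {y | y 5 < y 6 ∧ y 5 < y 4} with hU2
  set U3 : Set E7 := {y | y 6 < y 4 ∧ y 6 < y 5} with hU3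
  have o1 : IsOpen U1 := (isOpen_lt (continuous_apply 4) (continuous_apply 5)).inter
    (isOpen_lt (continuous_apply 4) (continuous_apply 6))
  have o2 : IsOpen U2 := (isOpen_lt (continuous_apply 5) (continuous_apply 6)).inter
    (isOpen_lt (continuous_apply 5) (continuous_apply 4))
  have o3 : IsOpen U3 := (isOpen_lt (continuous_apply 6) (continuous_apply 4)).inter
    (isOpen_lt (continuous_apply 6) (continuous_apply 5))
  have hsub : AL x ⊆ U1 ∪ (U2 ∪ U3) := by
    intro p hp
    obtain ⟨z, hz, hz0, hl⟩ := Good.of_mem_AL h.sol h.bd hp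
    have hP0 : p 4 * p 5 * p 6 = 0 := by
      rw [← hz0]
      exact hl.eq h.prod_zero 0 (V := fun y => y 4 * y 5 * y 6) (by fun_prop)
    obtain ⟨-, -, -, n4, n5, n6⟩ := h.AL_DD hp
    have a1 := h.not45 hp
    have a2 := h.not56 hp
    have a3 := h.not64 hp
    rcases mul_eq_zero.1 hP0 with h1 | h1
    · rcases mul_eq_zero.1 h1 with h1 | h1
      · left
        exact ⟨by rw [h1]; exact lt_of_le_of_ne n5 (fun e => a1 ⟨h1, e.symm⟩),
          by rw [h1]; exact lt_of_le_of_ne n6 (fun e => a3 ⟨e.symm, h1⟩)⟩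
      · right; left
        exact ⟨by rw [h1]; exact lt_of_le_of_ne n6 (fun e => a2 ⟨h1, e.symm⟩),
          by rw [h1]; exact lt_of_le_of_ne n4 (fun e => a1 ⟨e.symm, h1⟩)⟩
    · right; right
      exact ⟨by rw [h1]; exact lt_of_le_of_ne n4 (fun e => a3 ⟨h1, e.symm⟩),
          by rw [h1]; exact lt_of_le_of_ne n5 (fun e => a2 ⟨e.symm, h1⟩)⟩
  obtain ⟨T, hT⟩ := eventually_atBot.1 ((h.ev_open (o1.union (o2.union o3)) hsub).and (eventually_le_atBot 0))
  have hcon : IsPreconnected (x '' Iic T) := by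
    refine isPreconnected_Iic.image x (fun t ht => ?_)
    exact (h.sol t (hT t ht).2).1.continuousAt.continuousWithinAt
  have hsub2 : x '' Iic T ⊆ U1 ∪ (U2 ∪ U3) := by
    rintro _ ⟨t, ht, rfl⟩
    exact (hT t ht).1
  have d1 : Disjoint U1 (U2 ∪ U3) := by
    rw [Set.disjoint_left]
    rintro y ⟨a, b⟩ (⟨c, d⟩ | ⟨c, d⟩) <;> linarith
  have d2 : Disjoint U2 U3 := by
    rw [Set.disjoint_left]
    rintro y ⟨a, b⟩ ⟨c, d⟩
    linarith
  have ev : ∀ {U : Set E7}, x '' Iic T ⊆ U → ∀ᶠ t in atBot, x t ∈ U := by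
    intro U hU
    filter_upwards [eventually_le_atBot T] with t ht
    exact hU ⟨t, ht, rfl⟩
  rcases hcon.subset_or_subset o1 (o2.union o3) d1 hsub2 with hh | hh
  · exact h.final1 (ev hh)
  · rcases hcon.subset_or_subset o2 o3 d2 hh with hh | hh
    · exact h.rot.final1 (ev hh)
    · exact h.rot.rot.final1 (ev hh)

end ctx

/-! ### Boundedness to the past -/

lemma T_bound (hG0 : 0 < G) (hG4 : G < 4) : ∃ κ : ℝ, 0 ≤ κ ∧ ∀ Ω u r h : ℝ, 0 ≤ Ω → 0 ≤ r → 0 ≤ h →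
    h ≤ G/8 → Ω + u^2 + r = 1 + h →
    G/4 * (1+u)^2 ≤ 2 * (1+u)^2 + (G-2) * Ω + κ * (Ω * ((4-G) * u^2 + (2-G) * r)) := by
  rcases le_or_gt 2 G with hG | hG
  · refine ⟨0, le_rfl, ?_⟩
    intro Ω u r h hΩ hr hh hh' hc
    have h1 : 0 ≤ (G-2) * Ω := mul_nonneg (by linarith) hΩ
    have h2 : G/4 * (1+u)^2 ≤ 2 * (1+u)^2 := mul_le_mul_of_nonneg_right (by linarith) (sq_nonneg _)
    linarith
  · refine ⟨(16/G)^2, by positivity, ?_⟩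
    intro Ω u r h hΩ hr hh hh' hc
    have hu := sq_nonneg u
    have h1 : Ω * ((2-G) * (u^2 + r)) ≤ Ω * ((4-G) * u^2 + (2-G) * r) :=
      mul_le_mul_of_nonneg_left (by nlinarith) hΩ
    have h2 := mul_le_mul_of_nonneg_left h1 (by positivity : 0 ≤ (16/G)^2)
    have h3 : (16/G)^2 * (Ω * ((2-G) * (u^2 + r))) = (2-G) * Ω * ((16/G)^2 * (u^2 + r)) := by ring
    rw [h3] at h2
    have h0 : 0 ≤ (2-G) * Ω := mul_nonneg (by linarith) hΩ
    rcases le_or_gt 1 ((16/G)^2 * (u^2 + r)) with hw | hw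
    · have h4 : (2-G) * Ω ≤ (2-G) * Ω * ((16/G)^2 * (u^2 + r)) := le_mul_of_one_le_right h0 hw
      have h5 : G/4 * (1+u)^2 ≤ 2 * (1+u)^2 := mul_le_mul_of_nonneg_right (by linarith) (sq_nonneg _)
      linarith
    · have h4 : 0 ≤ (2-G) * Ω * ((16/G)^2 * (u^2 + r)) := by positivity
      have h5 : (16/G * u)^2 < 1 := by
        have : (16/G * u)^2 = (16/G)^2 * u^2 := by ring
        rw [this]
        have : 0 ≤ (16/G)^2 * r := by positivity
        linarith
      have h6 := (abs_lt.1 ((sq_lt_one_iff_abs_lt_one _).1 h5)).1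
      have h7 : -(G/16) < u := by
        have e : u = G/16 * (16/G * u) := by field_simp
        rw [e]
        nlinarith
      have h8 : 1 - G/8 ≤ (1+u)^2 := by nlinarith
      have h9 : (2-G) * Ω ≤ (2-G) * (1+h) := mul_le_mul_of_nonneg_left (by linarith) (by linarith)
      nlinarith

set_option maxHeartbeats 2000000 in
lemma eps_bound {Ω u d e n N h ρ q : ℝ} (hG0 : 0 < G) (hG4 : G < 4) (hΩ : 0 ≤ Ω) (hN : 0 ≤ N)
    (hn : 1 ≤ n) (hNn : N ≤ n) (hh : h = 3/4*(2*N*n - N^2)) (h1 : h ≤ 1)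
    (hc : Ω + u^2 + (d^2/12 + 3/4*e^2) = 1 + h) (hq : q = G/2*Ω + 2*u^2 + d^2/6)
    (hρ : ρ = Ω + (d^2/12 + 3/4*e^2)) :
    |((q-2)*(d*e) + 9*N*e^2)/(6*n) - d^2*e^2/(6*n^2)| ≤ 7/n * (ρ^2 + h) ∧
    |d*e/(6*n)| ≤ 1/n ∧ |Ω * (d*e/(6*n) * (2*q-G))| ≤ 7/n * ρ^2 ∧
    ρ^2 ≤ 18 * (1+u)^2 + 2*h ∧ 0 ≤ h ∧ ρ ≤ 2 := by
  have hn0 : 0 < n := by linarith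
  have hr0 : 0 ≤ d^2/12 + 3/4*e^2 := by positivity
  have hρ0 : 0 ≤ ρ := by linarith
  have hρ2 : ρ ≤ 2 := by linarith [sq_nonneg u]
  have hhN : 3/4 * N * n ≤ h := by rw [hh]; nlinarith
  have hh0 : 0 ≤ h := le_trans (by positivity) hhN
  have hNh : N ≤ 4/3 * h := by nlinarith
  have hu2 : u^2 ≤ 2 := by linarith
  have hde : |d*e| ≤ 2*ρ := by
    rw [abs_le]
    constructor <;> nlinarith [sq_nonneg (d - 3*e), sq_nonneg (d + 3*e)]
  have he : e^2 ≤ 4/3*ρ := by nlinarith [sq_nonneg d]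
  have hd : d^2 ≤ 12*ρ := by nlinarith [sq_nonneg e]
  have hq2 : |q-2| ≤ 2*ρ + 2*h := by
    have e1 : q - 2 = -((2-G/2)*Ω) - 3/2*e^2 + 2*h := by rw [hq]; linarith
    have e2 : 0 ≤ (2-G/2)*Ω := mul_nonneg (by linarith) hΩ
    have e3 : (2-G/2)*Ω ≤ 2*Ω := mul_le_mul_of_nonneg_right (by linarith) hΩ
    rw [abs_le]
    constructor <;> nlinarith [sq_nonneg d, sq_nonneg e]
  have a1 : |(q-2)*(d*e)| ≤ 4*ρ^2 + 8*h := by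
    rw [abs_mul]
    calc _ ≤ (2*ρ+2*h) * (2*ρ) := mul_le_mul hq2 hde (abs_nonneg _) (by positivity)
      _ ≤ _ := by nlinarith
  have a2 : |9*N*e^2| ≤ 32*h := by
    rw [abs_of_nonneg (by positivity)]
    have : N * e^2 ≤ 4/3*h * (4/3*2) := mul_le_mul hNh (by linarith) (by positivity) (by positivity)
    linarith
  have a3 : d^2*e^2 ≤ 4*ρ^2 := by
    have : d^2*e^2 = |d*e|^2 := by rw [sq_abs]; ring
    rw [this]
    nlinarith [abs_nonneg (d*e)]
  have hθ : |d*e/(6*n)| ≤ 2*ρ/(6*n) := by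
    rw [abs_div, abs_of_pos (by positivity : 0 < 6*n)]
    gcongr
  refine ⟨?_, ?_, ?_, ?_, hh0, hρ2⟩
  · have b1 : |((q-2)*(d*e) + 9*N*e^2)/(6*n)| ≤ (4*ρ^2 + 40*h)/(6*n) := by
      rw [abs_div, abs_of_pos (by positivity : 0 < 6*n)]
      gcongr
      exact (abs_add_le _ _).trans (by linarith)
    have b2 : |d^2*e^2/(6*n^2)| ≤ 4*ρ^2/(6*n) := by
      rw [abs_of_nonneg (by positivity)]
      have : (6*n : ℝ) ≤ 6*n^2 := by nlinarith
      gcongr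
    refine (abs_sub _ _).trans ((add_le_add b1 b2).trans ?_)
    rw [← add_div, div_mul_eq_mul_div, div_le_div_iff₀ (by positivity) hn0]
    have b3 : 8*ρ^2+40*h ≤ 42*(ρ^2+h) := by linarith [sq_nonneg ρ]
    have b4 := mul_le_mul_of_nonneg_right b3 hn0.le
    linarith
  · refine hθ.trans ?_
    rw [div_le_div_iff₀ (by positivity) hn0]
    have := mul_le_mul_of_nonneg_right hρ2 hn0.le
    linarith
  · have hqb : |2*q-G| ≤ 20 := by
      have := abs_le.1 hq2
      rw [abs_le]
      constructor <;> linarith [this.1, this.2]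
    rw [abs_mul, abs_mul, abs_of_nonneg hΩ]
    have hΩρ : Ω ≤ ρ := by linarith
    calc Ω * (|d*e/(6*n)| * |2*q-G|) ≤ ρ * (2*ρ/(6*n) * 20) := by
          gcongr
      _ ≤ _ := by
        have : ρ * (2*ρ/(6*n) * 20) = 20/3/n * ρ^2 := by field_simp; ring
        rw [this]
        gcongr
        norm_num
  · have e1 : ρ = (1+u)*(1-u) + h := by linarith
    have e2 : (1-u)^2 ≤ 9 := by nlinarith [sq_nonneg (u+2)]
    have e3 : ρ^2 ≤ 2*((1+u)^2*(1-u)^2) + 2*h^2 := by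
      rw [e1]; nlinarith [sq_nonneg ((1+u)*(1-u) - h)]
    have e4 : (1+u)^2*(1-u)^2 ≤ (1+u)^2*9 := mul_le_mul_of_nonneg_left e2 (sq_nonneg _)
    nlinarith

set_option maxHeartbeats 1000000 in
/-- Key pointwise estimate. -/
lemma E_nonneg (hG0 : 0 < G) (hG4 : G < 4) : ∃ κ : ℝ, 0 ≤ κ ∧ ∃ η : ℝ, 0 < η ∧ η ≤ 1/2 ∧
    ∀ Ω u d e n N h q : ℝ, 0 ≤ Ω → 0 ≤ N → 1 ≤ n → N ≤ n → 1/n ≤ η → N * n ≤ η →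
    h = 3/4*(2*N*n - N^2) → Ω + u^2 + (d^2/12 + 3/4*e^2) = 1 + h →
    q = G/2*Ω + 2*u^2 + d^2/6 →
    0 ≤ 2*(1+u)^2 + (G-2)*Ω + 2*h - (((q-2)*(d*e) + 9*N*e^2)/(6*n) - d^2*e^2/(6*n^2))
      + κ * (Ω * ((4-G)*u^2 + G*h + (2-G)*(d^2/12 + 3/4*e^2) - d*e/(6*n)*(2*q-G)
        - (((q-2)*(d*e) + 9*N*e^2)/(6*n) - d^2*e^2/(6*n^2)))) ∧
    |d*e/(6*n)| ≤ 1/n ∧ Ω ≤ 2 := by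
  obtain ⟨κ, hκ, hT⟩ := T_bound hG0 hG4
  refine ⟨κ, hκ, min (1/2) (min (G/12) (G/(72*(7+21*κ)))), by positivity, min_le_left _ _, ?_⟩
  intro Ω u d e n N h q hΩ hN hn hNn hη hNη hh hc hq
  have hη1 := min_le_left (1/2) (min (G/12) (G/(72*(7+21*κ))))
  have hη23 := min_le_right (1/2) (min (G/12) (G/(72*(7+21*κ))))
  have hη2 := hη23.trans (min_le_left _ _)
  have hη3 := hη23.trans (min_le_right _ _)
  set η := min (1/2) (min (G/12) (G/(72*(7+21*κ))))
  have hhle : h ≤ 3/2*(N*n) := by rw [hh]; nlinarith [sq_nonneg N]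
  have h1 : h ≤ 1 := by linarith
  obtain ⟨b1, b2, b3, b4, b5, b6⟩ := eps_bound hG0 hG4 hΩ hN hn hNn hh h1 hc hq rfl
  set ε := ((q-2)*(d*e) + 9*N*e^2)/(6*n) - d^2*e^2/(6*n^2) with hε
  set ρ := Ω + (d^2/12 + 3/4*e^2) with hρ
  set θ := d*e/(6*n) with hθ
  have hr0 : 0 ≤ d^2/12 + 3/4*e^2 := by positivity
  have hΩ2 : Ω ≤ 2 := by linarith
  refine ⟨?_, b2, hΩ2⟩
  have hTT := hT Ω u _ h hΩ hr0 b5 (by linarith) hc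
  have hn0 : 0 < n := by linarith
  have c0 : 0 ≤ κ * (Ω * (G*h)) := by positivity
  have c1 : κ * (Ω * ε) ≤ κ * (2 * (7/n*(ρ^2+h))) := by
    refine mul_le_mul_of_nonneg_left ?_ hκ
    calc Ω * ε ≤ Ω * |ε| := mul_le_mul_of_nonneg_left (le_abs_self _) hΩ
      _ ≤ _ := mul_le_mul hΩ2 b1 (abs_nonneg _) (by norm_num)
  have c2 : κ * (Ω * (θ*(2*q-G))) ≤ κ * (7/n*ρ^2) :=
    mul_le_mul_of_nonneg_left ((le_abs_self _).trans b3) hκ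
  have c3 : ε ≤ 7/n*(ρ^2+h) := (le_abs_self _).trans b1
  have c4 : κ * (7/n*ρ^2) ≤ κ * (7/n*(ρ^2+h)) := by
    refine mul_le_mul_of_nonneg_left (mul_le_mul_of_nonneg_left (by linarith) (by positivity)) hκ
  have c5 : (7+21*κ) * (1/n*(ρ^2+h)) ≤ G/4*(1+u)^2 + 2*h := by
    have hk : 0 < 7+21*κ := by positivity
    have e1 : 1/n * (ρ^2+h) ≤ G/(72*(7+21*κ)) * (18*(1+u)^2 + 3*h) :=
      mul_le_mul (hη.trans hη3) (by linarith) (by positivity) (by positivity)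
    have e2 : (7+21*κ) * (G/(72*(7+21*κ)) * (18*(1+u)^2 + 3*h)) = G/4*(1+u)^2 + G/24*h := by
      field_simp; ring
    have e3 := mul_le_mul_of_nonneg_left e1 hk.le
    rw [e2] at e3
    have : G/24*h ≤ 2*h := mul_le_mul_of_nonneg_right (by linarith) b5
    linarith
  have e7 : 7/n = 7*(1/n) := by ring
  rw [e7] at c1 c2 c3 c4
  linarith

/-- The Lyapunov function controlling `N₂ N₃` to the past. -/
def MM (κ : ℝ) (y : E7) : ℝ :=
  log (y 5 * y 6) - (y 2 - y 3) * (y 5 - y 6) / (6 * (y 5 + y 6))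
    + κ * (y 0 * (1 - (y 2 - y 3) * (y 5 - y 6) / (6 * (y 5 + y 6))))

set_option maxHeartbeats 1000000 in
lemma hd_MM {x : ℝ → E7} {t κ : ℝ} (hx : HasDerivAt x (FF G (x t)) t) (hD : x t ∈ DD)
    (p5 : 0 < x t 5) (p6 : 0 < x t 6) {Ω u d e n N h q : ℝ} (eΩ : Ω = x t 0) (eu : u = -x t 1/2)
    (ed : d = x t 2 - x t 3) (ee : e = x t 5 - x t 6) (en : n = x t 5 + x t 6) (eN : N = x t 4)
    (eh : h = 3/4*(2*N*n - N^2)) (eq : q = qq G (x t)) :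
    Ω + u^2 + (d^2/12 + 3/4*e^2) = 1 + h ∧ q = G/2*Ω + 2*u^2 + d^2/6 ∧
    HasDerivAt (fun s => MM κ (x s)) (2*(1+u)^2 + (G-2)*Ω + 2*h
      - (((q-2)*(d*e) + 9*N*e^2)/(6*n) - d^2*e^2/(6*n^2))
      + κ * (Ω * ((4-G)*u^2 + G*h + (2-G)*(d^2/12 + 3/4*e^2) - d*e/(6*n)*(2*q-G)
        - (((q-2)*(d*e) + 9*N*e^2)/(6*n) - d^2*e^2/(6*n^2))))) t := by
  have hs : x t 1 = -x t 2 - x t 3 := by linarith [hD.2.1]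
  have hcon := con1 hD
  have hc : Ω + u^2 + (d^2/12 + 3/4*e^2) = 1 + h := by
    rw [eh, eΩ, eu, ed, ee, en, eN]
    unfold r2 at hcon
    linarith
  have hq : q = G/2*Ω + 2*u^2 + d^2/6 := by
    rw [eq, eΩ, eu, ed, qq, hs]; ring
  refine ⟨hc, hq, ?_⟩
  have hd' : HasDerivAt (fun s => x s 2 - x s 3) (-(2-q)*d - 9*e*(n-N)) t := by
    refine ((hd2 hx).sub (hd3 hx)).congr_deriv ?_
    rw [eq, ed, ee, en, eN]; ring
  have he' : HasDerivAt (fun s => x s 5 - x s 6) ((q+2*u)*e + d*n) t := by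
    refine ((hd5 hx).sub (hd6 hx)).congr_deriv ?_
    rw [eq, ed, ee, en, eu, hs]; ring
  have hn' : HasDerivAt (fun s => x s 5 + x s 6) ((q+2*u)*n + d*e) t := by
    refine ((hd5 hx).add (hd6 hx)).congr_deriv ?_
    rw [eq, ed, ee, en, eu, hs]; ring
  have hO' : HasDerivAt (fun s => x s 0) ((2*q-G)*Ω) t := by
    rw [eq, eΩ]; exact hd0 hx
  have hp' : HasDerivAt (fun s => log (x s 5 * x s 6)) (2*(q+2*u)) t := by
    refine ((hd_p hx hD).log (mul_pos p5 p6).ne').congr_deriv ?_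
    rw [mul_div_assoc, div_self (mul_pos p5 p6).ne', eq, eu]; ring
  have n0 : n ≠ 0 := by rw [en]; positivity
  have hθ' : HasDerivAt (fun s => (x s 2 - x s 3) * (x s 5 - x s 6) / (6 * (x s 5 + x s 6)))
      ((d^2 - 9*e^2)/6 + (((q-2)*(d*e) + 9*N*e^2)/(6*n) - d^2*e^2/(6*n^2))) t := by
    refine ((hd'.mul he').div (hn'.const_mul 6) (by rw [← en]; positivity)).congr_deriv ?_
    simp only [Pi.mul_apply]
    rw [← ed, ← ee, ← en]
    field_simp
    ring
  set ε := ((q-2)*(d*e) + 9*N*e^2)/(6*n) - d^2*e^2/(6*n^2) with hε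
  refine ((hp'.sub hθ').add ((hO'.mul (hθ'.const_sub 1)).const_mul κ)).congr_deriv ?_
  rw [← ed, ← ee, ← en, ← eΩ]
  generalize d*e/(6*n) = θ
  have hΩ : Ω = 1 + h - u^2 - (d^2/12 + 3/4*e^2) := by linarith
  rw [hq]
  linear_combination (2 + κ * Ω * G) * hc

lemma small_lem {P0 η : ℝ} (hP : 0 < P0) (hη : 0 < η) (hη2 : η ≤ 1/2) : ∃ K : ℝ, 0 < K ∧
    ∀ N a b : ℝ, 0 < N → 0 < a → 0 < b → N * (a*b) ≤ P0 → K ≤ a*b →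
    3/4*(a-b)^2 ≤ 1 + 3/2*(N*(a+b)) →
    1 ≤ a+b ∧ N ≤ a+b ∧ 1/(a+b) ≤ η ∧ N*(a+b) ≤ η := by
  obtain ⟨ν, hν⟩ : ∃ ν, ν = η^2/(16*(P0+1)) := ⟨_, rfl⟩
  have hν0 : 0 < ν := by rw [hν]; positivity
  have hν1 : 16*(ν * P0) + 16 * ν = η^2 := by rw [hν]; field_simp
  have hνP : 0 < ν * P0 := mul_pos hν0 hP
  have hη3 : η^2 ≤ η/2 := by nlinarith
  refine ⟨P0/ν + 1/η^2, by positivity, ?_⟩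
  intro N a b hN ha hb h1 hK h2
  have k1 : P0/ν ≤ a*b := le_trans (by have : 0 < 1/η^2 := by positivity
                                       linarith) hK
  have k2 : 1/η^2 ≤ a*b := le_trans (by have : 0 < P0/ν := by positivity
                                        linarith) hK
  have hNν : N ≤ ν := by
    rw [div_le_iff₀ hν0] at k1
    have hab : 0 < a*b := by positivity
    by_contra hc
    have := mul_lt_mul_of_pos_right (not_le.1 hc) hab
    linarith
  have hn : 1/η ≤ a+b := by
    refine (sq_le_sq₀ (by positivity) (by positivity)).1 ?_
    rw [div_pow, one_pow]
    nlinarith [sq_nonneg (a-b)]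
  have hn1 : 2 ≤ 1/η := by rw [le_div_iff₀ hη]; linarith
  refine ⟨by linarith, by linarith, ?_, ?_⟩
  · rw [div_le_iff₀ (by positivity)]
    rw [div_le_iff₀ hη] at hn
    linarith
  · by_contra hc
    rw [not_le] at hc
    obtain ⟨X, hX⟩ : ∃ X, X = N*(a+b) := ⟨_, rfl⟩
    rw [← hX] at hc h2
    have hX0 : 0 < X := by linarith
    have e1 : X^2 = N^2*(a-b)^2 + 4*(N*(N*(a*b))) := by rw [hX]; ring
    have e2 : N*(N*(a*b)) ≤ ν*P0 := mul_le_mul hNν h1 (by positivity) hν0.le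
    have e3 : N^2 ≤ ν * (η/32) := by
      have : N^2 = N*N := by ring
      rw [this]
      exact mul_le_mul hNν (by linarith) hN.le hν0.le
    have e4 : N^2*(a-b)^2 ≤ (ν*(η/32)) * (4/3 + 2*X) :=
      mul_le_mul e3 (by linarith) (sq_nonneg _) (by positivity)
    have e5 : η * X ≤ X^2 := by nlinarith
    have e6 : ν ≤ 1/32 := by linarith
    have e7 : ν * (η * X) ≤ 1/32 * X^2 := mul_le_mul e6 e5 (by positivity) (by norm_num)
    have e8 : ν * η ≤ η^2 := by nlinarith
    have e9 : η^2 < X^2 := by nlinarith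
    have e10 : ν*(η/32)*(4/3+2*X) = ν*η/24 + ν*(η*X)/16 := by ring
    linarith

lemma pair_bound {x : ℝ → E7} (hG0 : 0 < G) (hG4 : G < 4) (hs : IsSol G (Iic 0) x)
    (pos : ∀ t ≤ 0, 0 < x t 4 ∧ 0 < x t 5 ∧ 0 < x t 6) :
    ∃ B, ∀ t ≤ 0, x t 5 * x t 6 ≤ B := by
  have hqn : ∀ y ∈ DD, 0 ≤ qq G y := by
    intro y hy
    have := hy.1
    unfold qq; positivity
  have hP : ∀ t ≤ 0, x t 4 * (x t 5 * x t 6) ≤ x 0 4 * (x 0 5 * x 0 6) := by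
    intro t ht
    refine le_of_deriv_nonneg' ht (f := fun t => x t 4 * (x t 5 * x t 6))
      (f' := fun t => 3 * qq G (x t) * (x t 4 * (x t 5 * x t 6))) ?_ ?_
    · intro s hs'
      obtain ⟨h1, h2⟩ := hs s hs'.2
      refine ((hd4 h1).mul (hd_p h1 h2)).congr_deriv ?_
      ring
    · intro s hs'
      have hs0 : s ≤ 0 := hs'.2.le
      obtain ⟨a, b, c⟩ := pos s hs0
      have := hqn _ (hs s hs0).2
      positivity
  obtain ⟨κ, hκ, η, hη, hη2, hE⟩ := E_nonneg hG0 hG4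
  have p0 := pos 0 le_rfl
  obtain ⟨K, hK, hsm⟩ := small_lem (P0 := x 0 4 * (x 0 5 * x 0 6))
    (mul_pos p0.1 (mul_pos p0.2.1 p0.2.2)) hη hη2
  have key : ∀ t ≤ 0, K ≤ x t 5 * x t 6 → (∃ D, HasDerivAt (fun s => MM κ (x s)) D t ∧ 0 ≤ D) ∧
      |MM κ (x t) - log (x t 5 * x t 6)| ≤ 1 + 4*κ := by
    intro t ht hKt
    obtain ⟨h1, h2⟩ := hs t ht
    obtain ⟨a, b, c⟩ := pos t ht
    obtain ⟨hc, hq, hd⟩ := hd_MM (κ := κ) h1 h2 b c rfl rfl rfl rfl rfl rfl rfl rfl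
    have hr : 3/4*(x t 5 - x t 6)^2 ≤ 1 + 3/2*(x t 4*(x t 5+x t 6)) := by
      have := h2.1
      have h4 := sq_nonneg (x t 4)
      have h5 := sq_nonneg (x t 2 - x t 3)
      have h6 := sq_nonneg (-x t 1/2)
      linarith
    obtain ⟨s1, s2, s3, s4⟩ := hsm _ _ _ a b c (hP t ht) hKt hr
    obtain ⟨g1, g2, g3⟩ := hE _ _ _ _ _ _ _ _ h2.1 a.le s1 s2 s3 s4 rfl hc hq
    refine ⟨⟨_, hd, g1⟩, ?_⟩
    have g4 : 1/(x t 5 + x t 6) ≤ 1 := by linarith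
    unfold MM
    set θ := (x t 2 - x t 3) * (x t 5 - x t 6) / (6 * (x t 5 + x t 6))
    have hθ := abs_le.1 (g2.trans g4)
    have m1 : x t 0 * (1-θ) ≤ 2 * 2 := mul_le_mul g3 (by linarith) (by linarith) (by norm_num)
    have m2 : 0 ≤ x t 0 * (1-θ) := mul_nonneg h2.1 (by linarith)
    have m3 := mul_nonneg hκ m2
    have m4 := mul_le_mul_of_nonneg_left m1 hκ
    rw [abs_le]
    constructor <;> linarith
  set K' := max K (x 0 5 * x 0 6) with hK'
  have hK'0 : 0 < K' := lt_of_lt_of_le hK (le_max_left _ _)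
  refine ⟨max K' (exp (log K' + 2*(1+4*κ))), ?_⟩
  intro t ht
  by_contra hcon
  rw [not_le, max_lt_iff] at hcon
  obtain ⟨hc1, hc2⟩ := hcon
  have hcont : ContinuousOn (fun s => x s 5 * x s 6) (Icc t 0) := fun s hs' =>
    (hd_p (hs s hs'.2).1 (hs s hs'.2).2).continuousAt.continuousWithinAt
  have hS : IsCompact (Icc t 0 ∩ (fun s => x s 5 * x s 6) ⁻¹' (Iic K')) :=
    isCompact_Icc.of_isClosed_subset (hcont.preimage_isClosed_of_isClosed isClosed_Icc isClosed_Iic)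
      inter_subset_left
  obtain ⟨s, hsS, hsmin⟩ := hS.exists_isLeast ⟨0, ⟨ht, le_rfl⟩, show x 0 5 * x 0 6 ≤ K' from le_max_right _ _⟩
  obtain ⟨hsI, hsK⟩ := hsS
  have hsK : x s 5 * x s 6 ≤ K' := hsK
  have hgt : ∀ r ∈ Icc t s, r < s → K' < x r 5 * x r 6 := by
    intro r hr hrs
    by_contra hc
    have := hsmin ⟨⟨hr.1, hr.2.trans hsI.2⟩, not_lt.1 hc⟩
    linarith
  have hts : t < s := by
    rcases hsI.1.lt_or_eq with h | h
    · exact h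
    · rw [← h] at hsK; linarith
  have hsK2 : K' ≤ x s 5 * x s 6 := by
    have hct : ContinuousAt (fun s => x s 5 * x s 6) s :=
      (hd_p (hs s hsI.2).1 (hs s hsI.2).2).continuousAt
    have h1 : Tendsto (fun s => x s 5 * x s 6) (𝓝[<] s) (𝓝 (x s 5 * x s 6)) :=
      hct.tendsto.mono_left nhdsWithin_le_nhds
    refine ge_of_tendsto h1 ?_
    filter_upwards [Ioo_mem_nhdsLT hts] with r hr
    exact (hgt r ⟨hr.1.le, hr.2.le⟩ hr.2).le
  have hge : ∀ r ∈ Icc t s, K ≤ x r 5 * x r 6 := by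
    intro r hr
    rcases hr.2.lt_or_eq with h | h
    · exact (le_max_left _ _).trans (hgt r hr h).le
    · rw [h]; exact (le_max_left _ _).trans hsK2
  have hM : MM κ (x t) ≤ MM κ (x s) := by
    refine le_of_deriv_nonneg' hts.le (f := fun t => MM κ (x t))
      (f' := fun r => deriv (fun t => MM κ (x t)) r) ?_ ?_
    · intro r hr
      obtain ⟨⟨D, hD, _⟩, _⟩ := key r (hr.2.trans hsI.2) (hge r hr)
      exact hD.differentiableAt.hasDerivAt
    · intro r hr
      obtain ⟨⟨D, hD, hD0⟩, _⟩ := key r (hr.2.le.trans hsI.2) (hge r ⟨hr.1.le, hr.2.le⟩)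
      show 0 ≤ deriv (fun t => MM κ (x t)) r
      rw [hD.deriv]; exact hD0
  have k1 := abs_le.1 (key t ht (hge t ⟨le_rfl, hts.le⟩)).2
  have k2 := abs_le.1 (key s hsI.2 (hge s ⟨hts.le, le_rfl⟩)).2
  have hl : log (x s 5 * x s 6) ≤ log K' := log_le_log (by linarith) hsK
  have hl2 := log_lt_log (exp_pos _) hc2
  rw [log_exp] at hl2
  linarith

lemma sol_bounded {x : ℝ → E7} (hG0 : 0 < G) (hG4 : G < 4) (hs : IsSol G (Iic 0) x)
    (pos : ∀ t ≤ 0, 0 < x t 4 ∧ 0 < x t 5 ∧ 0 < x t 6) : ∃ R, ∀ t ≤ 0, ‖x t‖ ≤ R := by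
  obtain ⟨B1, h1⟩ := pair_bound hG0 hG4 hs pos
  obtain ⟨B2, h2⟩ := pair_bound hG0 hG4 hs.rot
    (fun t ht => ⟨(pos t ht).2.1, (pos t ht).2.2, (pos t ht).1⟩)
  obtain ⟨B3, h3⟩ := pair_bound hG0 hG4 hs.rot.rot
    (fun t ht => ⟨(pos t ht).2.2, (pos t ht).1, (pos t ht).2.1⟩)
  obtain ⟨S, hS⟩ : ∃ S, S = 6*(1 + 3/2*(B1+B2+B3)) := ⟨_, rfl⟩
  refine ⟨S+1, ?_⟩
  intro t ht
  have e1 := h1 t ht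
  have e2 : x t 6 * x t 4 ≤ B2 := h2 t ht
  have e3 : x t 4 * x t 5 ≤ B3 := h3 t ht
  obtain ⟨d0, d1, d2, -⟩ := (hs t ht).2
  have hS0 : x t 0 ≤ S ∧ x t 1^2 ≤ S ∧ x t 2^2 ≤ S ∧ x t 3^2 ≤ S ∧ x t 4^2 ≤ S ∧ x t 5^2 ≤ S ∧
      x t 6^2 ≤ S := by
    have q1 := sq_nonneg (x t 1)
    have q2 := sq_nonneg (x t 2)
    have q3 := sq_nonneg (x t 3)
    have q4 := sq_nonneg (x t 4)
    have q5 := sq_nonneg (x t 5)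
    have q6 := sq_nonneg (x t 6)
    refine ⟨?_, ?_, ?_, ?_, ?_, ?_, ?_⟩ <;> linarith
  obtain ⟨a0, a1, a2, a3, a4, a5, a6⟩ := hS0
  have hSn : 0 ≤ S := d0.trans a0
  have hab : ∀ y : ℝ, y^2 ≤ S → ‖y‖ ≤ S + 1 := by
    intro y hy
    have h5 := sq_nonneg (y-1)
    have h6 := sq_nonneg (y+1)
    rw [Real.norm_eq_abs, abs_le]
    constructor <;> linarith
  rw [pi_norm_le_iff_of_nonneg (by linarith)]
  intro i
  fin_cases i
  · show ‖x t 0‖ ≤ _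
    rw [Real.norm_eq_abs, abs_of_nonneg d0]; linarith
  · exact hab _ a1
  · exact hab _ a2
  · exact hab _ a3
  · exact hab _ a4
  · exact hab _ a5
  · exact hab _ a6

/-- Passage to symmetric variables. -/
def conv7 (O Sp Sm n1 n2 n3 : ℝ → ℝ) (t : ℝ) : E7 :=
  ![O t, -2 * Sp t, Sp t + √3 * Sm t, Sp t - √3 * Sm t, n1 t, n2 t, n3 t]

lemma sq3 : √3 * √3 = 3 := mul_self_sqrt (by norm_num)

lemma conv7_sol {γ : ℝ} {O Sp Sm n1 n2 n3 : ℝ → ℝ}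
    (hsol : SolOn γ (Set.Iic 0) O Sp Sm n1 n2 n3)
    (hIX : ∀ τ ∈ Set.Iic (0:ℝ), 0 < n1 τ ∧ 0 < n2 τ ∧ 0 < n3 τ) :
    IsSol (3*γ-2) (Iic 0) (conv7 O Sp Sm n1 n2 n3) := by
  intro t ht
  have h3 := sq3
  have hq : qq (3*γ-2) (conv7 O Sp Sm n1 n2 n3 t) = qf γ (O t) (Sp t) (Sm t) := by
    show (3*γ-2)/2 * O t + ((-2*Sp t)^2 + (Sp t + √3 * Sm t)^2 + (Sp t - √3 * Sm t)^2)/3 = _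
    unfold qf
    linear_combination (2/3*(Sm t)^2) * h3
  constructor
  · refine hasDerivAt_pi.2 fun i => ?_
    fin_cases i
    · refine (hsol.hO t ht).congr_deriv ?_
      show _ = (2 * qq _ _ - _) * O t
      rw [hq]
    · refine ((hsol.hSp t ht).const_mul (-2)).congr_deriv ?_
      show _ = -(2 - qq _ _) * (-2 * Sp t) - 3 * (2 * n1 t^2 - n1 t * n2 t - n1 t * n3 t - (n2 t - n3 t)^2)
      rw [hq]; unfold SPf; ring
    · refine ((hsol.hSp t ht).add ((hsol.hSm t ht).const_mul √3)).congr_deriv ?_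
      show _ = -(2 - qq _ _) * (Sp t + √3 * Sm t) - 3 * (2 * n2 t^2 - n2 t * n3 t - n2 t * n1 t - (n3 t - n1 t)^2)
      rw [hq]; unfold SPf SMf
      linear_combination (-3/2 * (n3 t - n2 t) * (n1 t - n2 t - n3 t)) * h3
    · refine ((hsol.hSp t ht).sub ((hsol.hSm t ht).const_mul √3)).congr_deriv ?_
      show _ = -(2 - qq _ _) * (Sp t - √3 * Sm t) - 3 * (2 * n3 t^2 - n3 t * n1 t - n3 t * n2 t - (n1 t - n2 t)^2)
      rw [hq]; unfold SPf SMf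
      linear_combination (3/2 * (n3 t - n2 t) * (n1 t - n2 t - n3 t)) * h3
    · refine (hsol.hn1 t ht).congr_deriv ?_
      show _ = (qq _ _ + 2 * (-2 * Sp t)) * n1 t
      rw [hq]; ring
    · refine (hsol.hn2 t ht).congr_deriv ?_
      show _ = (qq _ _ + 2 * (Sp t + √3 * Sm t)) * n2 t
      rw [hq]; ring
    · refine (hsol.hn3 t ht).congr_deriv ?_
      show _ = (qq _ _ + 2 * (Sp t - √3 * Sm t)) * n3 t
      rw [hq]; ring
  · obtain ⟨a, b, c⟩ := hIX t ht
    refine ⟨hsol.hOnn t ht, ?_, ?_, a.le, b.le, c.le⟩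
    · show -2 * Sp t + (Sp t + √3 * Sm t) + (Sp t - √3 * Sm t) = 0
      ring
    · have hc := hsol.hcon t ht
      unfold Constraint at hc
      show O t + ((-2*Sp t)^2 + (Sp t + √3 * Sm t)^2 + (Sp t - √3 * Sm t)^2)/6 +
        3/4 * (n1 t^2 + n2 t^2 + n3 t^2 - 2*(n1 t * n2 t + n2 t * n3 t + n3 t * n1 t)) = 1
      linear_combination hc + (1/3*(Sm t)^2) * h3

/-- Recovering the original variables from limits. -/
lemma conv7_lim {ι : Type*} {l : Filter ι} {f : ι → ℝ} {O Sp Sm n1 n2 n3 : ℝ → ℝ} {p : E7}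
    (h : Tendsto (fun k => conv7 O Sp Sm n1 n2 n3 (f k)) l (𝓝 p)) :
    Tendsto (fun k => O (f k)) l (𝓝 (p 0)) ∧ Tendsto (fun k => Sp (f k)) l (𝓝 (-(p 1)/2)) ∧
    Tendsto (fun k => Sm (f k)) l (𝓝 (√3 * (p 2 - p 3)/6)) ∧
    Tendsto (fun k => n1 (f k)) l (𝓝 (p 4)) ∧ Tendsto (fun k => n2 (f k)) l (𝓝 (p 5)) ∧
    Tendsto (fun k => n3 (f k)) l (𝓝 (p 6)) := by
  have h' := tendsto_pi_nhds.1 h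
  have h3 := sq3
  refine ⟨h' 0, ?_, ?_, h' 4, h' 5, h' 6⟩
  · refine (((h' 1).neg).div_const 2).congr fun k => ?_
    show -(-2 * Sp (f k))/2 = _
    ring
  · refine ((((h' 2).sub (h' 3)).const_mul √3).div_const 6).congr fun k => ?_
    show √3 * ((Sp (f k) + √3 * Sm (f k)) - (Sp (f k) - √3 * Sm (f k)))/6 = _
    linear_combination (1/3 * Sm (f k)) * h3

lemma tendsto_of_rot {x : ℝ → E7} {l : Filter ℝ} {p : E7}
    (h : Tendsto (fun t => rot (x t)) l (𝓝 p)) : Tendsto x l (𝓝 (rot (rot p))) := by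
  have := (continuous_rot.tendsto _).comp ((continuous_rot.tendsto _).comp h)
  refine this.congr fun t => ?_
  exact rot_rot_rot _

lemma nP_pos (hG0 : 0 < G) (hG4 : G < 4) : 0 < nP G := by
  unfold nP
  refine sqrt_pos.2 ?_
  have : 0 < 1 - G/4 := by linarith
  positivity

lemma mem_DD_of_AL {x : ℝ → E7} (hx : IsSol G (Iic 0) x) {p : E7} (hp : p ∈ AL x) : p ∈ DD := by
  by_contra hn
  have hp' : MapClusterPt p atBot x := hp
  rw [mapClusterPt_iff_frequently] at hp'
  have h1 := hp' DDᶜ (isClosed_DD.isOpen_compl.mem_nhds hn)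
  obtain ⟨t, h2, h3⟩ := (h1.and_eventually (eventually_le_atBot 0)).exists
  exact h2 (hx t h3).2

lemma seq_of_AL {x : ℝ → E7} {p : E7} (hp : p ∈ AL x) :
    ∃ τs : ℕ → ℝ, Tendsto τs atTop atBot ∧ Tendsto (fun k => x (τs k)) atTop (𝓝 p) := by
  have hp' : MapClusterPt p atBot x := hp
  rw [mapClusterPt_iff_frequently] at hp'
  have h1 : ∀ k : ℕ, ∃ t : ℝ, dist (x t) p < 1/((k:ℝ)+1) ∧ t ≤ -(k:ℝ) := by
    intro k
    have h2 := hp' (Metric.ball p (1/((k:ℝ)+1))) (Metric.ball_mem_nhds _ (by positivity))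
    exact (h2.and_eventually (eventually_le_atBot (-(k:ℝ)))).exists
  choose τs hd hle using h1
  refine ⟨τs, ?_, ?_⟩
  · exact tendsto_atBot_mono hle (tendsto_neg_atTop_atBot.comp tendsto_natCast_atTop_atTop)
  · rw [tendsto_iff_dist_tendsto_zero]
    exact squeeze_zero (fun _ => dist_nonneg) (fun k => (hd k).le)
      tendsto_one_div_add_atTop_nhds_zero_nat

lemma tendsto_congr_lim {f : ℝ → ℝ} {l : Filter ℝ} {a b : ℝ} (h : Tendsto f l (𝓝 a)) (e : a = b) :
    Tendsto f l (𝓝 b) := e ▸ h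

/-- a generic Bianchi IX solution with `2/3 < γ < 2` has an α-limit point
on the Kasner circle. -/
theorem bianchiIX_generic_kasner_limit_point
    (γ : ℝ) (hγ1 : 2/3 < γ) (hγ2 : γ < 2)
    (O Sp Sm n1 n2 n3 : ℝ → ℝ)
    (hsol : SolOn γ (Set.Iic 0) O Sp Sm n1 n2 n3)
    (hIX : ∀ τ ∈ Set.Iic (0:ℝ), 0 < n1 τ ∧ 0 < n2 τ ∧ 0 < n3 τ)
    (hgen : Generic γ (Set.Iic 0) O Sp Sm n1 n2 n3) :
    ∃ a b : ℝ, a^2 + b^2 = 1 ∧ AlphaLim O Sp Sm n1 n2 n3 0 a b 0 0 0 := by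
  by_contra hno
  have hG0 : 0 < 3*γ-2 := by linarith
  have hG4 : 3*γ-2 < 4 := by linarith
  have hx := conv7_sol hsol hIX
  have h3 := sq3
  have h3p : 0 < √3 := sqrt_pos.2 (by norm_num)
  have hpos : ∀ t ≤ 0, 0 < conv7 O Sp Sm n1 n2 n3 t 4 ∧ 0 < conv7 O Sp Sm n1 n2 n3 t 5 ∧
      0 < conv7 O Sp Sm n1 n2 n3 t 6 := fun t ht => hIX t ht
  obtain ⟨R, hR⟩ := sol_bounded hG0 hG4 hx hpos
  obtain ⟨hT, hF, hP1, hP2, hP3⟩ := hgen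
  have hnP := nP_pos hG0 hG4
  refine Ctx.contra (G := 3*γ-2) (R := R) (x := conv7 O Sp Sm n1 n2 n3)
    ⟨hG0, hG4, hx, hR, hpos, ?_, ?_, ?_, ?_, ?_, ?_, ?_, ?_⟩
  · rintro p hp ⟨p0, p4, p5, p6⟩
    apply hno
    obtain ⟨τs, ht1, ht2⟩ := seq_of_AL hp
    obtain ⟨l0, l1, l2, l3, l4, l5⟩ := conv7_lim ht2
    obtain ⟨-, d1, d2, -⟩ := mem_DD_of_AL hx hp
    rw [p0] at l0
    rw [p4] at l3
    rw [p5] at l4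
    rw [p6] at l5
    refine ⟨_, _, ?_, τs, ht1, l0, l1, l2, l3, l4, l5⟩
    rw [p0, p4, p5, p6] at d2
    have e : p 1 = -p 2 - p 3 := by linarith
    rw [e] at d2 ⊢
    linear_combination d2 + ((p 2 - p 3)^2/36) * h3
  · intro h
    obtain ⟨l0, l1, l2, l3, l4, l5⟩ := conv7_lim (f := id) h
    refine hF ⟨?_, ?_, ?_, ?_, ?_, ?_⟩
    · exact l0
    · refine tendsto_congr_lim l1 ?_
      show -(0:ℝ)/2 = _
      ring
    · refine tendsto_congr_lim l2 ?_
      show √3 * ((0:ℝ) - 0)/6 = _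
      ring
    · exact l3
    · exact l4
    · exact l5
  · intro h
    obtain ⟨l0, l1, l2, l3, l4, l5⟩ := conv7_lim (f := id) h
    refine hP1 ⟨?_, ?_, ?_, ⟨nP (3*γ-2), hnP, ?_⟩, ?_, ?_⟩
    · exact l0
    · refine tendsto_congr_lim l1 ?_
      show -(-((3*γ-2)/4))/2 = _
      ring
    · refine tendsto_congr_lim l2 ?_
      show √3 * ((3*γ-2)/8 - (3*γ-2)/8)/6 = _
      ring
    · exact l3
    · exact l4
    · exact l5
  · intro h
    obtain ⟨l0, l1, l2, l3, l4, l5⟩ := conv7_lim (f := id) (tendsto_of_rot h)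
    refine hP2 ⟨?_, ?_, ?_, ?_, ⟨nP (3*γ-2), hnP, ?_⟩, ?_⟩
    · exact l0
    · refine tendsto_congr_lim l1 ?_
      show -((3*γ-2)/8)/2 = _
      ring
    · refine tendsto_congr_lim l2 ?_
      show √3 * (-((3*γ-2)/4) - (3*γ-2)/8)/6 = _
      ring
    · exact l3
    · exact l4
    · exact l5
  · intro h
    obtain ⟨l0, l1, l2, l3, l4, l5⟩ := conv7_lim (f := id) (tendsto_of_rot (tendsto_of_rot h))
    refine hP3 ⟨?_, ?_, ?_, ?_, ?_, ⟨nP (3*γ-2), hnP, ?_⟩⟩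
    · exact l0
    · refine tendsto_congr_lim l1 ?_
      show -((3*γ-2)/8)/2 = _
      ring
    · refine tendsto_congr_lim l2 ?_
      show √3 * ((3*γ-2)/8 - -((3*γ-2)/4))/6 = _
      ring
    · exact l3
    · exact l4
    · exact l5
  · intro h
    refine hT (Or.inl fun t ht => ?_)
    obtain ⟨e1, e2⟩ := h t ht
    have e1' : Sp t + √3 * Sm t = Sp t - √3 * Sm t := e1
    refine ⟨?_, e2⟩
    have : √3 * Sm t = 0 := by linarith
    exact (mul_eq_zero.1 this).resolve_left h3p.ne'
  · intro h
    refine hT (Or.inr (Or.inr fun t ht => ?_))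
    obtain ⟨e1, e2⟩ := h t ht
    have e1' : Sp t - √3 * Sm t = -2 * Sp t := e1
    refine ⟨?_, e2⟩
    linear_combination (-1/3 * √3) * e1' - (1/3 * Sm t) * h3
  · intro h
    refine hT (Or.inr (Or.inl fun t ht => ?_))
    obtain ⟨e1, e2⟩ := h t ht
    have e1' : -2 * Sp t = Sp t + √3 * Sm t := e1
    refine ⟨?_, e2⟩
    linear_combination (-1/3 * √3) * e1' - (1/3 * Sm t) * h3

end WainwrightHsu
end
end
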